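/- arXiv:1107.0695 — 14 statements merged into one kernel-verified Lean document; each statement's English description precedes it below -/
import Mathlib

section
/- The lattice P_{a,b,c} is generated over ℤ by the three vectors u = (1/gcd(a,b))·(−b, a, 0), v = (1/gcd(a,c))·(−c, 0, a) and w = (1/gcd(b,c))·(0, −c, b); that is, P_{a,b,c} = { m·u + n·v + p·w : m, n, p ∈ ℤ }. -/
/-- The syzygy `(-b, a)` of `(a, b)`, divided by `gcd a b`, is still a syzygy. -/
lemma Int.mul_neg_ediv_gcd_add_mul_ediv_gcd (a b : ℤ) :
    a * (-b / (Int.gcd a b : ℤ)) + b * (a / (Int.gcd a b : ℤ)) = 0 := by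
  rw [← Int.mul_ediv_assoc a (Int.dvd_neg.2 (Int.gcd_dvd_right a b)),
    ← Int.mul_ediv_assoc b (Int.gcd_dvd_left a b), mul_neg,
    Int.neg_ediv_of_dvd (Dvd.dvd.mul_left (Int.gcd_dvd_right a b) a), mul_comm b a]
  ring

/-- Bézout's identity for three coprime integers. -/
lemma Int.exists_bezout_of_gcd_gcd_eq_one {a b c : ℤ}
    (h : Int.gcd (Int.gcd a b : ℤ) c = 1) : ∃ r s t : ℤ, a * r + b * s + c * t = 1 := by
  have h₁ := Int.gcd_eq_gcd_ab (Int.gcd a b : ℤ) c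
  have h₂ := Int.gcd_eq_gcd_ab a b
  set x := Int.gcdA (Int.gcd a b : ℤ) c
  rw [h, Nat.cast_one] at h₁
  refine ⟨Int.gcdA a b * x, Int.gcdB a b * x, Int.gcdB (Int.gcd a b : ℤ) c, ?_⟩
  linear_combination -h₁ - x * h₂

theorem stmt_0 (a b c d : ℤ)
    (hgcd : Int.gcd (Int.gcd a b : ℤ) c = 1)
    (hsum : a ^ 2 + b ^ 2 + c ^ 2 = 3 * d ^ 2)
    (hd : 1 ≤ d) (hab : ¬(a = 0 ∧ b = 0)) :
    {p : Fin 3 → ℤ | a * p 0 + b * p 1 + c * p 2 = 0} =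
      {v : Fin 3 → ℤ | ∃ m n p : ℤ,
        v = m • ![-b / (Int.gcd a b : ℤ), a / (Int.gcd a b : ℤ), 0]
          + n • ![-c / (Int.gcd a c : ℤ), 0, a / (Int.gcd a c : ℤ)]
          + p • ![0, -c / (Int.gcd b c : ℤ), b / (Int.gcd b c : ℤ)]} := by
  ext q
  simp only [Set.mem_ofPred_eq]
  constructor
  · intro hq
    obtain ⟨r, s, t, h⟩ := Int.exists_bezout_of_gcd_gcd_eq_one hgcd
    have cancel_left (x y : ℤ) : (Int.gcd x y : ℤ) * (x / (Int.gcd x y : ℤ)) = x :=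
      Int.mul_ediv_cancel' (Int.gcd_dvd_left x y)
    have cancel_right (x y : ℤ) : (Int.gcd x y : ℤ) * (-y / (Int.gcd x y : ℤ)) = -y :=
      Int.mul_ediv_cancel' (Int.dvd_neg.2 (Int.gcd_dvd_right x y))
    -- The coefficients come from `q = n × (q × k)` with `n = (a, b, c)`, `k = (r, s, t)`.
    refine ⟨Int.gcd a b * (q 1 * r - q 0 * s), Int.gcd a c * (q 2 * r - q 0 * t),
      Int.gcd b c * (q 2 * s - q 1 * t), ?_⟩
    ext i
    fin_cases i <;> simp
    · linear_combination -q 0 * h + r * hq - (q 1 * r - q 0 * s) * cancel_right a b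
        - (q 2 * r - q 0 * t) * cancel_right a c
    · linear_combination -q 1 * h + s * hq - (q 1 * r - q 0 * s) * cancel_left a b
        - (q 2 * s - q 1 * t) * cancel_right b c
    · linear_combination -q 2 * h + t * hq - (q 2 * r - q 0 * t) * cancel_left a c
        - (q 2 * s - q 1 * t) * cancel_left b c
  · rintro ⟨m, n, p, rfl⟩
    simp
    linear_combination m * Int.mul_neg_ediv_gcd_add_mul_ediv_gcd a b
      + n * Int.mul_neg_ediv_gcd_add_mul_ediv_gcd a c
      + p * Int.mul_neg_ediv_gcd_add_mul_ediv_gcd b c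
end

section
/- There exist integers r and s such that: 2(a² + b²) = s² + 3r²; the number q = a² + b² divides each of rac + dbs, das − bcr, 3dbr − acs, and 3dar + bcs (so that the vectors ζ = (−(rac + dbs)/q, (das − bcr)/q, r) and ς = ((3dbr − acs)/q, −(3dar + bcs)/q, s) have integer coordinates); every coordinate of ζ + ς is even (so that η = (ζ + ς)/2 has integer coordinates); and gcd(a, b) divides both r and s. -/
/-- A positive definite binary quadratic form of discriminant `-3` represents `1`. -/
theorem exists_form_eq_one_of_discr_eq_neg_three (A B C : ℤ) (hA : 0 < A)
    (hB : B ^ 2 + 3 = 4 * A * C) : ∃ x y : ℤ, A * x ^ 2 + B * x * y + C * y ^ 2 = 1 := by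
  induction hn : B.natAbs using Nat.strong_induction_on generalizing A B C with
  | _ n ih =>
    have hC : 0 < C := by
      by_contra! h
      nlinarith [mul_nonneg hA.le (neg_nonneg.mpr h), sq_nonneg B]
    by_cases h₁ : A < |B|
    · rcases abs_cases B with ⟨e, -⟩ | ⟨e, -⟩
      · obtain ⟨x, y, h⟩ := ih (B - 2 * A).natAbs (by omega) A (B - 2 * A) (C - B + A) hA
          (by linear_combination hB) rfl
        exact ⟨x - y, y, by linear_combination h⟩
      · obtain ⟨x, y, h⟩ := ih (B + 2 * A).natAbs (by omega) A (B + 2 * A) (C + B + A) hA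
          (by linear_combination hB) rfl
        exact ⟨x + y, y, by linear_combination h⟩
    by_cases h₂ : C < |B|
    · rcases abs_cases B with ⟨e, -⟩ | ⟨e, -⟩
      · obtain ⟨x, y, h⟩ := ih (B - 2 * C).natAbs (by omega) (A - B + C) (B - 2 * C) C
          (by nlinarith [sq_nonneg (B - 2 * C)]) (by linear_combination hB) rfl
        exact ⟨x, y - x, by linear_combination h⟩
      · obtain ⟨x, y, h⟩ := ih (B + 2 * C).natAbs (by omega) (A + B + C) (B + 2 * C) C
          (by nlinarith [sq_nonneg (B + 2 * C)]) (by linear_combination hB) rfl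
        exact ⟨x, y + x, by linear_combination h⟩
    push Not at h₁ h₂
    have hBB : B ^ 2 ≤ A * C := by
      rw [← sq_abs, sq]
      exact mul_le_mul h₁ h₂ (abs_nonneg B) hA.le
    have hAC : A * C = 1 := by nlinarith [mul_pos hA hC]
    exact ⟨1, 0, by simpa using Int.eq_one_of_mul_eq_one_right hA.le hAC⟩

/-- If `q ≡ 2 [ZMOD 4]` divides `a ^ 2 + b ^ 2` and `3 * d ^ 2 - c ^ 2`, then `2 * q` is represented
by `s ^ 2 + 3 * r ^ 2` compatibly with the square roots of `-1` and `3` modulo `q` given by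
`(a, b)` and `(c, d)`. -/
theorem exists_two_mul_eq_sq_add_three_mul_sq {a b c d q : ℤ} (hq : 0 < q) (hq4 : q % 4 = 2)
    (ha : Odd a) (hc : Odd c) (hb : IsCoprime b q) (hd : IsCoprime d q)
    (hab : q ∣ a ^ 2 + b ^ 2) (hcd : q ∣ 3 * d ^ 2 - c ^ 2) :
    ∃ r s : ℤ, 2 * q = s ^ 2 + 3 * r ^ 2 ∧ q ∣ r * a * c + d * b * s ∧
      q ∣ d * a * s - b * c * r ∧ q ∣ 3 * d * b * r - a * c * s ∧
      q ∣ 3 * d * a * r + b * c * s := by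
  obtain ⟨m, rfl, hm⟩ : ∃ m, q = 2 * m ∧ m % 2 = 1 := ⟨q / 2, by omega, by omega⟩
  have hdb : IsCoprime (d * b) (2 * m) := hd.mul_left hb
  obtain ⟨k, hk⟩ : ∃ k, 2 * m ∣ d * b * k + a * c := by
    obtain ⟨u, v, h⟩ := hdb
    exact ⟨-(u * (a * c)), a * c * v, by linear_combination (-(a * c)) * h⟩
  have hk2 : 2 * m ∣ k ^ 2 + 3 := by
    refine (hdb.pow_left (m := 2)).symm.dvd_of_dvd_mul_left ?_
    have := ((hk.mul_right (d * b * k - a * c)).add (hab.mul_right (c ^ 2))).add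
      (hcd.mul_right (b ^ 2))
    convert this using 1
    ring
  have hkodd : Odd k := by
    have h2 : (2 : ℤ) ∣ d * b * k + a * c := (Dvd.intro _ rfl).trans hk
    have hac : Odd (a * c) := ha.mul hc
    by_contra hke
    rw [Int.not_odd_iff_even] at hke
    have : Odd (d * b * k + a * c) := (hke.mul_left _).add_odd hac
    exact (Int.not_even_iff_odd.mpr this) (even_iff_two_dvd.mpr h2)
  obtain ⟨C, hC⟩ : 4 * m ∣ k ^ 2 + 3 := by
    have h4 : (4 : ℤ) ∣ k ^ 2 + 3 := by
      obtain ⟨j, rfl⟩ := hkodd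
      exact ⟨j ^ 2 + j + 1, by ring⟩
    refine IsCoprime.mul_dvd ?_ h4 ((Dvd.intro_left _ rfl).trans hk2)
    exact ⟨-((m ^ 2 - 1) / 4), m, by
      have : (4 : ℤ) ∣ m ^ 2 - 1 := by
        obtain ⟨j, rfl⟩ : ∃ j, m = 2 * j + 1 := ⟨m / 2, by omega⟩
        exact ⟨j ^ 2 + j, by ring⟩
      linear_combination -(Int.ediv_mul_cancel this)⟩
  obtain ⟨x, y, hxy⟩ := exists_form_eq_one_of_discr_eq_neg_three m k C (by omega) hC
  obtain ⟨s, hs⟩ : ∃ s, s = k * y + 2 * m * x := ⟨_, rfl⟩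
  have h₁ : 2 * m ∣ y * a * c + d * b * s := by
    rw [hs]
    rw [show y * a * c + d * b * (k * y + 2 * m * x) =
      (d * b * k + a * c) * y + 2 * m * (d * b * x) by ring]
    exact (hk.mul_right y).add (dvd_mul_right ..)
  have h₂ : 2 * m ∣ d * a * s - b * c * y := by
    refine hb.symm.dvd_of_dvd_mul_left ?_
    convert (h₁.mul_right a).sub (hab.mul_right (c * y)) using 1
    ring
  refine ⟨y, s, ?_, h₁, h₂, ?_, ?_⟩
  · rw [hs]
    linear_combination (-4 * m) * hxy - y ^ 2 * hC
  · refine hd.symm.dvd_of_dvd_mul_left ?_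
    convert (hcd.mul_right (b * y)).sub (h₂.mul_right c) using 1
    ring
  · refine hd.symm.dvd_of_dvd_mul_left ?_
    convert (hcd.mul_right (a * y)).add (h₁.mul_right c) using 1
    ring

theorem odd_of_sq_add_sq_add_sq_eq_three_mul_sq {a b c d : ℤ}
    (hgcd : Int.gcd (Int.gcd a b : ℤ) c = 1) (hsum : a ^ 2 + b ^ 2 + c ^ 2 = 3 * d ^ 2) :
    Odd a ∧ Odd b ∧ Odd c ∧ Odd d := by
  have hne : ¬(2 ∣ a ∧ 2 ∣ b ∧ 2 ∣ c) := by
    rintro ⟨ha, hb, hc⟩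
    have := Int.dvd_coe_gcd (Int.dvd_coe_gcd ha hb) hc
    rw [hgcd] at this
    omega
  have hmod (x : ℤ) : x % 2 = 0 ∧ x ^ 2 % 4 = 0 ∨ x % 2 = 1 ∧ x ^ 2 % 4 = 1 := by
    rcases Int.emod_two_eq_zero_or_one x with h | h
    · exact .inl ⟨h, by
        obtain ⟨j, rfl⟩ := Int.dvd_of_emod_eq_zero h
        ring_nf; omega⟩
    · exact .inr ⟨h, Int.sq_mod_four_eq_one_of_odd (Int.odd_iff.mpr h)⟩
  simp only [Int.odd_iff]
  have ha := hmod a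
  have hb := hmod b
  have hc := hmod c
  have hd := hmod d
  omega


theorem stmt_3 (a b c d : ℤ)
    (hgcd : Int.gcd (Int.gcd a b : ℤ) c = 1)
    (hsum : a ^ 2 + b ^ 2 + c ^ 2 = 3 * d ^ 2)
    (hd : 1 ≤ d) (hab : ¬(a = 0 ∧ b = 0)) :
    ∃ r s : ℤ,
      2 * (a ^ 2 + b ^ 2) = s ^ 2 + 3 * r ^ 2 ∧
      (a ^ 2 + b ^ 2) ∣ (r * a * c + d * b * s) ∧
      (a ^ 2 + b ^ 2) ∣ (d * a * s - b * c * r) ∧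
      (a ^ 2 + b ^ 2) ∣ (3 * d * b * r - a * c * s) ∧
      (a ^ 2 + b ^ 2) ∣ (3 * d * a * r + b * c * s) ∧
      (∀ i : Fin 3,
        Even ((![-(r * a * c + d * b * s) / (a ^ 2 + b ^ 2),
                  (d * a * s - b * c * r) / (a ^ 2 + b ^ 2), r] : Fin 3 → ℤ) i +
              (![(3 * d * b * r - a * c * s) / (a ^ 2 + b ^ 2),
                  -(3 * d * a * r + b * c * s) / (a ^ 2 + b ^ 2), s] : Fin 3 → ℤ) i)) ∧
      (Int.gcd a b : ℤ) ∣ r ∧ (Int.gcd a b : ℤ) ∣ s := by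
  obtain ⟨ha, hb, hc, hd'⟩ := odd_of_sq_add_sq_add_sq_eq_three_mul_sq hgcd hsum
  have hg : IsCoprime (Int.gcd a b : ℤ) c := Int.isCoprime_iff_gcd_eq_one.mpr hgcd
  have hg0 : 0 < Int.gcd a b := Int.gcd_pos_iff.mpr (by tauto)
  have hh0 : 0 < Int.gcd c d := Int.gcd_pos_iff.mpr (by omega)
  obtain ⟨a', b', hab', ea, eb⟩ := Int.exists_gcd_one hg0
  obtain ⟨c', d', hcd', ec, ed⟩ := Int.exists_gcd_one hh0
  have hgh : IsCoprime (Int.gcd a b : ℤ) (Int.gcd c d : ℤ) :=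
    hg.of_isCoprime_of_dvd_right (Int.gcd_dvd_left ..)
  have hg0' : (0 : ℤ) < Int.gcd a b := by exact_mod_cast hg0
  have hh0' : (0 : ℤ) < Int.gcd c d := by exact_mod_cast hh0
  generalize (Int.gcd a b : ℤ) = g at *
  generalize (Int.gcd c d : ℤ) = h at *
  rw [← Int.isCoprime_iff_gcd_eq_one] at hab' hcd'
  have hkey : g ^ 2 * (a' ^ 2 + b' ^ 2) = h ^ 2 * (3 * d' ^ 2 - c' ^ 2) := by
    subst ea eb ec ed
    linear_combination hsum
  obtain ⟨q, hq⟩ : h ^ 2 ∣ a' ^ 2 + b' ^ 2 :=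
    (hgh.pow (m := 2) (n := 2)).symm.dvd_of_dvd_mul_left (Dvd.intro _ hkey.symm)
  have hq' : 3 * d' ^ 2 - c' ^ 2 = g ^ 2 * q := by
    refine mul_left_cancel₀ (pow_ne_zero 2 hh0'.ne') ?_
    linear_combination g ^ 2 * hq - hkey
  have hQ : a ^ 2 + b ^ 2 = (g * h) ^ 2 * q := by
    rw [ea, eb]
    linear_combination g ^ 2 * hq
  have hQpos : 0 < a ^ 2 + b ^ 2 := by
    have : a ≠ 0 := by rintro rfl; simp at ha
    positivity
  have hQ4 : (a ^ 2 + b ^ 2) % 4 = 2 := by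
    have := Int.sq_mod_four_eq_one_of_odd ha
    have := Int.sq_mod_four_eq_one_of_odd hb
    omega
  have hqpos : 0 < q := by
    rw [hQ] at hQpos
    exact pos_of_mul_pos_right hQpos (sq_nonneg _)
  have hgodd : Odd g := (Int.odd_mul.mp (ea ▸ ha)).2
  have hhodd : Odd h := (Int.odd_mul.mp (ec ▸ hc)).2
  have hq4 : q % 4 = 2 := by
    rw [hQ, Int.mul_emod, Int.sq_mod_four_eq_one_of_odd (hgodd.mul hhodd)] at hQ4
    omega
  have hbq : IsCoprime b' q := by
    have : IsCoprime b' (a' ^ 2 + b' ^ 2) := by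
      have := (hab'.symm.pow_right (n := 2)).add_mul_left_right b'
      rwa [← sq] at this
    exact this.of_isCoprime_of_dvd_right (Dvd.intro_left _ hq.symm)
  have hdq : IsCoprime d' q := by
    have : IsCoprime d' (3 * d' ^ 2 - c' ^ 2) := by
      rw [show 3 * d' ^ 2 - c' ^ 2 = -c' ^ 2 + d' * (3 * d') by ring]
      exact (hcd'.symm.pow_right (n := 2)).neg_right.add_mul_left_right (3 * d')
    exact this.of_isCoprime_of_dvd_right (Dvd.intro_left _ hq'.symm)
  obtain ⟨r, s, hrs, ⟨u, hu⟩, ⟨w, hw⟩, ⟨v, hv⟩, ⟨z, hz⟩⟩ :=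
    exists_two_mul_eq_sq_add_three_mul_sq hqpos hq4 (Int.odd_mul.mp (ea ▸ ha)).1
      (Int.odd_mul.mp (ec ▸ hc)).1 hbq hdq (Dvd.intro_left _ hq.symm) (Dvd.intro_left _ hq'.symm)
  obtain ⟨R, hR⟩ : ∃ R, R = g * h * r := ⟨_, rfl⟩
  obtain ⟨S, hS⟩ : ∃ S, S = g * h * s := ⟨_, rfl⟩
  have hRS : 2 * (a ^ 2 + b ^ 2) = S ^ 2 + 3 * R ^ 2 := by
    rw [hQ, hR, hS]
    linear_combination (g * h) ^ 2 * hrs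
  have hu' : R * a * c + d * b * S = (a ^ 2 + b ^ 2) * u := by
    rw [hQ, hR, hS, ea, eb, ec, ed]
    linear_combination (g * h) ^ 2 * hu
  have hw' : d * a * S - b * c * R = (a ^ 2 + b ^ 2) * w := by
    rw [hQ, hR, hS, ea, eb, ec, ed]
    linear_combination (g * h) ^ 2 * hw
  have hv' : 3 * d * b * R - a * c * S = (a ^ 2 + b ^ 2) * v := by
    rw [hQ, hR, hS, ea, eb, ec, ed]
    linear_combination (g * h) ^ 2 * hv
  have hz' : 3 * d * a * R + b * c * S = (a ^ 2 + b ^ 2) * z := by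
    rw [hQ, hR, hS, ea, eb, ec, ed]
    linear_combination (g * h) ^ 2 * hz
  have hpar : Even (R + S) := by
    have : Even (S ^ 2 + 3 * R ^ 2) := hRS ▸ even_two_mul _
    simpa [Int.even_add, Int.even_mul, Int.even_pow, iff_comm, show ¬ Even (3 : ℤ) by decide]
      using this
  have heven {x y t : ℤ} (hx : Odd x) (hy : Odd y)
      (h : (a ^ 2 + b ^ 2) * t = x * (R + S) + y * (S - 3 * R)) : Even t := by
    obtain ⟨m, hm⟩ : ∃ m, a ^ 2 + b ^ 2 = 4 * m + 2 := ⟨(a ^ 2 + b ^ 2) / 4, by omega⟩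
    obtain ⟨i, hi⟩ := hx.add_odd hy
    obtain ⟨j, hj⟩ := hpar
    exact ⟨i * j - y * R - m * t, by
      refine mul_left_cancel₀ (two_ne_zero (α := ℤ)) ?_
      linear_combination h - t * hm + (R + S) * hi + 2 * i * hj⟩
  refine ⟨R, S, hRS, ⟨u, hu'⟩, ⟨w, hw'⟩, ⟨v, hv'⟩, ⟨z, hz'⟩, ?_,
    ⟨h * r, by rw [hR]; ring⟩, ⟨h * s, by rw [hS]; ring⟩⟩
  rw [hu', hw', hv', hz', ← mul_neg, ← mul_neg]
  simp only [Int.mul_ediv_cancel_left _ hQpos.ne']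
  intro i
  fin_cases i
  · refine heven (t := -u + v) (ha.mul hc).neg (hd'.mul hb).neg ?_
    linear_combination hu' - hv'
  · refine heven (t := w + -z) (hb.mul hc).neg (hd'.mul ha) ?_
    linear_combination hz' - hw'
  · exact hpar
end

section
/- The vectors ζ and ς satisfy: ζ·ζ = 2d², ς·ς = 6d², ζ·ς = 0, aζ₁ + bζ₂ + cζ₃ = 0 and aς₁ + bς₂ + cς₃ = 0 (so that ζ and ς are orthogonal to each other, orthogonal to (a, b, c), and have lengths d√2 and d√6 respectively). -/
theorem stmt_4 (a b c d r s : ℤ)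
    (hgcd : Int.gcd (Int.gcd a b : ℤ) c = 1)
    (hsum : a ^ 2 + b ^ 2 + c ^ 2 = 3 * d ^ 2)
    (hd : 1 ≤ d) (hab : ¬(a = 0 ∧ b = 0))
    (hq : 2 * (a ^ 2 + b ^ 2) = s ^ 2 + 3 * r ^ 2)
    (h1 : (a ^ 2 + b ^ 2) ∣ (r * a * c + d * b * s))
    (h2 : (a ^ 2 + b ^ 2) ∣ (d * a * s - b * c * r))
    (h3 : (a ^ 2 + b ^ 2) ∣ (3 * d * b * r - a * c * s))
    (h4 : (a ^ 2 + b ^ 2) ∣ (3 * d * a * r + b * c * s))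
    (ζ ς : Fin 3 → ℤ)
    (hζ : ζ = ![-(r * a * c + d * b * s) / (a ^ 2 + b ^ 2),
                 (d * a * s - b * c * r) / (a ^ 2 + b ^ 2), r])
    (hς : ς = ![(3 * d * b * r - a * c * s) / (a ^ 2 + b ^ 2),
                 -(3 * d * a * r + b * c * s) / (a ^ 2 + b ^ 2), s]) :
    (∑ i, ζ i * ζ i) = 2 * d ^ 2 ∧
    (∑ i, ς i * ς i) = 6 * d ^ 2 ∧
    (∑ i, ζ i * ς i) = 0 ∧
    a * ζ 0 + b * ζ 1 + c * ζ 2 = 0 ∧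
    a * ς 0 + b * ς 1 + c * ς 2 = 0 := by
  have hpos : a ^ 2 + b ^ 2 ≠ 0 := by
    intro h
    exact hab ⟨by nlinarith [sq_nonneg a, sq_nonneg b], by nlinarith [sq_nonneg a, sq_nonneg b]⟩
  obtain ⟨x, hx⟩ := h1
  obtain ⟨y, hy⟩ := h2
  obtain ⟨z, hz⟩ := h3
  obtain ⟨w, hw⟩ := h4
  rw [hx, hy, ← mul_neg, Int.mul_ediv_cancel_left _ hpos, Int.mul_ediv_cancel_left _ hpos] at hζ
  rw [hz, hw, ← mul_neg, Int.mul_ediv_cancel_left _ hpos, Int.mul_ediv_cancel_left _ hpos] at hς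
  subst hζ hς
  simp only [Fin.sum_univ_three, Matrix.cons_val]
  have hpos2 := mul_ne_zero hpos hpos
  refine ⟨mul_left_cancel₀ hpos2 ?_, mul_left_cancel₀ hpos2 ?_, mul_left_cancel₀ hpos2 ?_,
    mul_left_cancel₀ hpos ?_, mul_left_cancel₀ hpos ?_⟩
  · linear_combination -((a ^ 2 + b ^ 2) * x + (r * a * c + d * b * s)) * hx
      - ((a ^ 2 + b ^ 2) * y + (d * a * s - b * c * r)) * hy
      + (a ^ 2 + b ^ 2) * (r ^ 2 * hsum - d ^ 2 * hq)
  · linear_combination -((a ^ 2 + b ^ 2) * z + (3 * d * b * r - a * c * s)) * hz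
      - ((a ^ 2 + b ^ 2) * w + (3 * d * a * r + b * c * s)) * hw
      + (a ^ 2 + b ^ 2) * (s ^ 2 * hsum - 3 * d ^ 2 * hq)
  · linear_combination (a ^ 2 + b ^ 2) * z * hx + (r * a * c + d * b * s) * hz
      + (a ^ 2 + b ^ 2) * w * hy + (d * a * s - b * c * r) * hw
      + (a ^ 2 + b ^ 2) * r * s * hsum
  · linear_combination a * hx - b * hy
  · linear_combination -a * hz + b * hw
end

section
/- If P, Q ∈ P_{a,b,c} with P ≠ Q and the triangle with vertices 0, P, Q is equilateral (i.e., ‖P‖ = ‖Q‖ = ‖P − Q‖), then there exist integers m, n such that the squared side length satisfies ‖P‖² = 2d²·(m² − mn + n²); in particular the side length is d·√(2(m² − mn + n²)). -/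
/-- Rounding to the nearest multiple of `e`. -/
theorem exists_two_mul_abs_sub_mul_le (x e : ℤ) (he : 0 < e) :
    ∃ u : ℤ, 2 * |x - e * u| ≤ e := by
  refine ⟨(2 * x + e) / (2 * e), ?_⟩
  have h1 := Int.emod_add_mul_ediv (2 * x + e) (2 * e)
  have h2 := Int.emod_nonneg (2 * x + e) (b := 2 * e) (by omega)
  have h3 := Int.emod_lt_of_pos (2 * x + e) (b := 2 * e) (by omega)
  have h4 : |2 * (x - e * ((2 * x + e) / (2 * e)))| ≤ e := abs_le.2 ⟨by linarith, by linarith⟩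
  rwa [abs_mul, abs_two] at h4

/-- The Davenport–Cassels descent for the form `x ^ 2 - x * y + y ^ 2`: an integer represented
over the rationals is represented over the integers. -/
theorem exists_eq_sq_sub_mul_add_sq_of_mul_sq (t : ℤ) {e x y : ℤ} (he : 0 < e)
    (h : t * e ^ 2 = x ^ 2 - x * y + y ^ 2) : ∃ m n : ℤ, t = m ^ 2 - m * n + n ^ 2 := by
  induction hk : e.toNat using Nat.strong_induction_on generalizing e x y with
  | _ k ih =>
  obtain ⟨u, hu⟩ := exists_two_mul_abs_sub_mul_le x e he
  obtain ⟨v, hv⟩ := exists_two_mul_abs_sub_mul_le y e he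
  set r := x - e * u with hr
  set s := y - e * v with hs
  have hr2 : 4 * r ^ 2 ≤ e ^ 2 := by nlinarith [abs_nonneg r, sq_abs r]
  have hs2 : 4 * s ^ 2 ≤ e ^ 2 := by nlinarith [abs_nonneg s, sq_abs s]
  set e' := e * t - (2 * x * u - x * v - y * u + 2 * y * v) + e * (u ^ 2 - u * v + v ^ 2) with he'
  have hee : e * e' = r ^ 2 - r * s + s ^ 2 := by
    rw [he', hr, hs]; linear_combination h
  have hlt : e' < e := by nlinarith [sq_nonneg (r + s)]
  have hnn : 0 ≤ e' := by
    by_contra! hneg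
    nlinarith [sq_nonneg (r - s), sq_nonneg r, sq_nonneg s, mul_pos he (neg_pos.2 hneg)]
  rcases hnn.eq_or_lt with h0 | hpos
  · rw [← h0, mul_zero] at hee
    have hr0 : r = 0 := by
      apply pow_eq_zero_iff two_ne_zero |>.1
      nlinarith [sq_nonneg (r - s), sq_nonneg r, sq_nonneg s]
    have hs0 : s = 0 := by
      apply pow_eq_zero_iff two_ne_zero |>.1
      nlinarith [sq_nonneg (r - s), sq_nonneg r, sq_nonneg s]
    have hx : x = e * u := by linarith
    have hy : y = e * v := by linarith
    refine ⟨u, v, mul_right_cancel₀ (pow_ne_zero 2 he.ne') ?_⟩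
    rw [h, hx, hy]; ring
  · refine ih e'.toNat (by omega) (e := e')
      (x := e' * u + r * (u ^ 2 - u * v + v ^ 2 - t))
      (y := e' * v + s * (u ^ 2 - u * v + v ^ 2 - t)) hpos ?_ rfl
    have hB : 2 * u * r - u * s - v * r + 2 * v * s
        = e * t - e * (u ^ 2 - u * v + v ^ 2) - e' := by
      rw [he', hr, hs]; ring
    linear_combination (-(u ^ 2 - u * v + v ^ 2 - t) * e') * hB
      + (u ^ 2 - u * v + v ^ 2 - t) ^ 2 * hee

/-- A vector whose cross product with a unimodular vector vanishes modulo `d` is, modulo `d`, a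
multiple of that vector. -/
theorem exists_eq_mul_add_mul_of_dvd_cross {a b c u v w d p q r : ℤ}
    (huvw : u * a + v * b + w * c = 1)
    (h₁ : d ∣ b * r - c * q) (h₂ : d ∣ c * p - a * r) (h₃ : d ∣ a * q - b * p) :
    ∃ l x y z : ℤ, p = l * a + d * x ∧ q = l * b + d * y ∧ r = l * c + d * z := by
  obtain ⟨k₁, h₁⟩ := h₁
  obtain ⟨k₂, h₂⟩ := h₂
  obtain ⟨k₃, h₃⟩ := h₃
  refine ⟨u * p + v * q + w * r, w * k₂ - v * k₃, u * k₃ - w * k₁, v * k₁ - u * k₂, ?_, ?_, ?_⟩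
  · linear_combination (-p) * huvw + w * h₂ - v * h₃
  · linear_combination (-q) * huvw + u * h₃ - w * h₁
  · linear_combination (-r) * huvw + v * h₁ - u * h₂

/-- Reflecting `(a, b, c)` to `(d, d, d)` shows that half the norm of a vector orthogonal to
`(a, b, c)` is rationally represented by `x ^ 2 - x * y + y ^ 2`. -/
theorem exists_mul_sq_eq_of_orthogonal {a b c d p q r m : ℤ} (hd : 0 < d)
    (hsum : a ^ 2 + b ^ 2 + c ^ 2 = 3 * d ^ 2)
    (horth : a * p + b * q + c * r = 0) (hm : p ^ 2 + q ^ 2 + r ^ 2 = 2 * m) :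
    ∃ e x y : ℤ, 0 < e ∧ m * e ^ 2 = x ^ 2 - x * y + y ^ 2 := by
  have hD : 0 ≤ (a - d) ^ 2 + (b - d) ^ 2 + (c - d) ^ 2 := by positivity
  rcases hD.eq_or_lt with h0 | hpos
  · have ha : a = d := by nlinarith [sq_nonneg (a - d), sq_nonneg (b - d), sq_nonneg (c - d)]
    have hb : b = d := by nlinarith [sq_nonneg (a - d), sq_nonneg (b - d), sq_nonneg (c - d)]
    have hc : c = d := by nlinarith [sq_nonneg (a - d), sq_nonneg (b - d), sq_nonneg (c - d)]
    subst ha hb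
    rw [hc] at horth
    have hr : r = -(p + q) := by
      apply mul_left_cancel₀ hd.ne'
      linear_combination horth
    refine ⟨1, p, -q, one_pos, ?_⟩
    rw [hr] at hm
    linarith
  · set D := (a - d) ^ 2 + (b - d) ^ 2 + (c - d) ^ 2 with hDdef
    set σ := p + q + r with hσ
    have hD' : D = -2 * d * (a + b + c - 3 * d) := by rw [hDdef]; linear_combination hsum
    have hs : p * (a - d) + q * (b - d) + r * (c - d) = -d * σ := by
      rw [hσ]; linear_combination horth
    obtain ⟨x, hx⟩ : ∃ x, x = D * p + 2 * d * σ * (a - d) := ⟨_, rfl⟩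
    obtain ⟨y, hy⟩ : ∃ y, y = D * q + 2 * d * σ * (b - d) := ⟨_, rfl⟩
    obtain ⟨z, hz⟩ : ∃ z, z = D * r + 2 * d * σ * (c - d) := ⟨_, rfl⟩
    have hxyz : z = -(x + y) := by
      rw [hx, hy, hz]; linear_combination σ * hD' - D * hσ
    have hsq : x ^ 2 + y ^ 2 + z ^ 2 = 2 * (m * D ^ 2) := by
      rw [hx, hy, hz]
      linear_combination D ^ 2 * hm + 4 * d * σ * D * hs - 4 * d ^ 2 * σ ^ 2 * hDdef
    rw [hxyz] at hsq
    exact ⟨D, x, -y, hpos, by linarith⟩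

theorem stmt_6 (a b c d : ℤ)
    (hgcd : Int.gcd (Int.gcd a b : ℤ) c = 1)
    (hsum : a ^ 2 + b ^ 2 + c ^ 2 = 3 * d ^ 2)
    (hd : 1 ≤ d) (hab : ¬(a = 0 ∧ b = 0))
    (P Q : Fin 3 → ℤ)
    (hP : a * P 0 + b * P 1 + c * P 2 = 0)
    (hQ : a * Q 0 + b * Q 1 + c * Q 2 = 0)
    (hPQ : P ≠ Q)
    (heq1 : (∑ i, P i ^ 2) = (∑ i, Q i ^ 2))
    (heq2 : (∑ i, Q i ^ 2) = (∑ i, (P i - Q i) ^ 2)) :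
    ∃ m n : ℤ, (∑ i, P i ^ 2) = 2 * d ^ 2 * (m ^ 2 - m * n + n ^ 2) := by
  have hne : (∑ i, P i ^ 2) ≠ 0 := by
    intro h0
    apply hPQ
    rw [heq1, heq2, Finset.sum_eq_zero_iff_of_nonneg fun i _ => sq_nonneg _] at h0
    funext i
    exact sub_eq_zero.1 (pow_eq_zero_iff two_ne_zero |>.1 (h0 i (Finset.mem_univ i)))
  simp only [Fin.sum_univ_three] at heq1 heq2 hne ⊢
  generalize P 0 = p₁, P 1 = p₂, P 2 = p₃, Q 0 = q₁, Q 1 = q₂, Q 2 = q₃ at *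
  obtain ⟨u, v, w, huvw⟩ : ∃ u v w : ℤ, u * a + v * b + w * c = 1 := by
    have h1 := Int.gcd_eq_gcd_ab a b
    have h2 := Int.gcd_eq_gcd_ab (Int.gcd a b : ℤ) c
    rw [hgcd] at h2
    push_cast at h2
    exact ⟨a.gcdA b * Int.gcdA (a.gcd b) c, a.gcdB b * Int.gcdA (a.gcd b) c,
      Int.gcdB (a.gcd b) c, by linear_combination -h2 - Int.gcdA (a.gcd b) c * h1⟩
  obtain ⟨M, hM⟩ : ∃ M, M = p₁ * q₁ + p₂ * q₂ + p₃ * q₃ := ⟨_, rfl⟩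
  have hPP : p₁ ^ 2 + p₂ ^ 2 + p₃ ^ 2 = 2 * M := by rw [hM]; linarith
  have hQQ : q₁ ^ 2 + q₂ ^ 2 + q₃ ^ 2 = 2 * M := by rw [hM]; linarith
  have hM0 : M ≠ 0 := by rintro rfl; exact hne (by simpa using hPP)
  -- the cross product of `P` and `Q` is `k` times the normal vector
  obtain ⟨k, hk₁, hk₂, hk₃⟩ : ∃ k, p₂ * q₃ - p₃ * q₂ = k * a ∧ p₃ * q₁ - p₁ * q₃ = k * b ∧
      p₁ * q₂ - p₂ * q₁ = k * c := by
    obtain ⟨k, x, y, z, h₁, h₂, h₃⟩ := exists_eq_mul_add_mul_of_dvd_cross (d := 0)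
      (p := p₂ * q₃ - p₃ * q₂) (q := p₃ * q₁ - p₁ * q₃) (r := p₁ * q₂ - p₂ * q₁) huvw
      (zero_dvd_iff.2 (by linear_combination p₁ * hQ - q₁ * hP))
      (zero_dvd_iff.2 (by linear_combination p₂ * hQ - q₂ * hP))
      (zero_dvd_iff.2 (by linear_combination p₃ * hQ - q₃ * hP))
    exact ⟨k, by linarith, by linarith, by linarith⟩
  have hMsq : M ^ 2 = (k * d) ^ 2 := by
    have h : (p₁ ^ 2 + p₂ ^ 2 + p₃ ^ 2) * (q₁ ^ 2 + q₂ ^ 2 + q₃ ^ 2) - M ^ 2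
        = k ^ 2 * (a ^ 2 + b ^ 2 + c ^ 2) := by
      have : k ^ 2 * (a ^ 2 + b ^ 2 + c ^ 2) = (k * a) ^ 2 + (k * b) ^ 2 + (k * c) ^ 2 := by ring
      rw [this, ← hk₁, ← hk₂, ← hk₃, hM]; ring
    rw [hPP, hQQ, hsum] at h
    linarith
  have hdM : k * d ∣ M := (Int.pow_dvd_pow_iff two_ne_zero).1 hMsq.symm.dvd
  have hk0 : k ≠ 0 := by rintro rfl; exact hM0 (by simpa using hMsq)
  have hdvd : ∀ {x y : ℤ}, k * x = M * y → d ∣ x := fun {x y} h =>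
    (mul_dvd_mul_iff_left hk0).1 (h ▸ hdM.mul_right y)
  obtain ⟨l, x₁, x₂, x₃, hp₁, hp₂, hp₃⟩ := exists_eq_mul_add_mul_of_dvd_cross
    (d := d) (p := p₁) (q := p₂) (r := p₃) huvw
    (hdvd (y := 2 * q₁ - p₁) (by linear_combination q₁ * hPP + p₁ * hM - p₃ * hk₂ + p₂ * hk₃))
    (hdvd (y := 2 * q₂ - p₂) (by linear_combination q₂ * hPP + p₂ * hM - p₁ * hk₃ + p₃ * hk₁))
    (hdvd (y := 2 * q₃ - p₃) (by linear_combination q₃ * hPP + p₃ * hM - p₂ * hk₁ + p₁ * hk₂))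
  obtain ⟨l', y₁, y₂, y₃, hq₁, hq₂, hq₃⟩ := exists_eq_mul_add_mul_of_dvd_cross
    (d := d) (p := q₁) (q := q₂) (r := q₃) huvw
    (hdvd (y := q₁ - 2 * p₁) (by linear_combination -p₁ * hQQ - q₁ * hM - q₃ * hk₂ + q₂ * hk₃))
    (hdvd (y := q₂ - 2 * p₂) (by linear_combination -p₂ * hQQ - q₂ * hM - q₁ * hk₃ + q₃ * hk₁))
    (hdvd (y := q₃ - 2 * p₃) (by linear_combination -p₃ * hQQ - q₃ * hM - q₂ * hk₁ + q₁ * hk₂))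
  -- hence `P ⬝ Q` is divisible by `d ^ 2`
  obtain ⟨t, ht⟩ : ∃ t, M = t * d ^ 2 := by
    refine ⟨x₁ * y₁ + x₂ * y₂ + x₃ * y₃ - 3 * l * l', ?_⟩
    rw [hp₁, hp₂, hp₃] at hP
    rw [hq₁, hq₂, hq₃] at hQ
    rw [hM, hp₁, hp₂, hp₃, hq₁, hq₂, hq₃]
    linear_combination l' * hP + l * hQ - l * l' * hsum
  obtain ⟨e, x, y, he, hxy⟩ := exists_mul_sq_eq_of_orthogonal hd hsum hP hPP
  obtain ⟨m, n, hmn⟩ := exists_eq_sq_sub_mul_add_sq_of_mul_sq t (e := d * e)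
    (mul_pos hd he) (by rw [← hxy, ht]; ring)
  exact ⟨m, n, by rw [hPP, ht, hmn]; ring⟩
end

section
/- The following three vector identities hold in ℤ³: s·ζ − r·ς = 2d·(−b, a, 0); ς₁·ζ − ζ₁·ς = 2d·(0, −c, b); and ς₂·ζ − ζ₂·ς = 2d·(c, 0, −a). (Equivalently, with η = (ζ + ς)/2: ((r+s)/2)ζ − rη = d(−b, a, 0), ((ζ₁+ς₁)/2)ζ − ζ₁η = d(0, −c, b), and ((ζ₂+ς₂)/2)ζ − ζ₂η = d(c, 0, −a).) -/
theorem stmt_7 (a b c d r s : ℤ)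
    (hgcd : Int.gcd (Int.gcd a b : ℤ) c = 1)
    (hsum : a ^ 2 + b ^ 2 + c ^ 2 = 3 * d ^ 2)
    (hd : 1 ≤ d) (hab : ¬(a = 0 ∧ b = 0))
    (hq : 2 * (a ^ 2 + b ^ 2) = s ^ 2 + 3 * r ^ 2)
    (h1 : (a ^ 2 + b ^ 2) ∣ (r * a * c + d * b * s))
    (h2 : (a ^ 2 + b ^ 2) ∣ (d * a * s - b * c * r))
    (h3 : (a ^ 2 + b ^ 2) ∣ (3 * d * b * r - a * c * s))
    (h4 : (a ^ 2 + b ^ 2) ∣ (3 * d * a * r + b * c * s))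
    (ζ ς : Fin 3 → ℤ)
    (hζ : ζ = ![-(r * a * c + d * b * s) / (a ^ 2 + b ^ 2),
                 (d * a * s - b * c * r) / (a ^ 2 + b ^ 2), r])
    (hς : ς = ![(3 * d * b * r - a * c * s) / (a ^ 2 + b ^ 2),
                 -(3 * d * a * r + b * c * s) / (a ^ 2 + b ^ 2), s]) :
    s • ζ - r • ς = (2 * d) • ![-b, a, 0] ∧
    (ς 0) • ζ - (ζ 0) • ς = (2 * d) • ![0, -c, b] ∧
    (ς 1) • ζ - (ζ 1) • ς = (2 * d) • ![c, 0, -a] := by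
  have hq0 : a ^ 2 + b ^ 2 ≠ 0 := by
    intro h
    exact hab ⟨by nlinarith [sq_nonneg a, sq_nonneg b], by nlinarith [sq_nonneg a, sq_nonneg b]⟩
  have e0 := Int.mul_ediv_cancel' ((dvd_neg).mpr h1)
  have e1 := Int.mul_ediv_cancel' h2
  have f0 := Int.mul_ediv_cancel' h3
  have f1 := Int.mul_ediv_cancel' ((dvd_neg).mpr h4)
  set x := -(r * a * c + d * b * s) / (a ^ 2 + b ^ 2)
  set y := (d * a * s - b * c * r) / (a ^ 2 + b ^ 2)
  set u := (3 * d * b * r - a * c * s) / (a ^ 2 + b ^ 2)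
  set v := -(3 * d * a * r + b * c * s) / (a ^ 2 + b ^ 2)
  have hx : s * x - r * u = -(2 * d * b) := mul_left_cancel₀ hq0 (by
    linear_combination s * e0 - r * f0 + d * b * hq)
  have hy : s * y - r * v = 2 * d * a := mul_left_cancel₀ hq0 (by
    linear_combination s * e1 - r * f1 - d * a * hq)
  have hxy : u * y - x * v = -(2 * d * c) := mul_left_cancel₀ (mul_ne_zero hq0 hq0) (by
    linear_combination (a ^ 2 + b ^ 2) * y * f0 + (3 * d * b * r - a * c * s) * e1
      - (a ^ 2 + b ^ 2) * v * e0 + (r * a * c + d * b * s) * f1 + d * c * (a ^ 2 + b ^ 2) * hq)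
  subst hζ hς
  refine ⟨?_, ?_, ?_⟩ <;> ext i <;> fin_cases i <;> simp <;> linarith
end

section
/- If α and β are integers such that d·τ = α·ζ + β·η, then |((r̃ + s̃)/2)·β + r̃·α| = d. -/
theorem stmt_8 (a b c d r s k l rt st : ℤ)
    (hgcd : Int.gcd (Int.gcd a b : ℤ) c = 1)
    (hsum : a ^ 2 + b ^ 2 + c ^ 2 = 3 * d ^ 2)
    (hd : 1 ≤ d) (hab : ¬(a = 0 ∧ b = 0))
    (hq : 2 * (a ^ 2 + b ^ 2) = s ^ 2 + 3 * r ^ 2)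
    (h1 : (a ^ 2 + b ^ 2) ∣ (r * a * c + d * b * s))
    (h2 : (a ^ 2 + b ^ 2) ∣ (d * a * s - b * c * r))
    (h3 : (a ^ 2 + b ^ 2) ∣ (3 * d * b * r - a * c * s))
    (h4 : (a ^ 2 + b ^ 2) ∣ (3 * d * a * r + b * c * s))
    (hr : r = (Int.gcd a b : ℤ) * rt)
    (hs : s = (Int.gcd a b : ℤ) * st)
    (hrs : Even (rt + st))
    (ζ ς : Fin 3 → ℤ)
    (hζ : ζ = ![-(r * a * c + d * b * s) / (a ^ 2 + b ^ 2),
                 (d * a * s - b * c * r) / (a ^ 2 + b ^ 2), r])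
    (hς : ς = ![(3 * d * b * r - a * c * s) / (a ^ 2 + b ^ 2),
                 -(3 * d * a * r + b * c * s) / (a ^ 2 + b ^ 2), s])
    (heven : ∀ i, Even (ζ i + ς i))
    (η : Fin 3 → ℤ) (hη : η = fun i => (ζ i + ς i) / 2)
    (hkl : k * a + l * b = (Int.gcd a b : ℤ))
    (τ : Fin 3 → ℤ) (hτ : τ = ![-k * c, -l * c, (Int.gcd a b : ℤ)])
    (α β : ℤ) (hαβ : d • τ = α • ζ + β • η) :
    |((rt + st) / 2) * β + rt * α| = d := by
  have hω : (Int.gcd a b : ℤ) ≠ 0 := by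
    rw [Int.natCast_ne_zero, Ne, Int.gcd_eq_zero_iff]
    exact hab
  have hlast : d * (Int.gcd a b : ℤ) = α * r + β * ((r + s) / 2) := by
    simpa [hτ, hη, hζ, hς] using congrFun hαβ 2
  obtain ⟨m, hm⟩ := hrs
  have hhalf : (rt + st) / 2 = m := by omega
  have hhalf' : (r + s) / 2 = (Int.gcd a b : ℤ) * m := by
    rw [hr, hs, ← mul_add, hm, ← two_mul, mul_left_comm,
      Int.mul_ediv_cancel_left _ two_ne_zero]
  have hcoeff : m * β + rt * α = d := by
    apply mul_left_cancel₀ hω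
    rw [hhalf', hr] at hlast
    linear_combination -hlast
  rw [hhalf, hcoeff, abs_of_pos (by omega)]
end

section
/- Assume gcd(r̃, β) = 1, gcd((r̃ + s̃)/2, α) = 1, and gcd((r̃ − s̃)/2, α + β) = 1. Let Δ ⊆ ℝ³ be the convex hull of {(0,0,0), ζ, η}. Then for every positive integer t, the number of points of ℤ³ lying in tΔ equals (d·t² + 3t)/2 + 1. -/
open Pointwise

/-- The interval `[0, t d)` contains exactly `t` members of each residue class mod `d`. -/
lemma card_filter_dvd_sub_Ico {d : ℤ} (hd : 0 < d) (t : ℕ) (c : ℤ) :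
    ((Finset.Ico 0 (t * d)).filter (fun j => d ∣ j - c)).card = t := by
  have h := Int.Ico_filter_modEq_card 0 (t * d) hd c
  have hd' : (d : ℚ) ≠ 0 := by positivity
  have e : (((t * d : ℤ) : ℚ) - c) / d = ((0 : ℤ) - (c : ℚ)) / d + (t : ℤ) := by
    push_cast
    field_simp
    ring
  rw [e, Int.ceil_add_intCast, add_sub_cancel_left, max_eq_left (Int.natCast_nonneg t)] at h
  simpa only [Int.modEq_comm, Int.modEq_iff_dvd, Nat.cast_inj] using h

lemma card_filter_dvd_sub_Icc {d : ℤ} (hd : 0 < d) (t : ℕ) (c : ℤ) :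
    ((Finset.Icc 0 (t * d)).filter (fun j => d ∣ j - c)).card = t + if d ∣ c then 1 else 0 := by
  rw [← Finset.Ico_insert_right (by positivity), Finset.filter_insert]
  simp only [dvd_sub_right (dvd_mul_left d (t : ℤ))]
  split_ifs with hc
  · rw [Finset.card_insert_of_notMem (by simp), card_filter_dvd_sub_Ico hd]
  · rw [card_filter_dvd_sub_Ico hd, add_zero]

lemma card_filter_dvd_Icc {d : ℤ} (hd : 0 < d) (t : ℕ) :
    ((Finset.Icc 0 (t * d)).filter (fun i => d ∣ i)).card = t + 1 := by
  simpa using card_filter_dvd_sub_Icc hd t 0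

/-- The points of the lattice `{(i, j) | d ∣ j - h i}` in the square `[0, t d]²`. -/
lemma card_square {d : ℤ} (hd : 0 < d) (t : ℕ) (h : ℤ) (hh : ∀ i, d ∣ h * i → d ∣ i) :
    ((((Finset.Icc 0 (t * d)) ×ˢ (Finset.Icc 0 (t * d))).filter
      (fun x : ℤ × ℤ => d ∣ x.2 - h * x.1)).card : ℤ) = d * t ^ 2 + 2 * t + 1 := by
  rw [Finset.card_filter, Finset.sum_product]
  simp only [← Finset.card_filter, card_filter_dvd_sub_Icc hd]
  have e : ∀ i, d ∣ h * i ↔ d ∣ i := fun i => ⟨hh i, fun hi => hi.mul_left h⟩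
  simp only [e, Finset.sum_add_distrib, ← Finset.card_filter, card_filter_dvd_Icc hd,
    Finset.sum_const, Int.card_Icc, smul_eq_mul]
  have : 0 ≤ t * d := by positivity
  push_cast
  rw [Int.toNat_of_nonneg (by omega)]
  ring

/-- The points of the lattice `{(i, j) | d ∣ j - h i}` in the triangle with legs `t d`, when the
triangle with legs `d` has primitive edges. -/
lemma two_mul_card_triangle {d : ℤ} (hd : 0 < d) (t : ℕ) (h : ℤ)
    (hh : ∀ i, d ∣ h * i → d ∣ i) (hh' : ∀ i, d ∣ (h + 1) * i → d ∣ i) :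
    2 * ({x : ℤ × ℤ | 0 ≤ x.1 ∧ 0 ≤ x.2 ∧ x.1 + x.2 ≤ t * d ∧ d ∣ x.2 - h * x.1}.ncard : ℤ) =
      d * t ^ 2 + 3 * t + 2 := by
  set N : ℤ := t * d with hN
  have hdN : d ∣ N := dvd_mul_left d _
  set Q := ((Finset.Icc 0 N) ×ˢ (Finset.Icc 0 N)).filter
      (fun x : ℤ × ℤ => d ∣ x.2 - h * x.1) with hQ
  set L := Q.filter (fun x => x.1 + x.2 ≤ N) with hL
  set U := Q.filter (fun x => N ≤ x.1 + x.2) with hU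
  have hset : {x : ℤ × ℤ | 0 ≤ x.1 ∧ 0 ≤ x.2 ∧ x.1 + x.2 ≤ N ∧ d ∣ x.2 - h * x.1} = L := by
    ext x
    simp only [hL, hQ, Set.mem_ofPred_eq, Finset.coe_filter, Finset.mem_filter, Finset.mem_product,
      Finset.mem_Icc]
    constructor
    · rintro ⟨h1, h2, h3, h4⟩
      exact ⟨⟨⟨⟨h1, by omega⟩, h2, by omega⟩, h4⟩, h3⟩
    · rintro ⟨⟨⟨⟨h1, -⟩, h2, -⟩, h4⟩, h3⟩
      exact ⟨h1, h2, h3, h4⟩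
  have hLU : L.card = U.card := by
    have key : ∀ x ∈ Q, (N - x.1, N - x.2) ∈ Q := by
      intro x hx
      simp only [hQ, Finset.mem_filter, Finset.mem_product, Finset.mem_Icc] at hx ⊢
      refine ⟨⟨⟨by omega, by omega⟩, by omega, by omega⟩, ?_⟩
      have : N - x.2 - h * (N - x.1) = N * (1 - h) - (x.2 - h * x.1) := by ring
      rw [this]
      exact dvd_sub (hdN.mul_right _) hx.2
    refine Finset.card_bij' (fun x _ => (N - x.1, N - x.2)) (fun x _ => (N - x.1, N - x.2))
      ?_ ?_ (by simp) (by simp)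
    · intro x hx
      rw [hL, Finset.mem_filter] at hx
      rw [hU, Finset.mem_filter]
      exact ⟨key x hx.1, by have := hx.2; dsimp only; omega⟩
    · intro x hx
      rw [hU, Finset.mem_filter] at hx
      rw [hL, Finset.mem_filter]
      exact ⟨key x hx.1, by have := hx.2; dsimp only; omega⟩
  have hun : L ∪ U = Q := by
    rw [hL, hU, ← Finset.filter_or]
    exact Finset.filter_true_of_mem fun x _ => le_total _ _
  have hinter : (L ∩ U).card = t + 1 := by
    rw [← card_filter_dvd_Icc hd t, ← hN]
    symm
    refine Finset.card_bij (fun i _ => (i, N - i)) ?_ (by simp) ?_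
    · intro i hi
      simp only [hL, hU, hQ, Finset.mem_inter, Finset.mem_filter, Finset.mem_product,
        Finset.mem_Icc] at hi ⊢
      have : d ∣ N - i - h * i := by
        have e : N - i - h * i = N - i * (1 + h) := by ring
        rw [e]
        exact dvd_sub hdN (hi.2.mul_right _)
      refine ⟨⟨⟨⟨⟨?_, ?_⟩, ?_, ?_⟩, this⟩, ?_⟩, ⟨⟨⟨?_, ?_⟩, ?_, ?_⟩, this⟩, ?_⟩ <;> omega
    · intro x hx
      simp only [hL, hU, hQ, Finset.mem_inter, Finset.mem_filter, Finset.mem_product,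
        Finset.mem_Icc] at hx
      obtain ⟨⟨⟨⟨hx1, -⟩, hx2⟩, hx3⟩, -, hx4⟩ := hx
      have hx5 : x.2 = N - x.1 := by omega
      refine ⟨x.1, ?_, by rw [← hx5]⟩
      simp only [Finset.mem_filter, Finset.mem_Icc]
      refine ⟨hx1, hh' _ ?_⟩
      have e : (h + 1) * x.1 = N - (x.2 - h * x.1) := by rw [hx5]; ring
      rw [e]
      exact dvd_sub hdN hx2
  have hsum := Finset.card_union_add_card_inter L U
  have hQc : (Q.card : ℤ) = _ := card_square hd t h hh
  rw [hun, hinter, ← hLU] at hsum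
  rw [hset, Set.ncard_coe_finset]
  zify at hsum
  linarith

/-- The lattice points `(n, k)` of the dilates of the triangle with vertices `0`, `(r, -β)`,
`(m, α)`, whose area is `d / 2` and whose edges are primitive. -/
lemma two_mul_card_primitive_triangle {d r m α β : ℤ} (hd : 0 < d) (t : ℕ)
    (hdet : m * β + r * α = d) (h₁ : IsCoprime r β) (h₂ : IsCoprime m α)
    (h₃ : IsCoprime (r - m) (α + β)) :
    2 * ({x : ℤ × ℤ | 0 ≤ α * x.1 - m * x.2 ∧ 0 ≤ β * x.1 + r * x.2 ∧
      (α * x.1 - m * x.2) + (β * x.1 + r * x.2) ≤ t * d}.ncard : ℤ) = d * t ^ 2 + 3 * t + 2 := by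
  obtain ⟨u, z, huz⟩ := h₂
  -- the lattice of `(i, j) = (α n - m k, β n + r k)` is `{(i, j) | d ∣ j - h i}` for this `h`
  set h : ℤ := z * β - u * r with hh
  have lat : ∀ i j : ℤ, d ∣ j - h * i → d ∣ r * i + m * j ∧ d ∣ α * j - β * i := by
    rintro i j ⟨e, he⟩
    obtain rfl : j = d * e + h * i := by linarith
    refine ⟨⟨m * e + i * z, ?_⟩, ⟨α * e - i * u, ?_⟩⟩
    · linear_combination i * z * hdet - r * i * huz
    · linear_combination β * i * huz - i * u * hdet
  rw [← two_mul_card_triangle hd t h]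
  · congr 2
    refine Set.ncard_congr (fun x _ => (α * x.1 - m * x.2, β * x.1 + r * x.2)) ?_ ?_ ?_
    · rintro ⟨n, k⟩ ⟨ha, hb, hc⟩
      refine ⟨ha, hb, hc, u * n + z * k, ?_⟩
      linear_combination (u * n + z * k) * hdet - (β * n + r * k) * huz
    · rintro ⟨n, k⟩ ⟨n', k'⟩ - - he
      simp only [Prod.mk.injEq] at he
      obtain ⟨e₁, e₂⟩ := he
      rw [Prod.mk.injEq]
      constructor <;> apply mul_left_cancel₀ hd.ne'
      · linear_combination r * e₁ + m * e₂ - (n - n') * hdet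
      · linear_combination α * e₂ - β * e₁ - (k - k') * hdet
    · rintro ⟨i, j⟩ ⟨ha, hb, hc, hj⟩
      obtain ⟨⟨n, hn⟩, k, hk⟩ := lat i j hj
      dsimp only at *
      have ei : α * n - m * k = i := by
        apply mul_left_cancel₀ hd.ne'
        linear_combination i * hdet - α * hn + m * hk
      have ej : β * n + r * k = j := by
        apply mul_left_cancel₀ hd.ne'
        linear_combination j * hdet - β * hn - r * hk
      refine ⟨(n, k), ?_, by simp only [ei, ej]⟩
      simp only [Set.mem_ofPred_eq, ei, ej]
      exact ⟨ha, hb, hc⟩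
  · intro i hi
    obtain ⟨hr, hβ⟩ := lat i 0 (by rw [zero_sub]; exact hi.neg_right)
    obtain ⟨x, y, hxy⟩ := h₁
    have e : i = x * (r * i + m * 0) - y * (α * 0 - β * i) := by linear_combination (-i) * hxy
    rw [e]
    exact dvd_sub (hr.mul_left _) (hβ.mul_left _)
  · intro i hi
    obtain ⟨hr, hβ⟩ := lat i (-i) (by
      have e : -i - h * i = -((h + 1) * i) := by ring
      rw [e]
      exact hi.neg_right)
    obtain ⟨x, y, hxy⟩ := h₃
    have e : i = x * (r * i + m * -i) - y * (α * -i - β * i) := by linear_combination (-i) * hxy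
    rw [e]
    exact dvd_sub (hr.mul_left _) (hβ.mul_left _)

lemma mem_smul_convexHull_triangle_iff {E : Type*} [AddCommGroup E] [Module ℝ E] {u v x : E}
    {t : ℝ} (ht : 0 < t) :
    x ∈ t • convexHull ℝ {0, u, v} ↔
      ∃ X Y : ℝ, 0 ≤ X ∧ 0 ≤ Y ∧ X + Y ≤ t ∧ x = X • u + Y • v := by
  constructor
  · rintro ⟨y, hy, rfl⟩
    rw [convexHull_insert (by simp), convexHull_pair, mem_convexJoin] at hy
    obtain ⟨_, rfl, z, ⟨e, f, he, hf, hef, rfl⟩, ⟨g, h, hg, hh, hgh, rfl⟩⟩ := hy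
    refine ⟨t * (h * e), t * (h * f), by positivity, by positivity, ?_, ?_⟩
    · have : t * (h * e) + t * (h * f) = t * h := by linear_combination (t * h) * hef
      nlinarith
    · simp only [smul_zero, zero_add, smul_add, smul_smul]
  · rintro ⟨X, Y, hX, hY, hXY, rfl⟩
    refine ⟨(X / t) • u + (Y / t) • v, ?_, ?_⟩
    · have key := (convex_convexHull ℝ ({0, u, v} : Set E)).sum_mem (t := Finset.univ)
        (w := ![1 - (X + Y) / t, X / t, Y / t]) (z := ![0, u, v])
      simp only [Fin.sum_univ_three, Finset.mem_univ, forall_const, Fin.forall_fin_succ] at key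
      simp only [Fin.isValue, Matrix.cons_val_zero, Matrix.cons_val_one, Matrix.cons_val,
        smul_zero, zero_add] at key
      refine key ⟨?_, ?_⟩ (by ring) ⟨?_, ?_⟩
      · rw [sub_nonneg]; exact (div_le_one ht).2 hXY
      · simp; constructor <;> positivity
      · exact subset_convexHull _ _ (by simp)
      · simp; constructor <;> exact subset_convexHull _ _ (by simp)
    · simp only [smul_add, smul_smul, mul_div_cancel₀ _ ht.ne']

/-- Lattice points in dilates of a lattice triangle with primitive edges, with respect to a basis
`v`, `w` of the saturated lattice which it spans. -/
lemma ncard_smul_triangle {ι : Type*} {d r m α β : ℤ} (hd : 0 < d) (t : ℕ) (ht : 0 < t)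
    (hdet : m * β + r * α = d) (h₁ : IsCoprime r β) (h₂ : IsCoprime m α)
    (h₃ : IsCoprime (r - m) (α + β)) {v w ζ η : ι → ℤ}
    (hli : ∀ x y : ℝ, (∀ i, x * v i + y * w i = 0) → x = 0 ∧ y = 0)
    (hsat : ∀ (p : ι → ℤ) (x y : ℝ), (∀ i, (p i : ℝ) = x * v i + y * w i) →
      ∃ n k : ℤ, ∀ i, p i = n * v i + k * w i)
    (hζ : ∀ i, ζ i = r * v i - β * w i) (hη : ∀ i, η i = m * v i + α * w i) :
    2 * ({p : ι → ℤ | (fun i => (p i : ℝ)) ∈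
      (t : ℝ) • convexHull ℝ {0, (fun i => (ζ i : ℝ)), (fun i => (η i : ℝ))}}.ncard : ℤ) =
      d * t ^ 2 + 3 * t + 2 := by
  rw [← two_mul_card_primitive_triangle hd t hdet h₁ h₂ h₃]
  congr 2
  symm
  have hdet' : (m : ℝ) * β + r * α = d := mod_cast hdet
  have hd' : (0 : ℝ) < d := mod_cast hd
  have ht' : (0 : ℝ) < t := mod_cast ht
  refine Set.ncard_congr (fun x _ i => x.1 * v i + x.2 * w i) ?_ ?_ ?_
  · rintro ⟨n, k⟩ ⟨ha, hb, hc⟩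
    dsimp only at ha hb hc
    rw [Set.mem_ofPred_eq, mem_smul_convexHull_triangle_iff ht']
    have ha' : (0 : ℝ) ≤ α * n - m * k := mod_cast ha
    have hb' : (0 : ℝ) ≤ β * n + r * k := mod_cast hb
    have hc' : ((α * n - m * k) + (β * n + r * k) : ℝ) ≤ t * d := mod_cast hc
    refine ⟨(α * n - m * k) / d, (β * n + r * k) / d, by positivity, by positivity, ?_, ?_⟩
    · rw [← add_div, div_le_iff₀ hd']
      exact hc'
    · funext i
      simp only [Pi.add_apply, Pi.smul_apply, smul_eq_mul, hζ, hη]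
      push_cast
      field_simp
      linear_combination (-(n * v i) - k * w i : ℝ) * hdet'
  · rintro ⟨n, k⟩ ⟨n', k'⟩ - - he
    have := hli (n - n') (k - k') fun i => by
      have hi := congrFun he i
      dsimp only at hi
      have hi' : (n * v i + k * w i : ℝ) = n' * v i + k' * w i := mod_cast hi
      linear_combination hi'
    rw [Prod.mk.injEq]
    exact ⟨by exact_mod_cast sub_eq_zero.1 this.1, by exact_mod_cast sub_eq_zero.1 this.2⟩
  · intro p hp
    rw [Set.mem_ofPred_eq, mem_smul_convexHull_triangle_iff ht'] at hp
    obtain ⟨X, Y, hX, hY, hXY, hp⟩ := hp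
    have hp' : ∀ i, (p i : ℝ) = (X * r + Y * m) * v i + (Y * α - X * β) * w i := fun i => by
      have := congrFun hp i
      simp only [Pi.add_apply, Pi.smul_apply, smul_eq_mul, hζ, hη] at this
      push_cast at this
      linear_combination this
    obtain ⟨n, k, hnk⟩ := hsat p _ _ hp'
    obtain ⟨hn, hk⟩ := hli (n - (X * r + Y * m)) (k - (Y * α - X * β)) fun i => by
      have h := hp' i
      rw [hnk i] at h
      push_cast at h
      linear_combination h
    refine ⟨(n, k), ?_, funext fun i => (hnk i).symm⟩
    have e₁ : (α * n - m * k : ℝ) = d * X := by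
      linear_combination α * hn - m * hk + X * hdet'
    have e₂ : (β * n + r * k : ℝ) = d * Y := by
      linear_combination β * hn + r * hk + Y * hdet'
    refine ⟨?_, ?_, ?_⟩ <;> dsimp only <;> rify
    · rw [e₁]; positivity
    · rw [e₂]; positivity
    · rw [e₁, e₂]; nlinarith

theorem stmt_10 (a b c d r s rt st α β : ℤ)
    (hgcd : Int.gcd (Int.gcd a b : ℤ) c = 1)
    (hsum : a ^ 2 + b ^ 2 + c ^ 2 = 3 * d ^ 2)
    (hd : 1 ≤ d) (hab : ¬(a = 0 ∧ b = 0))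
    (hq : 2 * (a ^ 2 + b ^ 2) = s ^ 2 + 3 * r ^ 2)
    (h1 : (a ^ 2 + b ^ 2) ∣ (r * a * c + d * b * s))
    (h2 : (a ^ 2 + b ^ 2) ∣ (d * a * s - b * c * r))
    (h3 : (a ^ 2 + b ^ 2) ∣ (3 * d * b * r - a * c * s))
    (h4 : (a ^ 2 + b ^ 2) ∣ (3 * d * a * r + b * c * s))
    (hr : r = (Int.gcd a b : ℤ) * rt)
    (hs : s = (Int.gcd a b : ℤ) * st)
    (hrs : Even (rt + st))
    (ζ ς : Fin 3 → ℤ)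
    (hζ : ζ = ![-(r * a * c + d * b * s) / (a ^ 2 + b ^ 2),
                 (d * a * s - b * c * r) / (a ^ 2 + b ^ 2), r])
    (hς : ς = ![(3 * d * b * r - a * c * s) / (a ^ 2 + b ^ 2),
                 -(3 * d * a * r + b * c * s) / (a ^ 2 + b ^ 2), s])
    (heven : ∀ i, Even (ζ i + ς i))
    (η : Fin 3 → ℤ) (hη : η = fun i => (ζ i + ς i) / 2)
    (hαβ : ((rt + st) / 2) * β + rt * α = d)
    (hdiv : ∀ i, d ∣ (α * ζ i + β * η i))
    (hg1 : Int.gcd rt β = 1)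
    (hg2 : Int.gcd ((rt + st) / 2) α = 1)
    (hg3 : Int.gcd ((rt - st) / 2) (α + β) = 1)
    (Δ : Set (Fin 3 → ℝ))
    (hΔ : Δ = convexHull ℝ {0, (fun i => (ζ i : ℝ)), (fun i => (η i : ℝ))})
    (t : ℕ) (ht : 0 < t) :
    (({p : Fin 3 → ℤ | (fun i => (p i : ℝ)) ∈ (t : ℝ) • Δ}).ncard : ℚ) =
      ((d : ℚ) * (t : ℚ) ^ 2 + 3 * (t : ℚ)) / 2 + 1 := by
  obtain ⟨u, z, huz⟩ : ∃ u z : ℤ, a * u + b * z = Int.gcd a b :=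
    ⟨_, _, (Int.gcd_eq_gcd_ab a b).symm⟩
  have hω : (Int.gcd a b : ℤ) ≠ 0 := by
    rw [Ne, Int.natCast_eq_zero, Int.gcd_eq_zero_iff]
    exact hab
  obtain ⟨a', ha⟩ : (Int.gcd a b : ℤ) ∣ a := Int.gcd_dvd_left _ _
  obtain ⟨b', hb⟩ : (Int.gcd a b : ℤ) ∣ b := Int.gcd_dvd_right _ _
  have hωc : IsCoprime (Int.gcd a b : ℤ) c := Int.isCoprime_iff_gcd_eq_one.2 hgcd
  generalize (Int.gcd a b : ℤ) = ω at *
  have huz' : a' * u + b' * z = 1 := by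
    apply mul_left_cancel₀ hω
    rw [ha, hb] at huz
    linear_combination huz
  have hq0 : a ^ 2 + b ^ 2 ≠ 0 := by
    intro h
    exact hab ⟨by nlinarith, by nlinarith⟩
  obtain ⟨m, hm⟩ := hrs
  have hm' : (rt + st) / 2 = m := by omega
  have hm'' : (rt - st) / 2 = rt - m := by omega
  rw [hm'] at hαβ hg2
  rw [hm''] at hg3
  have hζ0 : (a ^ 2 + b ^ 2) * ζ 0 = -(r * a * c + d * b * s) := by
    rw [hζ]; exact Int.mul_ediv_cancel' h1.neg_right
  have hζ1 : (a ^ 2 + b ^ 2) * ζ 1 = d * a * s - b * c * r := by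
    rw [hζ]; exact Int.mul_ediv_cancel' h2
  have hζ2 : ζ 2 = r := by rw [hζ]; rfl
  have hς0 : (a ^ 2 + b ^ 2) * ς 0 = 3 * d * b * r - a * c * s := by
    rw [hς]; exact Int.mul_ediv_cancel' h3
  have hς1 : (a ^ 2 + b ^ 2) * ς 1 = -(3 * d * a * r + b * c * s) := by
    rw [hς]; exact Int.mul_ediv_cancel' h4.neg_right
  have hς2 : ς 2 = s := by rw [hς]; rfl
  have hη' : ∀ i, 2 * η i = ζ i + ς i := fun i => by
    rw [hη]; exact Int.mul_ediv_cancel' (heven i).two_dvd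
  clear hζ hς hη
  choose v hv using hdiv
  have hd0 : d ≠ 0 := by omega
  have hv2 : v 2 = ω := by
    apply mul_left_cancel₀ (mul_ne_zero two_ne_zero hd0)
    linear_combination (-2) * hv 2 + β * hη' 2 + (2 * α + β) * hζ2 + β * hς2 + (2 * α + β) * hr
      + β * hs + β * ω * hm + 2 * ω * hαβ
  have hw : ∀ i, m * ζ i - rt * η i = -d * ![b', -a', 0] i := by
    have key : ∀ i, (a ^ 2 + b ^ 2) * (s * ζ i - r * ς i) =
        (a ^ 2 + b ^ 2) * (-2 * d * ![b, -a, 0] i) := by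
      intro i
      fin_cases i <;> simp only [Fin.zero_eta, Fin.mk_one, Fin.reduceFinMk, Fin.isValue,
        Matrix.cons_val_zero, Matrix.cons_val_one, Matrix.cons_val]
      · linear_combination s * hζ0 - r * hς0 + d * b * hq
      · linear_combination s * hζ1 - r * hς1 - d * a * hq
      · rw [hζ2, hς2]; ring
    intro i
    have h := mul_left_cancel₀ hq0 (key i)
    have hab' : ![b, -a, 0] i = ω * ![b', -a', 0] i := by
      fin_cases i <;> simp [ha, hb]
    apply mul_left_cancel₀ (mul_ne_zero two_ne_zero hω)
    rw [hab', hr, hs] at h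
    linear_combination h - ω * ζ i * hm - ω * rt * hη' i
  have hζv : ∀ i, ζ i = rt * v i - β * ![b', -a', 0] i := fun i => by
    apply mul_left_cancel₀ hd0
    linear_combination rt * hv i + β * hw i - ζ i * hαβ
  have hηv : ∀ i, η i = m * v i + α * ![b', -a', 0] i := fun i => by
    apply mul_left_cancel₀ hd0
    linear_combination m * hv i - α * hw i - η i * hαβ
  have hplane : a * v 0 + b * v 1 + c * v 2 = 0 := by
    have e₁ : a * ζ 0 + b * ζ 1 + c * ζ 2 = 0 := by
      apply mul_left_cancel₀ hq0
      rw [hζ2]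
      linear_combination a * hζ0 + b * hζ1
    have e₂ : a * ς 0 + b * ς 1 + c * ς 2 = 0 := by
      apply mul_left_cancel₀ hq0
      rw [hς2]
      linear_combination a * hς0 + b * hς1
    apply mul_left_cancel₀ (mul_ne_zero two_ne_zero hd0)
    linear_combination (-2) * (a * hv 0 + b * hv 1 + c * hv 2)
      + β * (a * hη' 0 + b * hη' 1 + c * hη' 2) + (2 * α + β) * e₁ + β * e₂
  have main := ncard_smul_triangle (by omega) t ht hαβ (Int.isCoprime_iff_gcd_eq_one.2 hg1)
    (Int.isCoprime_iff_gcd_eq_one.2 hg2) (Int.isCoprime_iff_gcd_eq_one.2 hg3) ?_ ?_ hζv hηv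
  · rw [hΔ]
    have main' := congrArg (Int.cast : ℤ → ℚ) main
    push_cast at main'
    linear_combination main' / 2
  · intro x y hxy
    have y0 := hxy 0
    have y1 := hxy 1
    have x2 := hxy 2
    simp only [Fin.isValue, Matrix.cons_val_zero, Matrix.cons_val_one, Matrix.cons_val, hv2,
      Int.cast_zero, mul_zero, add_zero, mul_eq_zero, Int.cast_eq_zero, hω, or_false] at y0 y1 x2
    subst x2
    push_cast at y0 y1
    have huzR : (a' : ℝ) * u + b' * z = 1 := mod_cast huz'
    exact ⟨rfl, by linear_combination z * y0 - u * y1 - y * huzR⟩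
  · intro p x y hp
    have p0 := hp 0
    have p1 := hp 1
    have p2 := hp 2
    simp only [Fin.isValue, Matrix.cons_val_zero, Matrix.cons_val_one, Matrix.cons_val] at p0 p1 p2
    push_cast at p0 p1 p2
    have haR : (a : ℝ) = ω * a' := mod_cast ha
    have hbR : (b : ℝ) = ω * b' := mod_cast hb
    have hpl : a * p 0 + b * p 1 + c * p 2 = 0 := by
      have hplR : (a : ℝ) * v 0 + b * v 1 + c * v 2 = 0 := mod_cast hplane
      rify
      linear_combination a * p0 + b * p1 + c * p2 + x * hplR + y * b' * haR - y * a' * hbR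
    obtain ⟨n, hn⟩ : ω ∣ p 2 := by
      refine hωc.dvd_of_dvd_mul_left ⟨-(a' * p 0 + b' * p 1), ?_⟩
      linear_combination hpl - p 0 * ha - p 1 * hb
    have hperp : a' * (p 0 - n * v 0) + b' * (p 1 - n * v 1) = 0 := by
      apply mul_left_cancel₀ hω
      linear_combination hpl - n * hplane - (p 0 - n * v 0) * ha - (p 1 - n * v 1) * hb
        + c * n * hv2 - c * hn
    refine ⟨n, z * (p 0 - n * v 0) - u * (p 1 - n * v 1), fun i => ?_⟩
    fin_cases i <;> simp only [Fin.zero_eta, Fin.mk_one, Fin.reduceFinMk, Fin.isValue,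
      Matrix.cons_val_zero, Matrix.cons_val_one, Matrix.cons_val]
    · linear_combination u * hperp - (p 0 - n * v 0) * huz'
    · linear_combination z * hperp - (p 1 - n * v 1) * huz'
    · rw [hv2, hn]; ring
end

section
/- Suppose P, Q ∈ P_{a,b,c} satisfy ‖P‖² = ‖Q‖² = ‖P − Q‖² = 2d² (so that 0, P, Q are the vertices of a minimal equilateral triangle in P_{a,b,c}). For a nonzero v ∈ ℤ³ let g(v) denote gcd(v₁, v₂, v₃). Then the three numbers g(P), g(Q), g(P − Q) are pairwise coprime: gcd(g(P), g(Q)) = 1, gcd(g(P), g(P − Q)) = 1, and gcd(g(Q), g(P − Q)) = 1. -/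
/-- If `d ≠ 0` divides `n × u` for a primitive vector `n` of squared norm `3d²` orthogonal to `u`,
then `d²` divides `‖u‖²`. -/
theorem sq_dvd_normSq_of_dvd_cross {a b c d x y z u₀ u₁ u₂ w₀ w₁ w₂ : ℤ} (hd : d ≠ 0)
    (hbez : a * x + b * y + c * z = 1)
    (hsum : a ^ 2 + b ^ 2 + c ^ 2 = 3 * d ^ 2)
    (hu : a * u₀ + b * u₁ + c * u₂ = 0)
    (h₀ : b * u₂ - c * u₁ = d * w₀) (h₁ : c * u₀ - a * u₂ = d * w₁)
    (h₂ : a * u₁ - b * u₀ = d * w₂) :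
    d ^ 2 ∣ u₀ ^ 2 + u₁ ^ 2 + u₂ ^ 2 := by
  obtain ⟨t, ht⟩ : ∃ t, t = x * u₀ + y * u₁ + z * u₂ := ⟨_, rfl⟩
  obtain ⟨r₀, hr₀⟩ : ∃ r, r = z * w₁ - y * w₂ := ⟨_, rfl⟩
  obtain ⟨r₁, hr₁⟩ : ∃ r, r = x * w₂ - z * w₀ := ⟨_, rfl⟩
  obtain ⟨r₂, hr₂⟩ : ∃ r, r = y * w₀ - x * w₁ := ⟨_, rfl⟩
  have e₀ : u₀ = t * a + d * r₀ := by
    subst ht hr₀; linear_combination (-u₀) * hbez + z * h₁ - y * h₂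
  have e₁ : u₁ = t * b + d * r₁ := by
    subst ht hr₁; linear_combination (-u₁) * hbez + x * h₂ - z * h₀
  have e₂ : u₂ = t * c + d * r₂ := by
    subst ht hr₂; linear_combination (-u₂) * hbez + y * h₀ - x * h₁
  have hr : a * r₀ + b * r₁ + c * r₂ = -3 * d * t := by
    apply mul_left_cancel₀ hd
    linear_combination hu - a * e₀ - b * e₁ - c * e₂ - t * hsum
  refine ⟨r₀ ^ 2 + r₁ ^ 2 + r₂ ^ 2 - 3 * t ^ 2, ?_⟩
  rw [e₀, e₁, e₂]
  linear_combination t ^ 2 * hsum + 2 * t * d * hr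

/-- No integer other than a unit divides two sides of an equilateral triangle of squared side
length `2d²` in the plane orthogonal to a primitive vector of squared norm `3d²`. -/
theorem isUnit_of_dvd_equilateral {a b c d m P₀ P₁ P₂ Q₀ Q₁ Q₂ : ℤ} (hd : d ≠ 0)
    (hgcd : Int.gcd (Int.gcd a b : ℤ) c = 1)
    (hsum : a ^ 2 + b ^ 2 + c ^ 2 = 3 * d ^ 2)
    (hP : a * P₀ + b * P₁ + c * P₂ = 0)
    (hQ : a * Q₀ + b * Q₁ + c * Q₂ = 0)
    (hPlen : P₀ ^ 2 + P₁ ^ 2 + P₂ ^ 2 = 2 * d ^ 2)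
    (hQlen : Q₀ ^ 2 + Q₁ ^ 2 + Q₂ ^ 2 = 2 * d ^ 2)
    (hPQlen : (P₀ - Q₀) ^ 2 + (P₁ - Q₁) ^ 2 + (P₂ - Q₂) ^ 2 = 2 * d ^ 2)
    (hP₀ : m ∣ P₀) (hP₁ : m ∣ P₁) (hP₂ : m ∣ P₂)
    (hQ₀ : m ∣ Q₀) (hQ₁ : m ∣ Q₁) (hQ₂ : m ∣ Q₂) : IsUnit m := by
  obtain ⟨x, y, z, hbez⟩ : ∃ x y z : ℤ, a * x + b * y + c * z = 1 := by
    have h₁ := Int.gcd_eq_gcd_ab a b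
    have h₂ := Int.gcd_eq_gcd_ab (Int.gcd a b : ℤ) c
    rw [hgcd] at h₂
    push_cast at h₂
    refine ⟨Int.gcdA a b * Int.gcdA (Int.gcd a b : ℤ) c,
      Int.gcdB a b * Int.gcdA (Int.gcd a b : ℤ) c, Int.gcdB (Int.gcd a b : ℤ) c, ?_⟩
    linear_combination -Int.gcdA (Int.gcd a b : ℤ) c * h₁ - h₂
  have hdot : P₀ * Q₀ + P₁ * Q₁ + P₂ * Q₂ = d ^ 2 := by linarith
  obtain ⟨s, hs⟩ : ∃ s, s = x * (P₁ * Q₂ - P₂ * Q₁) + y * (P₂ * Q₀ - P₀ * Q₂)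
    + z * (P₀ * Q₁ - P₁ * Q₀) := ⟨_, rfl⟩
  have c₀ : P₁ * Q₂ - P₂ * Q₁ = s * a := by
    subst hs
    linear_combination (-(P₁ * Q₂ - P₂ * Q₁)) * hbez + (y * Q₂ - z * Q₁) * hP
      + (z * P₁ - y * P₂) * hQ
  have c₁ : P₂ * Q₀ - P₀ * Q₂ = s * b := by
    subst hs
    linear_combination (-(P₂ * Q₀ - P₀ * Q₂)) * hbez + (z * Q₀ - x * Q₂) * hP
      + (x * P₂ - z * P₀) * hQ
  have c₂ : P₀ * Q₁ - P₁ * Q₀ = s * c := by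
    subst hs
    linear_combination (-(P₀ * Q₁ - P₁ * Q₀)) * hbez + (x * Q₁ - y * Q₀) * hP
      + (y * P₀ - x * P₁) * hQ
  have hsd : d ^ 2 = s ^ 2 := by
    have h3 : (3 * d ^ 2 : ℤ) ≠ 0 := by positivity
    apply mul_left_cancel₀ h3
    have lagrange : (P₁ * Q₂ - P₂ * Q₁) ^ 2 + (P₂ * Q₀ - P₀ * Q₂) ^ 2 + (P₀ * Q₁ - P₁ * Q₀) ^ 2
        = (P₀ ^ 2 + P₁ ^ 2 + P₂ ^ 2) * (Q₀ ^ 2 + Q₁ ^ 2 + Q₂ ^ 2)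
          - (P₀ * Q₀ + P₁ * Q₁ + P₂ * Q₂) ^ 2 := by ring
    rw [c₀, c₁, c₂, hPlen, hQlen, hdot] at lagrange
    linear_combination -lagrange + s ^ 2 * hsum
  have hs0 : s ≠ 0 := by
    rintro rfl
    exact hd (by simpa using hsd)
  rw [hsd] at hsum hPlen hdot
  have hm : m ≠ 0 := by
    rintro rfl
    rw [zero_dvd_iff] at hP₀ hP₁ hP₂
    subst hP₀ hP₁ hP₂
    have : 0 < s ^ 2 := by positivity
    linarith
  obtain ⟨u₀, rfl⟩ := hP₀
  obtain ⟨u₁, rfl⟩ := hP₁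
  obtain ⟨u₂, rfl⟩ := hP₂
  obtain ⟨v₀, rfl⟩ := hQ₀
  obtain ⟨v₁, rfl⟩ := hQ₁
  obtain ⟨v₂, rfl⟩ := hQ₂
  have hms : m * s ≠ 0 := mul_ne_zero hm hs0
  obtain ⟨k, hk⟩ := sq_dvd_normSq_of_dvd_cross (u₀ := u₀) (u₁ := u₁) (u₂ := u₂)
    (w₀ := 2 * v₀ - u₀) (w₁ := 2 * v₁ - u₁) (w₂ := 2 * v₂ - u₂) hs0 hbez hsum
    (mul_left_cancel₀ hm (by linear_combination hP))
    (mul_left_cancel₀ hms (by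
      linear_combination -(m * u₂) * c₁ + (m * u₁) * c₂ + m * v₀ * hPlen - m * u₀ * hdot))
    (mul_left_cancel₀ hms (by
      linear_combination -(m * u₀) * c₂ + (m * u₂) * c₀ + m * v₁ * hPlen - m * u₁ * hdot))
    (mul_left_cancel₀ hms (by
      linear_combination -(m * u₁) * c₀ + (m * u₀) * c₁ + m * v₂ * hPlen - m * u₂ * hdot))
  have hmk : m * m ∣ 2 := ⟨k, mul_left_cancel₀ (pow_ne_zero 2 hs0)
    (by linear_combination -hPlen + m ^ 2 * hk)⟩
  exact Int.prime_two.irreducible.squarefree m hmk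

theorem stmt_12 (a b c d : ℤ)
    (hgcd : Int.gcd (Int.gcd a b : ℤ) c = 1)
    (hsum : a ^ 2 + b ^ 2 + c ^ 2 = 3 * d ^ 2)
    (hd : 1 ≤ d) (hab : ¬(a = 0 ∧ b = 0))
    (P Q : Fin 3 → ℤ)
    (hP : a * P 0 + b * P 1 + c * P 2 = 0)
    (hQ : a * Q 0 + b * Q 1 + c * Q 2 = 0)
    (hPlen : P 0 ^ 2 + P 1 ^ 2 + P 2 ^ 2 = 2 * d ^ 2)
    (hQlen : Q 0 ^ 2 + Q 1 ^ 2 + Q 2 ^ 2 = 2 * d ^ 2)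
    (hPQlen : (P 0 - Q 0) ^ 2 + (P 1 - Q 1) ^ 2 + (P 2 - Q 2) ^ 2 = 2 * d ^ 2) :
    Nat.gcd (Int.gcd (Int.gcd (P 0) (P 1) : ℤ) (P 2))
            (Int.gcd (Int.gcd (Q 0) (Q 1) : ℤ) (Q 2)) = 1 ∧
    Nat.gcd (Int.gcd (Int.gcd (P 0) (P 1) : ℤ) (P 2))
            (Int.gcd (Int.gcd (P 0 - Q 0) (P 1 - Q 1) : ℤ) (P 2 - Q 2)) = 1 ∧
    Nat.gcd (Int.gcd (Int.gcd (Q 0) (Q 1) : ℤ) (Q 2))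
            (Int.gcd (Int.gcd (P 0 - Q 0) (P 1 - Q 1) : ℤ) (P 2 - Q 2)) = 1 := by
  have hd0 : d ≠ 0 := by lia
  have key (p q : Fin 3 → ℤ) (hp : a * p 0 + b * p 1 + c * p 2 = 0)
      (hq : a * q 0 + b * q 1 + c * q 2 = 0)
      (hplen : p 0 ^ 2 + p 1 ^ 2 + p 2 ^ 2 = 2 * d ^ 2)
      (hqlen : q 0 ^ 2 + q 1 ^ 2 + q 2 ^ 2 = 2 * d ^ 2)
      (hpqlen : (p 0 - q 0) ^ 2 + (p 1 - q 1) ^ 2 + (p 2 - q 2) ^ 2 = 2 * d ^ 2) :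
      Nat.gcd (Int.gcd (Int.gcd (p 0) (p 1) : ℤ) (p 2))
        (Int.gcd (Int.gcd (q 0) (q 1) : ℤ) (q 2)) = 1 := by
    have dvd_coords (v : Fin 3 → ℤ) {n : ℕ} (h : n ∣ Int.gcd (Int.gcd (v 0) (v 1) : ℤ) (v 2)) :
        (n : ℤ) ∣ v 0 ∧ (n : ℤ) ∣ v 1 ∧ (n : ℤ) ∣ v 2 := by
      rw [← Int.natCast_dvd_natCast, Int.dvd_coe_gcd_iff, Int.dvd_coe_gcd_iff] at h
      tauto
    obtain ⟨hp₀, hp₁, hp₂⟩ := dvd_coords p (Nat.gcd_dvd_left _ _)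
    obtain ⟨hq₀, hq₁, hq₂⟩ := dvd_coords q (Nat.gcd_dvd_right _ _)
    exact Nat.isUnit_iff.1 (Int.ofNat_isUnit.1 (isUnit_of_dvd_equilateral hd0 hgcd hsum
      hp hq hplen hqlen hpqlen hp₀ hp₁ hp₂ hq₀ hq₁ hq₂))
  refine ⟨key P Q hP hQ hPlen hQlen hPQlen, key P (P - Q) hP ?_ hPlen hPQlen ?_, ?_⟩
  · simp only [Pi.sub_apply]
    linear_combination hP - hQ
  · simpa using hQlen
  · have h := key Q (-(P - Q)) hQ (by simp only [Pi.neg_apply, Pi.sub_apply]; linarith) hQlen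
      (by simp only [Pi.neg_apply, Pi.sub_apply]; linarith) (by simpa using hPlen)
    simpa only [Pi.neg_apply, Pi.sub_apply, Int.gcd_neg, Int.neg_gcd] using h
end

section
/- The number of points of ℤ³ lying in the open segment from (0,0,0) to ζ in ℝ³ equals gcd(r̃, β) − 1. -/
/-- The lattice points in the open segment from the origin to an integer vector `v = n • w`, where
`n` is the greatest common divisor of the coordinates of `v`, are `n - 1` in number. -/
theorem ncard_int_openSegment_zero {ι : Type*} (v w : ι → ℤ) (n : ℕ) (hn : n ≠ 0)
    (hv : ∀ i, v i = n * w i) (hgcd : ∀ m : ℤ, (∀ i, m ∣ v i) → m ∣ n) :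
    {x : ι → ℤ | (fun i => (x i : ℝ)) ∈
      openSegment ℝ (0 : ι → ℝ) (fun i => (v i : ℝ))}.ncard = n - 1 := by
  have hn' : (0 : ℝ) < n := by positivity
  obtain ⟨i, hi⟩ : ∃ i, v i ≠ 0 := by
    by_contra! h
    have := hgcd 0 (fun i => by simp [h i])
    exact hn (by simpa using this)
  have hwi : w i ≠ 0 := by
    rintro h
    exact hi (by simp [hv, h])
  have himage : {x : ι → ℤ | (fun i => (x i : ℝ)) ∈
      openSegment ℝ (0 : ι → ℝ) (fun i => (v i : ℝ))} =
      (fun (k : ℤ) (i : ι) => k * w i) '' Set.Ioo (0 : ℤ) n := by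
    ext x
    simp only [Set.mem_ofPred_eq, openSegment_eq_image, Set.mem_image, Set.mem_Ioo]
    constructor
    · rintro ⟨t, ⟨ht0, ht1⟩, htx⟩
      have hx : ∀ j, (x j : ℝ) = t * v j := fun j => by
        simpa using (congrFun htx j).symm
      have hcross : ∀ j, x j * v i = x i * v j := fun j => by
        have : (x j : ℝ) * v i = x i * v j := by rw [hx i, hx j]; ring
        exact_mod_cast this
      obtain ⟨g, p, q, hg, hpq, hp, hq⟩ := Int.exists_gcd_one' (m := x i) (n := v i)
        (Int.gcd_pos_of_ne_zero_right _ hi)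
      have hg' : (g : ℤ) ≠ 0 := by exact_mod_cast hg.ne'
      have hpj : ∀ j, x j * q = p * v j := fun j => by
        have := hcross j
        rw [hp, hq] at this
        exact mul_right_cancel₀ hg' (by linear_combination this)
      obtain ⟨e, he⟩ := hgcd q fun j =>
        (Int.isCoprime_iff_gcd_eq_one.mpr hpq).symm.dvd_of_dvd_mul_left
          ⟨x j, by rw [← hpj j]; ring⟩
      have hq0 : q ≠ 0 := by
        rintro rfl
        simp at hq
        exact hi hq
      have hxj : ∀ j, x j = p * e * w j := fun j =>
        mul_right_cancel₀ hq0 (by rw [hpj j, hv j, he]; ring)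
      have hte : t * n = ((p * e : ℤ) : ℝ) := by
        have h := hx i
        rw [hxj i, hv i] at h
        have hw : (w i : ℝ) ≠ 0 := by exact_mod_cast hwi
        push_cast at h ⊢
        exact mul_right_cancel₀ hw (by linear_combination -h)
      refine ⟨p * e, ⟨?_, ?_⟩, funext fun j => (hxj j).symm⟩
      · have : (0 : ℝ) < ((p * e : ℤ) : ℝ) := by rw [← hte]; positivity
        exact_mod_cast this
      · have : ((p * e : ℤ) : ℝ) < n := by rw [← hte]; nlinarith
        exact_mod_cast this
    · rintro ⟨k, ⟨hk0, hkn⟩, rfl⟩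
      have hk0' : (0 : ℝ) < k := by exact_mod_cast hk0
      have hkn' : (k : ℝ) < n := by exact_mod_cast hkn
      refine ⟨k / n, ⟨by positivity, (div_lt_one hn').mpr hkn'⟩, funext fun j => ?_⟩
      simp [hv j]
      field_simp
  rw [himage, Set.ncard_image_of_injective _ fun k l h => mul_right_cancel₀ hwi (congrFun h i),
    ← Finset.coe_Ioo, Set.ncard_coe_finset, Int.card_Ioo]
  omega


theorem stmt_13 (a b c d r s rt st α β : ℤ)
    (hgcd : Int.gcd (Int.gcd a b : ℤ) c = 1)
    (hsum : a ^ 2 + b ^ 2 + c ^ 2 = 3 * d ^ 2)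
    (hd : 1 ≤ d) (hab : ¬(a = 0 ∧ b = 0))
    (hq : 2 * (a ^ 2 + b ^ 2) = s ^ 2 + 3 * r ^ 2)
    (h1 : (a ^ 2 + b ^ 2) ∣ (r * a * c + d * b * s))
    (h2 : (a ^ 2 + b ^ 2) ∣ (d * a * s - b * c * r))
    (h3 : (a ^ 2 + b ^ 2) ∣ (3 * d * b * r - a * c * s))
    (h4 : (a ^ 2 + b ^ 2) ∣ (3 * d * a * r + b * c * s))
    (hr : r = (Int.gcd a b : ℤ) * rt)
    (hs : s = (Int.gcd a b : ℤ) * st)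
    (hrs : Even (rt + st))
    (ζ ς : Fin 3 → ℤ)
    (hζ : ζ = ![-(r * a * c + d * b * s) / (a ^ 2 + b ^ 2),
                 (d * a * s - b * c * r) / (a ^ 2 + b ^ 2), r])
    (hς : ς = ![(3 * d * b * r - a * c * s) / (a ^ 2 + b ^ 2),
                 -(3 * d * a * r + b * c * s) / (a ^ 2 + b ^ 2), s])
    (heven : ∀ i, Even (ζ i + ς i))
    (η : Fin 3 → ℤ) (hη : η = fun i => (ζ i + ς i) / 2)
    (hαβ : ((rt + st) / 2) * β + rt * α = d)
    (hdiv : ∀ i, d ∣ (α * ζ i + β * η i)) :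
    ({x : Fin 3 → ℤ |
        (fun i => (x i : ℝ)) ∈
          openSegment ℝ (0 : Fin 3 → ℝ) (fun i => (ζ i : ℝ))}).ncard =
      Int.gcd rt β - 1 := by
  have hω : (Int.gcd a b : ℤ) ≠ 0 := by
    rw [Ne, Int.natCast_eq_zero, Int.gcd_eq_zero_iff]
    exact hab
  obtain ⟨a', ha⟩ := Int.gcd_dvd_left a b
  obtain ⟨b', hb⟩ := Int.gcd_dvd_right a b
  have hcop : IsCoprime a' b' := by
    have hbez := Int.gcd_eq_gcd_ab a b
    refine ⟨Int.gcdA a b, Int.gcdB a b, mul_left_cancel₀ hω ?_⟩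
    linear_combination -hbez - Int.gcdA a b * ha - Int.gcdB a b * hb
  have hωc : IsCoprime (Int.gcd a b : ℤ) c := Int.isCoprime_iff_gcd_eq_one.mpr hgcd
  have hq0 : a ^ 2 + b ^ 2 ≠ 0 := fun h =>
    hab ⟨by nlinarith [sq_nonneg a, sq_nonneg b], by nlinarith [sq_nonneg a, sq_nonneg b]⟩
  have hd0 : d ≠ 0 := by omega
  generalize (Int.gcd a b : ℤ) = ω at *
  have hζ0 : (a ^ 2 + b ^ 2) * ζ 0 = -(r * a * c + d * b * s) := by
    simpa [hζ] using Int.mul_ediv_cancel' ((dvd_neg).mpr h1)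
  have hζ1 : (a ^ 2 + b ^ 2) * ζ 1 = d * a * s - b * c * r := by
    simpa [hζ] using Int.mul_ediv_cancel' h2
  have hζ2 : ζ 2 = r := by simp [hζ]
  have hς0 : (a ^ 2 + b ^ 2) * ς 0 = 3 * d * b * r - a * c * s := by
    simpa [hς] using Int.mul_ediv_cancel' h3
  have hς1 : (a ^ 2 + b ^ 2) * ς 1 = -(3 * d * a * r + b * c * s) := by
    simpa [hς] using Int.mul_ediv_cancel' ((dvd_neg).mpr h4)
  have hς2 : ς 2 = s := by simp [hς]
  have hη2 : ∀ i, 2 * η i = ζ i + ς i := fun i => by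
    rw [hη]
    exact Int.mul_ediv_cancel' (heven i).two_dvd
  obtain ⟨h, hh⟩ : ∃ h, rt + st = 2 * h := hrs.two_dvd
  have hhalf : (rt + st) / 2 = h := by omega
  rw [hhalf] at hαβ
  have horth : a * ζ 0 + b * ζ 1 + c * ζ 2 = 0 := by
    refine mul_left_cancel₀ hq0 ?_
    rw [hζ2]
    linear_combination a * hζ0 + b * hζ1
  choose v hv using hdiv
  have hq' : 2 * (a' ^ 2 + b' ^ 2) = st ^ 2 + 3 * rt ^ 2 := by
    refine mul_left_cancel₀ (pow_ne_zero 2 hω) ?_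
    rw [ha, hb, hr, hs] at hq
    linear_combination hq
  have hdet0 : rt * ς 0 - st * ζ 0 = 2 * d * b' := by
    refine mul_left_cancel₀ hq0 ?_
    rw [hr, hs] at hζ0 hς0
    linear_combination rt * hς0 - st * hζ0 + d * (3 * ω * rt ^ 2 + ω * st ^ 2) * hb
      - ω ^ 2 * d * b' * hq' - 2 * d * b' * (a + ω * a') * ha - 2 * d * b' * (b + ω * b') * hb
  have hdet1 : rt * ς 1 - st * ζ 1 = -(2 * d * a') := by
    refine mul_left_cancel₀ hq0 ?_
    rw [hr, hs] at hζ1 hς1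
    linear_combination rt * hς1 - st * hζ1 - d * (3 * ω * rt ^ 2 + ω * st ^ 2) * ha
      + ω ^ 2 * d * a' * hq' + 2 * d * a' * (a + ω * a') * ha + 2 * d * a' * (b + ω * b') * hb
  have hdet2 : rt * ς 2 - st * ζ 2 = 0 := by
    rw [hς2, hζ2, hr, hs]
    ring
  have hbasis : ∀ i u, rt * ς i - st * ζ i = 2 * d * u → ζ i = rt * v i - β * u := by
    intro i u hu
    refine mul_left_cancel₀ (mul_ne_zero two_ne_zero hd0) ?_
    linear_combination 2 * rt * hv i - β * hu - 2 * ζ i * hαβ - rt * β * hη2 i - β * ζ i * hh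
  have e0 := hbasis 0 b' hdet0
  have e1 := hbasis 1 (-a') (by rw [hdet1]; ring)
  have e2 := hbasis 2 0 (by rw [hdet2]; ring)
  have hg0 : Int.gcd rt β ≠ 0 := by
    rw [Ne, Int.gcd_eq_zero_iff]
    rintro ⟨rfl, rfl⟩
    exact hd0 (by simpa using hαβ.symm)
  have hdvd : ∀ i, (Int.gcd rt β : ℤ) ∣ ζ i := by
    have key : ∀ x y : ℤ, (Int.gcd rt β : ℤ) ∣ rt * x - β * y := fun x y =>
      dvd_sub ((Int.gcd_dvd_left rt β).mul_right x) ((Int.gcd_dvd_right rt β).mul_right y)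
    intro i
    fin_cases i
    · exact e0 ▸ key _ _
    · exact e1 ▸ key _ _
    · exact e2 ▸ key _ _
  choose w hw using hdvd
  refine ncard_int_openSegment_zero ζ w _ hg0 hw fun m hm => ?_
  have hmrt : m ∣ rt := by
    rcases eq_or_ne m 0 with rfl | hm0
    · have h0 := zero_dvd_iff.mp (hm 2)
      rw [hζ2, hr] at h0
      simpa [hω] using h0
    · choose k hk using hm
      have hk0 : a * k 0 + b * k 1 + c * k 2 = 0 := by
        refine mul_left_cancel₀ hm0 ?_
        rw [hk 0, hk 1, hk 2] at horth
        linear_combination horth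
      obtain ⟨l, hl⟩ : ω ∣ k 2 := hωc.dvd_of_dvd_mul_left
        ⟨-(a' * k 0 + b' * k 1), by linear_combination hk0 - k 0 * ha - k 1 * hb⟩
      refine ⟨l, mul_left_cancel₀ hω ?_⟩
      rw [← hr, ← hζ2, hk 2, hl]
      ring
  refine Int.dvd_coe_gcd hmrt ?_
  have hmb : m ∣ β * b' := by
    have := dvd_sub (hmrt.mul_right (v 0)) (hm 0)
    rwa [e0, sub_sub_cancel] at this
  have hma : m ∣ β * a' := by
    have := dvd_sub (hm 1) (hmrt.mul_right (v 1))
    rwa [e1, show rt * v 1 - β * -a' - rt * v 1 = β * a' by ring] at this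
  obtain ⟨x, y, hxy⟩ := hcop
  have := dvd_add (hma.mul_left x) (hmb.mul_left y)
  rwa [show x * (β * a') + y * (β * b') = β by linear_combination β * hxy] at this
end

section
/- Let Δ ⊆ ℝ³ be the convex hull of {(0,0,0), ζ, η} and set c₁ = gcd(r̃, β) + gcd((r̃ + s̃)/2, α) + gcd((r̃ − s̃)/2, α + β). Then for every positive integer t, the number of points of ℤ³ lying in tΔ equals (d·t² + c₁·t)/2 + 1. -/
open Pointwise

/-- The half-open lattice segment from `0` to `(p₁, p₂)`, cut out on its line by a linear form. -/
lemma ncard_segment (p₁ p₂ l m : ℤ) (h : 0 < l * p₁ + m * p₂) :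
    ({z : ℤ × ℤ | p₁ * z.2 = p₂ * z.1 ∧ 0 ≤ l * z.1 + m * z.2 ∧
      l * z.1 + m * z.2 < l * p₁ + m * p₂}).ncard = Int.gcd p₁ p₂ := by
  have hg : 0 < Int.gcd p₁ p₂ := by
    rw [Int.gcd_pos_iff]
    by_contra! hp
    simp [hp] at h
  obtain ⟨g, hgg⟩ : ∃ g : ℤ, g = Int.gcd p₁ p₂ := ⟨_, rfl⟩
  obtain ⟨u, hu⟩ := Int.gcd_dvd_left (a := p₁) (b := p₂)
  obtain ⟨v, hv⟩ := Int.gcd_dvd_right (a := p₁) (b := p₂)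
  have hbez := Int.gcd_eq_gcd_ab p₁ p₂
  rw [← hgg] at hu hv hbez
  have hg0 : 0 < g := by omega
  generalize Int.gcdA p₁ p₂ = A at hbez
  generalize Int.gcdB p₁ p₂ = B at hbez
  have hAB : u * A + v * B = 1 := by
    apply mul_left_cancel₀ hg0.ne'
    rw [hu, hv] at hbez
    linear_combination -hbez
  have hpos : 0 < l * u + m * v := by
    rw [hu, hv] at h
    exact pos_of_mul_pos_right (a := g) (by linarith) hg0.le
  have himg : {z : ℤ × ℤ | p₁ * z.2 = p₂ * z.1 ∧ 0 ≤ l * z.1 + m * z.2 ∧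
      l * z.1 + m * z.2 < l * p₁ + m * p₂} =
      (fun X : ℤ => (X * u, X * v)) '' (Finset.Ico 0 g : Finset ℤ) := by
    ext ⟨x, y⟩
    simp only [Set.mem_ofPred_eq, Set.mem_image, Finset.coe_Ico, Set.mem_Ico, Prod.mk.injEq]
    constructor
    · rintro ⟨e, h0, h1⟩
      have e' : u * y = v * x := by
        apply mul_left_cancel₀ hg0.ne'
        rw [hu, hv] at e
        linear_combination e
      have ex : x = (A * x + B * y) * u := by linear_combination (-x) * hAB - B * e'
      have ey : y = (A * x + B * y) * v := by linear_combination (-y) * hAB + A * e'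
      have eL : l * x + m * y = (A * x + B * y) * (l * u + m * v) := by
        linear_combination l * ex + m * ey
      have eP : l * p₁ + m * p₂ = g * (l * u + m * v) := by rw [hu, hv]; ring
      rw [eL] at h0 h1
      rw [eP] at h1
      exact ⟨A * x + B * y, ⟨nonneg_of_mul_nonneg_left h0 hpos,
        lt_of_mul_lt_mul_right h1 hpos.le⟩, ex.symm, ey.symm⟩
    · rintro ⟨X, ⟨h0, h1⟩, rfl, rfl⟩
      have eL : l * (X * u) + m * (X * v) = X * (l * u + m * v) := by ring
      have eP : l * p₁ + m * p₂ = g * (l * u + m * v) := by rw [hu, hv]; ring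
      rw [eL, eP]
      refine ⟨by rw [hu, hv]; ring, by positivity, mul_lt_mul_of_pos_right h1 hpos⟩
  rw [himg, Set.ncard_image_of_injective, Set.ncard_coe_finset, Int.card_Ico]
  · omega
  · intro X Y hXY
    simp only [Prod.mk.injEq] at hXY
    linear_combination A * hXY.1 + B * hXY.2 - (X - Y) * hAB

/-- A half-open lattice parallelogram contains as many lattice points as its area. -/
lemma ncard_parallelogram (p₁ p₂ q₁ q₂ : ℤ) (h : 0 < p₁ * q₂ - p₂ * q₁) :
    (({z : ℤ × ℤ | 0 ≤ z.1 * q₂ - z.2 * q₁ ∧ z.1 * q₂ - z.2 * q₁ < p₁ * q₂ - p₂ * q₁ ∧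
      0 ≤ p₁ * z.2 - p₂ * z.1 ∧ p₁ * z.2 - p₂ * z.1 < p₁ * q₂ - p₂ * q₁}).ncard : ℤ) =
      p₁ * q₂ - p₂ * q₁ := by
  have hg : 0 < Int.gcd p₁ p₂ := by
    rw [Int.gcd_pos_iff]
    by_contra! hp
    simp [hp] at h
  obtain ⟨g, hgg⟩ : ∃ g : ℤ, g = Int.gcd p₁ p₂ := ⟨_, rfl⟩
  obtain ⟨u, hu⟩ := Int.gcd_dvd_left (a := p₁) (b := p₂)
  obtain ⟨v, hv⟩ := Int.gcd_dvd_right (a := p₁) (b := p₂)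
  have hbez := Int.gcd_eq_gcd_ab p₁ p₂
  rw [← hgg] at hu hv hbez
  have hg0 : 0 < g := by omega
  generalize Int.gcdA p₁ p₂ = A at hbez
  generalize Int.gcdB p₁ p₂ = B at hbez
  have hAB : u * A + v * B = 1 := by
    apply mul_left_cancel₀ hg0.ne'
    rw [hu, hv] at hbez
    linear_combination -hbez
  obtain ⟨H, hH⟩ : ∃ H, H = u * q₂ - v * q₁ := ⟨_, rfl⟩
  obtain ⟨k, hk⟩ : ∃ k, k = B * q₂ + A * q₁ := ⟨_, rfl⟩
  have hD : p₁ * q₂ - p₂ * q₁ = g * H := by rw [hu, hv, hH]; ring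
  have hHpos : 0 < H := by
    rw [hD] at h
    exact pos_of_mul_pos_right h hg0.le
  rw [hD]
  have himg : {z : ℤ × ℤ | 0 ≤ z.1 * q₂ - z.2 * q₁ ∧ z.1 * q₂ - z.2 * q₁ < g * H ∧
      0 ≤ p₁ * z.2 - p₂ * z.1 ∧ p₁ * z.2 - p₂ * z.1 < g * H} =
      (fun w : ℤ × ℤ => (u * (w.1 - (-(k * w.2)) / H) - B * w.2,
        v * (w.1 - (-(k * w.2)) / H) + A * w.2)) ''
        (Finset.Ico 0 g ×ˢ Finset.Ico 0 H : Finset (ℤ × ℤ)) := by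
    ext ⟨x, y⟩
    simp only [Set.mem_ofPred_eq, Set.mem_image, Finset.mem_coe, Finset.mem_product,
      Finset.mem_Ico, Prod.mk.injEq, Prod.exists]
    constructor
    · rintro ⟨h0, h1, h2, h3⟩
      obtain ⟨X, hX⟩ : ∃ X, X = A * x + B * y := ⟨_, rfl⟩
      obtain ⟨Y, hY⟩ : ∃ Y, Y = u * y - v * x := ⟨_, rfl⟩
      have ex : x = u * X - B * Y := by rw [hX, hY]; linear_combination (-x) * hAB
      have ey : y = v * X + A * Y := by rw [hX, hY]; linear_combination (-y) * hAB
      have eU : x * q₂ - y * q₁ = H * X - k * Y := by rw [ex, ey, hH, hk]; ring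
      have eV : p₁ * y - p₂ * x = g * Y := by rw [hu, hv, hY]; ring
      rw [eU] at h0 h1
      rw [eV] at h2 h3
      have d1 := Int.mul_ediv_add_emod (-(k * Y)) H
      have d2 := Int.emod_nonneg (-(k * Y)) hHpos.ne'
      have d3 := Int.emod_lt_of_pos (-(k * Y)) hHpos
      refine ⟨X + (-(k * Y)) / H, Y, ⟨⟨?_, ?_⟩, nonneg_of_mul_nonneg_right h2 hg0,
        lt_of_mul_lt_mul_left h3 hg0.le⟩, by rw [ex]; ring, by rw [ey]; ring⟩
      · by_contra! hc
        nlinarith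
      · by_contra! hc
        nlinarith
    · rintro ⟨i, Y, ⟨⟨i0, i1⟩, Y0, Y1⟩, ex, ey⟩
      have d1 := Int.mul_ediv_add_emod (-(k * Y)) H
      have d2 := Int.emod_nonneg (-(k * Y)) hHpos.ne'
      have d3 := Int.emod_lt_of_pos (-(k * Y)) hHpos
      generalize (-(k * Y)) / H = F at *
      generalize (-(k * Y)) % H = R at *
      have eU : x * q₂ - y * q₁ = H * i + R := by
        rw [← ex, ← ey]
        linear_combination -d1 - (i - F) * hH + Y * hk
      have eV : p₁ * y - p₂ * x = g * Y := by
        rw [hu, hv, ← ex, ← ey]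
        linear_combination g * Y * hAB
      rw [eU, eV]
      refine ⟨by positivity, by nlinarith, by positivity, mul_lt_mul_of_pos_left Y1 hg0⟩
  rw [himg, Set.ncard_image_of_injective, Set.ncard_coe_finset, Finset.card_product,
    Int.card_Ico, Int.card_Ico]
  · push_cast
    rw [Int.toNat_of_nonneg (by omega), Int.toNat_of_nonneg (by omega)]
    ring
  · rintro ⟨i, Y⟩ ⟨j, Z⟩ hw
    simp only [Prod.mk.injEq] at hw
    have hY : Y = Z := by
      linear_combination u * hw.2 - v * hw.1 - (Y - Z) * hAB
    subst hY
    simp only [Prod.mk.injEq, and_true]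
    linear_combination A * hw.1 + B * hw.2 - (i - j) * hAB

/-- Pick's theorem for the lattice triangle with vertices `0`, `(p₁, p₂)`, `(q₁, q₂)`. -/
lemma ncard_triangle (p₁ p₂ q₁ q₂ : ℤ) (h : 0 < p₁ * q₂ - p₂ * q₁) :
    2 * (({z : ℤ × ℤ | 0 ≤ z.1 * q₂ - z.2 * q₁ ∧ 0 ≤ p₁ * z.2 - p₂ * z.1 ∧
      (z.1 * q₂ - z.2 * q₁) + (p₁ * z.2 - p₂ * z.1) ≤ p₁ * q₂ - p₂ * q₁}).ncard : ℤ) =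
      p₁ * q₂ - p₂ * q₁ + Int.gcd p₁ p₂ + Int.gcd q₁ q₂ + Int.gcd (q₁ - p₁) (q₂ - p₂) + 2 := by
  obtain ⟨D, hD⟩ : ∃ D, D = p₁ * q₂ - p₂ * q₁ := ⟨_, rfl⟩
  let U : ℤ × ℤ → ℤ := fun z => z.1 * q₂ - z.2 * q₁
  let V : ℤ × ℤ → ℤ := fun z => p₁ * z.2 - p₂ * z.1
  have hUV : ∀ z w, U z = U w → V z = V w → z = w := by
    rintro ⟨x, y⟩ ⟨x', y'⟩ e1 e2
    simp only [U, V] at e1 e2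
    rw [Prod.mk.injEq]
    constructor <;> apply mul_left_cancel₀ h.ne'
    · linear_combination p₁ * e1 + q₁ * e2
    · linear_combination p₂ * e1 + q₂ * e2
  have hUp : U (p₁, p₂) = D := by simp only [U]; linarith
  have hVp : V (p₁, p₂) = 0 := by simp only [V]; ring
  have hUq : U (q₁, q₂) = 0 := by simp only [U]; ring
  have hVq : V (q₁, q₂) = D := by simp only [V]; linarith
  have hUs : ∀ z w, U (z - w) = U z - U w := by
    intro z w; simp only [U, Prod.fst_sub, Prod.snd_sub]; ring
  have hVs : ∀ z w, V (z - w) = V z - V w := by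
    intro z w; simp only [V, Prod.fst_sub, Prod.snd_sub]; ring
  have hUa : ∀ z w, U (z + w) = U z + U w := by
    intro z w; simp only [U, Prod.fst_add, Prod.snd_add]; ring
  have hVa : ∀ z w, V (z + w) = V z + V w := by
    intro z w; simp only [V, Prod.fst_add, Prod.snd_add]; ring
  have hpar := ncard_parallelogram p₁ p₂ q₁ q₂ h
  have hEp := ncard_segment p₁ p₂ q₂ (-q₁) (by linarith)
  have hEq := ncard_segment q₁ q₂ (-p₂) p₁ (by linarith)
  have hEd := ncard_segment (q₁ - p₁) (q₂ - p₂) (-p₂) p₁ (by linarith)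
  have eP : {z : ℤ × ℤ | p₁ * z.2 = p₂ * z.1 ∧ 0 ≤ q₂ * z.1 + -q₁ * z.2 ∧
      q₂ * z.1 + -q₁ * z.2 < q₂ * p₁ + -q₁ * p₂} = {z | V z = 0 ∧ 0 ≤ U z ∧ U z < D} := by
    ext z
    simp only [Set.mem_ofPred_eq, U, V, hD]
    constructor <;> rintro ⟨e0, e1, e2⟩ <;> exact ⟨by linarith, by linarith, by linarith⟩
  have eQ : {z : ℤ × ℤ | q₁ * z.2 = q₂ * z.1 ∧ 0 ≤ -p₂ * z.1 + p₁ * z.2 ∧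
      -p₂ * z.1 + p₁ * z.2 < -p₂ * q₁ + p₁ * q₂} = {z | U z = 0 ∧ 0 ≤ V z ∧ V z < D} := by
    ext z
    simp only [Set.mem_ofPred_eq, U, V, hD]
    constructor <;> rintro ⟨e0, e1, e2⟩ <;> exact ⟨by linarith, by linarith, by linarith⟩
  have eD : {z : ℤ × ℤ | (q₁ - p₁) * z.2 = (q₂ - p₂) * z.1 ∧ 0 ≤ -p₂ * z.1 + p₁ * z.2 ∧
      -p₂ * z.1 + p₁ * z.2 < -p₂ * (q₁ - p₁) + p₁ * (q₂ - p₂)} =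
      {z | U z + V z = 0 ∧ 0 ≤ V z ∧ V z < D} := by
    ext z
    simp only [Set.mem_ofPred_eq, U, V, hD]
    constructor <;> rintro ⟨e0, e1, e2⟩ <;> exact ⟨by linarith, by linarith, by linarith⟩
  rw [eP] at hEp
  rw [eQ] at hEq
  rw [eD] at hEd
  rw [← hD] at hpar h ⊢
  change ((({z | 0 ≤ U z ∧ U z < D ∧ 0 ≤ V z ∧ V z < D} : Set (ℤ × ℤ)).ncard : ℤ)) = D at hpar
  change 2 * ((({z | 0 ≤ U z ∧ 0 ≤ V z ∧ U z + V z ≤ D} : Set (ℤ × ℤ)).ncard : ℤ)) = _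
  clear_value U V
  clear eP eQ eD hD
  have hfin : ({z | 0 ≤ U z ∧ U z ≤ D ∧ 0 ≤ V z ∧ V z ≤ D} : Set (ℤ × ℤ)).Finite := by
    apply Set.Finite.of_finite_image (f := fun z => (U z, V z))
    · apply ((Set.finite_Icc (0 : ℤ) D).prod (Set.finite_Icc (0 : ℤ) D)).subset
      rintro _ ⟨z, ⟨h0, h1, h2, h3⟩, rfl⟩
      exact ⟨⟨h0, h1⟩, h2, h3⟩
    · intro z _ w _ e
      simp only [Prod.mk.injEq] at e
      exact hUV z w e.1 e.2
  have shift : ∀ (S T : Set (ℤ × ℤ)) (w : ℤ × ℤ), (∀ z, z ∈ S ↔ z - w ∈ T) →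
      S.ncard = T.ncard := by
    intro S T w hST
    rw [← Set.ncard_image_of_injective S (sub_left_injective (b := w))]
    congr 1
    ext z
    constructor
    · rintro ⟨y, hy, rfl⟩
      exact (hST y).1 hy
    · intro hz
      exact ⟨z + w, (hST _).2 (by simpa using hz), by simp⟩
  have tP : ({z | V z = D ∧ 0 ≤ U z ∧ U z < D} : Set (ℤ × ℤ)).ncard = Int.gcd p₁ p₂ := by
    rw [← hEp]
    apply shift _ _ (q₁, q₂)
    intro z
    simp only [Set.mem_ofPred_eq, hUs, hVs, hUq, hVq]
    omega
  have tQ : ({z | U z = D ∧ 0 ≤ V z ∧ V z < D} : Set (ℤ × ℤ)).ncard = Int.gcd q₁ q₂ := by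
    rw [← hEq]
    apply shift _ _ (p₁, p₂)
    intro z
    simp only [Set.mem_ofPred_eq, hUs, hVs, hUp, hVp]
    omega
  have tD : ({z | U z + V z = D ∧ 0 ≤ V z ∧ V z < D} : Set (ℤ × ℤ)).ncard =
      Int.gcd (q₁ - p₁) (q₂ - p₂) := by
    rw [← hEd]
    apply shift _ _ (p₁, p₂)
    intro z
    simp only [Set.mem_ofPred_eq, hUs, hVs, hUp, hVp]
    omega
  have cD : ({z | U z + V z = D ∧ 0 ≤ V z ∧ V z ≤ D} : Set (ℤ × ℤ)).ncard =
      Int.gcd (q₁ - p₁) (q₂ - p₂) + 1 := by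
    have hq : (q₁, q₂) ∉ {z | U z + V z = D ∧ 0 ≤ V z ∧ V z < D} := by
      rintro ⟨-, -, e⟩
      omega
    rw [← tD, ← Set.ncard_insert_of_notMem hq (hfin.subset fun z hz => by
      simp only [Set.mem_ofPred_eq] at hz ⊢; omega)]
    congr 1
    ext z
    simp only [Set.mem_insert_iff, Set.mem_ofPred_eq]
    constructor
    · rintro ⟨e0, e1, e2⟩
      rcases e2.lt_or_eq with e2 | e2
      · exact Or.inr ⟨e0, e1, e2⟩
      · exact Or.inl (hUV _ _ (by rw [hUq]; linarith) (by rw [hVq]; linarith))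
    · rintro (rfl | ⟨e0, e1, e2⟩)
      · rw [hUq, hVq]; omega
      · omega
  have hclosed : (({z | 0 ≤ U z ∧ U z ≤ D ∧ 0 ≤ V z ∧ V z ≤ D} : Set (ℤ × ℤ)).ncard : ℤ) =
      D + Int.gcd p₁ p₂ + Int.gcd q₁ q₂ + 1 := by
    have e : ({z | 0 ≤ U z ∧ U z ≤ D ∧ 0 ≤ V z ∧ V z ≤ D} : Set (ℤ × ℤ)) =
        insert ((p₁, p₂) + (q₁, q₂)) (({z | 0 ≤ U z ∧ U z < D ∧ 0 ≤ V z ∧ V z < D} ∪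
          {z | V z = D ∧ 0 ≤ U z ∧ U z < D}) ∪ {z | U z = D ∧ 0 ≤ V z ∧ V z < D}) := by
      ext z
      simp only [Set.mem_insert_iff, Set.mem_union, Set.mem_ofPred_eq]
      constructor
      · intro hz
        by_cases hc : U z = D ∧ V z = D
        · exact Or.inl (hUV _ _ (by rw [hUa, hUp, hUq]; omega) (by rw [hVa, hVp, hVq]; omega))
        · right; omega
      · rintro (rfl | hz)
        · rw [hUa, hVa, hUp, hVp, hUq, hVq]; omega
        · omega
    have hf := hfin
    rw [e] at hf ⊢
    have hf1 := hf.subset (Set.subset_insert _ _)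
    have hf2 := hf1.subset Set.subset_union_left
    rw [Set.ncard_insert_of_notMem _ hf1, Set.ncard_union_eq _ hf2 (hf1.subset Set.subset_union_right),
      Set.ncard_union_eq _ (hf2.subset Set.subset_union_left) (hf2.subset Set.subset_union_right),
      tP, tQ]
    · push_cast
      rw [hpar]
    · rw [Set.disjoint_left]
      intro z; simp only [Set.mem_ofPred_eq]; omega
    · rw [Set.disjoint_left]
      intro z; simp only [Set.mem_ofPred_eq, Set.mem_union]; omega
    · simp only [Set.mem_ofPred_eq, Set.mem_union, hUa, hVa, hUp, hVp, hUq, hVq]; omega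
  have hrefl : ({z | U z ≤ D ∧ V z ≤ D ∧ D ≤ U z + V z} : Set (ℤ × ℤ)).ncard =
      ({z | 0 ≤ U z ∧ 0 ≤ V z ∧ U z + V z ≤ D} : Set (ℤ × ℤ)).ncard := by
    rw [← Set.ncard_image_of_injective {z | 0 ≤ U z ∧ 0 ≤ V z ∧ U z + V z ≤ D}
      (sub_right_injective (b := (p₁, p₂) + (q₁, q₂)))]
    congr 1
    ext z
    constructor
    · rintro ⟨e0, e1, e2⟩
      refine ⟨(p₁, p₂) + (q₁, q₂) - z, ⟨?_, ?_, ?_⟩, sub_sub_cancel _ _⟩ <;>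
        simp only [hUs, hVs, hUa, hVa, hUp, hVp, hUq, hVq] <;> linarith
    · rintro ⟨w, ⟨e0, e1, e2⟩, rfl⟩
      refine ⟨?_, ?_, ?_⟩ <;>
        simp only [hUs, hVs, hUa, hVa, hUp, hVp, hUq, hVq] <;> linarith
  have hui := Set.ncard_union_add_ncard_inter
    {z | 0 ≤ U z ∧ 0 ≤ V z ∧ U z + V z ≤ D} {z | U z ≤ D ∧ V z ≤ D ∧ D ≤ U z + V z}
    (hfin.subset fun z hz => by simp only [Set.mem_ofPred_eq] at hz ⊢; omega)
    (hfin.subset fun z hz => by simp only [Set.mem_ofPred_eq] at hz ⊢; omega)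
  have e1 : ({z | 0 ≤ U z ∧ 0 ≤ V z ∧ U z + V z ≤ D} ∪ {z | U z ≤ D ∧ V z ≤ D ∧ D ≤ U z + V z} :
      Set (ℤ × ℤ)) = {z | 0 ≤ U z ∧ U z ≤ D ∧ 0 ≤ V z ∧ V z ≤ D} := by
    ext z; simp only [Set.mem_union, Set.mem_ofPred_eq]; omega
  have e2 : ({z | 0 ≤ U z ∧ 0 ≤ V z ∧ U z + V z ≤ D} ∩ {z | U z ≤ D ∧ V z ≤ D ∧ D ≤ U z + V z} :
      Set (ℤ × ℤ)) = {z | U z + V z = D ∧ 0 ≤ V z ∧ V z ≤ D} := by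
    ext z; simp only [Set.mem_inter_iff, Set.mem_ofPred_eq]; omega
  rw [e1, e2, hrefl, cD] at hui
  zify at hui
  rw [hclosed] at hui
  linarith

lemma mem_smul_convexHull_triple {E : Type*} [AddCommGroup E] [Module ℝ E] {t : ℝ} (ht : 0 < t)
    (x y p : E) : p ∈ t • convexHull ℝ {0, x, y} ↔
      ∃ u v : ℝ, 0 ≤ u ∧ 0 ≤ v ∧ u + v ≤ t ∧ p = u • x + v • y := by
  have key : convexHull ℝ {0, x, y} =
      {p | ∃ u v : ℝ, 0 ≤ u ∧ 0 ≤ v ∧ u + v ≤ 1 ∧ p = u • x + v • y} := by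
    apply Set.Subset.antisymm
    · apply convexHull_min
      · rintro _ (rfl | rfl | rfl)
        · exact ⟨0, 0, by simp⟩
        · exact ⟨1, 0, by simp⟩
        · exact ⟨0, 1, by simp⟩
      · rintro _ ⟨u, v, hu, hv, huv, rfl⟩ _ ⟨u', v', hu', hv', huv', rfl⟩ A B hA hB hAB
        refine ⟨A * u + B * u', A * v + B * v', by positivity, by positivity, ?_, by module⟩
        nlinarith
    · rintro _ ⟨u, v, hu, hv, huv, rfl⟩
      have := (convex_convexHull ℝ {0, x, y}).sum_mem (t := Finset.univ)
        (w := ![1 - u - v, u, v]) (z := ![0, x, y])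
        (by intro i _; fin_cases i <;> simp <;> linarith)
        (by simp [Fin.sum_univ_three]; ring)
        (by intro i _; apply subset_convexHull; fin_cases i <;> simp)
      simpa [Fin.sum_univ_three] using this
  rw [key, Set.mem_smul_set]
  constructor
  · rintro ⟨_, ⟨u, v, hu, hv, huv, rfl⟩, rfl⟩
    exact ⟨t * u, t * v, by positivity, by positivity, by nlinarith, by module⟩
  · rintro ⟨u, v, hu, hv, huv, rfl⟩
    refine ⟨(u / t) • x + (v / t) • y, ⟨u / t, v / t, by positivity, by positivity, ?_, rfl⟩, ?_⟩
    · rw [← add_div]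
      exact (div_le_one ht).2 huv
    · rw [smul_add, smul_smul, smul_smul, mul_div_cancel₀ _ ht.ne', mul_div_cancel₀ _ ht.ne']

/-- A lattice triangle in the plane orthogonal to a primitive vector `(ω a, ω b, c)`, with its
vertices given in the lattice basis `ξ`, `(-b, a, 0)`, where `ξ` has third coordinate `ω`. -/
lemma ncard_smul_triangle_s14 {a b c d ω n m α β : ℤ} (hω : 0 < ω) (hab : IsCoprime a b)
    (hωc : IsCoprime ω c) (hd : 0 < d) (hdet : n * β + m * α = d)
    {ξ ζ η : Fin 3 → ℤ} (hξ : ω * a * ξ 0 + ω * b * ξ 1 + c * ξ 2 = 0) (hξ2 : ξ 2 = ω)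
    (hζ : ζ = ![m * ξ 0 - β * b, m * ξ 1 + β * a, m * ω])
    (hη : η = ![n * ξ 0 + α * b, n * ξ 1 - α * a, n * ω]) {t : ℕ} (ht : 0 < t) :
    2 * (({p : Fin 3 → ℤ | (fun i => (p i : ℝ)) ∈
      (t : ℝ) • convexHull ℝ {0, (fun i => (ζ i : ℝ)), (fun i => (η i : ℝ))}}).ncard : ℤ) =
      d * t ^ 2 + (Int.gcd m β + Int.gcd n α + Int.gcd (m - n) (β + α)) * t + 2 := by
  have hT : (0 : ℤ) < t := by exact_mod_cast ht
  have hTR : (0 : ℝ) < t := by exact_mod_cast ht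
  have hdR : (0 : ℝ) < d := by exact_mod_cast hd
  have hωR : (0 : ℝ) < ω := by exact_mod_cast hω
  have hdetR : (n * β + m * α : ℝ) = d := by exact_mod_cast hdet
  have hdet' : (t * n) * (t * β) - (t * -α) * (t * m) = t ^ 2 * d := by
    rw [← hdet]; ring
  have hpick := ncard_triangle (t * n) (t * -α) (t * m) (t * β) (by rw [hdet']; positivity)
  have hab0 : ∀ y : ℤ, y * a = 0 → y * b = 0 → y = 0 := by
    obtain ⟨A, B, hAB⟩ := hab
    intro y h1 h2
    linear_combination A * h1 + B * h2 - y * hAB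
  let e : ℤ × ℤ → Fin 3 → ℤ := fun z => ![z.1 * ξ 0 - z.2 * b, z.1 * ξ 1 + z.2 * a, z.1 * ω]
  have he : Function.Injective e := by
    rintro ⟨x, y⟩ ⟨x', y'⟩ h
    have h0 := congrFun h 0
    have h1 := congrFun h 1
    have h2 := congrFun h 2
    simp only [e, Matrix.cons_val] at h0 h1 h2
    have hx : x = x' := mul_right_cancel₀ hω.ne' h2
    subst hx
    have := hab0 (y - y') (by linear_combination h1) (by linear_combination -h0)
    rw [sub_eq_zero.1 this]
  have hset : {p : Fin 3 → ℤ | (fun i => (p i : ℝ)) ∈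
      (t : ℝ) • convexHull ℝ {0, (fun i => (ζ i : ℝ)), (fun i => (η i : ℝ))}} =
      e '' {z : ℤ × ℤ | 0 ≤ z.1 * (t * β) - z.2 * (t * m) ∧ 0 ≤ (t * n) * z.2 - (t * -α) * z.1 ∧
      (z.1 * (t * β) - z.2 * (t * m)) + ((t * n) * z.2 - (t * -α) * z.1) ≤
        (t * n) * (t * β) - (t * -α) * (t * m)} := by
    rw [hdet']
    ext p
    rw [Set.mem_ofPred_eq, mem_smul_convexHull_triple hTR]
    constructor
    · rintro ⟨v, u, hv, hu, huv, hp⟩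
      have h0 := congrFun hp 0
      have h1 := congrFun hp 1
      have h2 := congrFun hp 2
      simp only [hζ, hη, Pi.add_apply, Pi.smul_apply, smul_eq_mul, Matrix.cons_val] at h0 h1 h2
      push_cast at h0 h1 h2
      have hξR : (ω * a * ξ 0 + ω * b * ξ 1 + c * ω : ℝ) = 0 := by
        rw [hξ2] at hξ; exact_mod_cast hξ
      have horth : ω * a * p 0 + ω * b * p 1 + c * p 2 = 0 := by
        have : (ω * a * p 0 + ω * b * p 1 + c * p 2 : ℝ) = 0 := by
          rw [h0, h1, h2]
          linear_combination (v * m + u * n) * hξR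
        exact_mod_cast this
      obtain ⟨x, hx⟩ : ω ∣ p 2 := by
        apply hωc.dvd_of_dvd_mul_left
        exact ⟨-(a * p 0 + b * p 1), by linear_combination horth⟩
      have hline : a * (p 0 - x * ξ 0) + b * (p 1 - x * ξ 1) = 0 := by
        apply mul_left_cancel₀ hω.ne'
        rw [hξ2] at hξ
        rw [hx] at horth
        linear_combination horth - x * hξ
      obtain ⟨A, B, hAB⟩ := hab
      obtain ⟨y, hy⟩ : ∃ y, y = A * (p 1 - x * ξ 1) - B * (p 0 - x * ξ 0) := ⟨_, rfl⟩
      have hy0 : p 0 = x * ξ 0 - y * b := by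
        rw [hy]
        linear_combination A * hline - (p 0 - x * ξ 0) * hAB
      have hy1 : p 1 = x * ξ 1 + y * a := by
        rw [hy]
        linear_combination B * hline - (p 1 - x * ξ 1) * hAB
      have hpe : e (x, y) = p := by
        ext i
        fin_cases i <;> simp [e] <;> linarith
      have hxR : (x : ℝ) = v * m + u * n := by
        apply mul_left_cancel₀ hωR.ne'
        have : (p 2 : ℝ) = ω * x := by exact_mod_cast hx
        linear_combination h2 - this
      have hyR : (y : ℝ) = v * β - u * α := by
        have e0 : (p 0 : ℝ) = x * ξ 0 - y * b := by exact_mod_cast hy0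
        have e1 : (p 1 : ℝ) = x * ξ 1 + y * a := by exact_mod_cast hy1
        have eAB : (A * a + B * b : ℝ) = 1 := by exact_mod_cast hAB
        linear_combination A * (h1 - e1 - ξ 1 * hxR) - B * (h0 - e0 - ξ 0 * hxR) -
          (y - v * β + u * α) * eAB
      have eU : (x * β - y * m : ℝ) = u * d := by
        rw [hxR, hyR, ← hdetR]; ring
      have eV : (n * y + α * x : ℝ) = v * d := by
        rw [hxR, hyR, ← hdetR]; ring
      have iU : 0 ≤ x * β - y * m := by
        have : (0 : ℝ) ≤ x * β - y * m := by rw [eU]; positivity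
        exact_mod_cast this
      have iV : 0 ≤ n * y + α * x := by
        have : (0 : ℝ) ≤ n * y + α * x := by rw [eV]; positivity
        exact_mod_cast this
      have iUV : (x * β - y * m) + (n * y + α * x) ≤ t * d := by
        have : ((x * β - y * m) + (n * y + α * x) : ℝ) ≤ t * d := by
          rw [eU, eV, ← add_mul]
          exact mul_le_mul_of_nonneg_right (by linarith) hdR.le
        exact_mod_cast this
      exact ⟨(x, y), ⟨by nlinarith, by nlinarith, by nlinarith⟩, hpe⟩
    · rintro ⟨⟨x, y⟩, ⟨hU, hV, hUV⟩, rfl⟩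
      have e1 : x * (t * β) - y * (t * m) = t * (x * β - y * m) := by ring
      have e2 : t * n * y - t * -α * x = t * (n * y + α * x) := by ring
      simp only [e1, e2] at hU hV hUV
      have hU' : (0 : ℝ) ≤ x * β - y * m := by
        exact_mod_cast nonneg_of_mul_nonneg_right hU hT
      have hV' : (0 : ℝ) ≤ n * y + α * x := by
        exact_mod_cast nonneg_of_mul_nonneg_right hV hT
      have hUV' : ((x * β - y * m) + (n * y + α * x) : ℝ) ≤ t * d := by
        have : (x * β - y * m) + (n * y + α * x) ≤ t * d :=
          le_of_mul_le_mul_left (by linarith) hT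
        exact_mod_cast this
      have hx : (x : ℝ) = (n * y + α * x) / d * m + (x * β - y * m) / d * n := by
        field_simp
        linear_combination (-x : ℝ) * hdetR
      have hy : (y : ℝ) = (n * y + α * x) / d * β - (x * β - y * m) / d * α := by
        field_simp
        linear_combination (-y : ℝ) * hdetR
      refine ⟨(n * y + α * x) / d, (x * β - y * m) / d, by positivity, by positivity, ?_, ?_⟩
      · rw [← add_div, div_le_iff₀ hdR]
        linarith
      · generalize ((n * y + α * x) / d : ℝ) = v at *
        generalize ((x * β - y * m) / d : ℝ) = u at *
        ext i
        fin_cases i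
        · simp [e, hζ, hη]
          linear_combination (ξ 0 : ℝ) * hx - b * hy
        · simp [e, hζ, hη]
          linear_combination (ξ 1 : ℝ) * hx + a * hy
        · simp [e, hζ, hη]
          linear_combination (ω : ℝ) * hx
  rw [hset, Set.ncard_image_of_injective _ he, hpick, hdet', ← mul_sub, ← mul_sub]
  simp only [Int.gcd_mul_left, Int.gcd_neg, sub_neg_eq_add, Int.natAbs_natCast]
  push_cast
  ring

theorem stmt_14 (a b c d r s rt st α β : ℤ)
    (hgcd : Int.gcd (Int.gcd a b : ℤ) c = 1)
    (hsum : a ^ 2 + b ^ 2 + c ^ 2 = 3 * d ^ 2)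
    (hd : 1 ≤ d) (hab : ¬(a = 0 ∧ b = 0))
    (hq : 2 * (a ^ 2 + b ^ 2) = s ^ 2 + 3 * r ^ 2)
    (h1 : (a ^ 2 + b ^ 2) ∣ (r * a * c + d * b * s))
    (h2 : (a ^ 2 + b ^ 2) ∣ (d * a * s - b * c * r))
    (h3 : (a ^ 2 + b ^ 2) ∣ (3 * d * b * r - a * c * s))
    (h4 : (a ^ 2 + b ^ 2) ∣ (3 * d * a * r + b * c * s))
    (hr : r = (Int.gcd a b : ℤ) * rt)
    (hs : s = (Int.gcd a b : ℤ) * st)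
    (hrs : Even (rt + st))
    (ζ ς : Fin 3 → ℤ)
    (hζ : ζ = ![-(r * a * c + d * b * s) / (a ^ 2 + b ^ 2),
                 (d * a * s - b * c * r) / (a ^ 2 + b ^ 2), r])
    (hς : ς = ![(3 * d * b * r - a * c * s) / (a ^ 2 + b ^ 2),
                 -(3 * d * a * r + b * c * s) / (a ^ 2 + b ^ 2), s])
    (heven : ∀ i, Even (ζ i + ς i))
    (η : Fin 3 → ℤ) (hη : η = fun i => (ζ i + ς i) / 2)
    (hαβ : ((rt + st) / 2) * β + rt * α = d)
    (hdiv : ∀ i, d ∣ (α * ζ i + β * η i))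
    (Δ : Set (Fin 3 → ℝ))
    (hΔ : Δ = convexHull ℝ {0, (fun i => (ζ i : ℝ)), (fun i => (η i : ℝ))})
    (c₁ : ℤ)
    (hc₁ : c₁ = Int.gcd rt β + Int.gcd ((rt + st) / 2) α +
                Int.gcd ((rt - st) / 2) (α + β))
    (t : ℕ) (ht : 0 < t) :
    (({p : Fin 3 → ℤ | (fun i => (p i : ℝ)) ∈ (t : ℝ) • Δ}).ncard : ℚ) =
      ((d : ℚ) * (t : ℚ) ^ 2 + (c₁ : ℚ) * (t : ℚ)) / 2 + 1 := by
  obtain ⟨ω, hωdef⟩ : ∃ ω : ℤ, ω = Int.gcd a b := ⟨_, rfl⟩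
  have hω : 0 < ω := by
    have : 0 < Int.gcd a b := Int.gcd_pos_iff.2 (by tauto)
    omega
  have hωc : IsCoprime ω c := by
    rw [Int.isCoprime_iff_gcd_eq_one, hωdef]
    exact hgcd
  obtain ⟨a', ha⟩ : ω ∣ a := hωdef ▸ Int.gcd_dvd_left ..
  obtain ⟨b', hb⟩ : ω ∣ b := hωdef ▸ Int.gcd_dvd_right ..
  have hbez := Int.gcd_eq_gcd_ab a b
  rw [← hωdef] at hbez hr hs
  generalize Int.gcdA a b = A at hbez
  generalize Int.gcdB a b = B at hbez
  have hAB : A * a' + B * b' = 1 := by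
    apply mul_left_cancel₀ hω.ne'
    rw [ha, hb] at hbez
    linear_combination -hbez
  have hQ : 0 < a ^ 2 + b ^ 2 := by
    have : a ≠ 0 ∨ b ≠ 0 := by tauto
    rcases this with h | h <;> positivity
  obtain ⟨n, hn⟩ := hrs.two_dvd
  have hn1 : (rt + st) / 2 = n := by omega
  have hn2 : (rt - st) / 2 = rt - n := by omega
  rw [hn1] at hαβ hc₁
  rw [hn2] at hc₁
  -- clear the denominators
  have hς0 : (a ^ 2 + b ^ 2) * ς 0 = 3 * d * b * r - a * c * s := by
    rw [hς]; exact Int.mul_ediv_cancel' h3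
  have hς1 : (a ^ 2 + b ^ 2) * ς 1 = -(3 * d * a * r + b * c * s) := by
    rw [hς]; exact Int.mul_ediv_cancel' (dvd_neg.2 h4)
  have hς2 : ς 2 = s := by rw [hς]; rfl
  have hζ0 : (a ^ 2 + b ^ 2) * ζ 0 = -(r * a * c + d * b * s) := by
    rw [hζ]; exact Int.mul_ediv_cancel' (dvd_neg.2 h1)
  have hζ1 : (a ^ 2 + b ^ 2) * ζ 1 = d * a * s - b * c * r := by
    rw [hζ]; exact Int.mul_ediv_cancel' h2
  have hζ2 : ζ 2 = ω * rt := by rw [hζ, ← hr]; rfl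
  have hη' : ∀ i, 2 * η i = ζ i + ς i := fun i => by
    rw [hη]; exact Int.mul_ediv_cancel' (heven i).two_dvd
  have hη2 : η 2 = ω * n := by
    have := hη' 2
    rw [hς2, hζ2, hs, ← mul_add, hn] at this
    linarith
  have orthζ : a * ζ 0 + b * ζ 1 + c * ζ 2 = 0 := by
    apply mul_left_cancel₀ hQ.ne'
    rw [hζ2, ← hr]
    linear_combination a * hζ0 + b * hζ1
  have orthς : a * ς 0 + b * ς 1 + c * ς 2 = 0 := by
    apply mul_left_cancel₀ hQ.ne'
    rw [hς2]
    linear_combination a * hς0 + b * hς1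
  have orthη : a * η 0 + b * η 1 + c * η 2 = 0 := by
    have h0 := hη' 0
    have h1 := hη' 1
    have h2 := hη' 2
    apply mul_left_cancel₀ (two_ne_zero (α := ℤ))
    linear_combination a * h0 + b * h1 + c * h2 + orthζ + orthς
  have cross0 : ζ 1 * η 2 - ζ 2 * η 1 = d * a := by
    apply mul_left_cancel₀ (mul_pos two_pos hQ).ne'
    have h1 := hη' 1
    have h2 := hη' 2
    have hz : ζ 2 = r := by rw [hζ2, hr]
    rw [hς2, hz] at h2
    rw [hz]
    linear_combination (a ^ 2 + b ^ 2) * ζ 1 * h2 - (a ^ 2 + b ^ 2) * r * h1 + s * hζ1 -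
      r * hς1 - d * a * hq
  have cross1 : ζ 2 * η 0 - ζ 0 * η 2 = d * b := by
    apply mul_left_cancel₀ (mul_pos two_pos hQ).ne'
    have h0 := hη' 0
    have h2 := hη' 2
    have hz : ζ 2 = r := by rw [hζ2, hr]
    rw [hς2, hz] at h2
    rw [hz]
    linear_combination (a ^ 2 + b ^ 2) * r * h0 - (a ^ 2 + b ^ 2) * ζ 0 * h2 - s * hζ0 +
      r * hς0 - d * b * hq
  choose ξ hξ using hdiv
  have hd0 : d ≠ 0 := by omega
  have hξ2 : ξ 2 = ω := by
    apply mul_left_cancel₀ hd0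
    rw [← hξ, hζ2, hη2]
    linear_combination ω * hαβ
  have orthξ : a * ξ 0 + b * ξ 1 + c * ξ 2 = 0 := by
    apply mul_left_cancel₀ hd0
    linear_combination α * orthζ + β * orthη - a * hξ 0 - b * hξ 1 - c * hξ 2
  have C0 : n * ζ 1 - rt * η 1 = d * a' := by
    apply mul_left_cancel₀ hω.ne'
    rw [hζ2, hη2, ha] at cross0
    linear_combination cross0
  have C1 : rt * η 0 - n * ζ 0 = d * b' := by
    apply mul_left_cancel₀ hω.ne'
    rw [hζ2, hη2, hb] at cross1
    linear_combination cross1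
  have eζ0 : ζ 0 = rt * ξ 0 - β * b' := by
    apply mul_left_cancel₀ hd0
    linear_combination rt * hξ 0 - ζ 0 * hαβ - β * C1
  have eζ1 : ζ 1 = rt * ξ 1 + β * a' := by
    apply mul_left_cancel₀ hd0
    linear_combination rt * hξ 1 - ζ 1 * hαβ + β * C0
  have eη0 : η 0 = n * ξ 0 + α * b' := by
    apply mul_left_cancel₀ hd0
    linear_combination n * hξ 0 - η 0 * hαβ + α * C1
  have eη1 : η 1 = n * ξ 1 - α * a' := by
    apply mul_left_cancel₀ hd0
    linear_combination n * hξ 1 - η 1 * hαβ - α * C0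
  have main := ncard_smul_triangle_s14 (n := n) (m := rt) (ζ := ζ) (η := η) hω ⟨A, B, hAB⟩ hωc
    (by omega) (by linarith : n * β + rt * α = d) (by rw [← ha, ← hb]; exact orthξ) hξ2
    (by ext i; fin_cases i <;> simp [eζ0, eζ1, hζ2, mul_comm])
    (by ext i; fin_cases i <;> simp [eη0, eη1, hη2, mul_comm]) ht
  rw [← hΔ, add_comm β α, add_right_comm, add_assoc] at main
  have main' := congrArg (Int.cast (R := ℚ)) main
  rw [hc₁]
  push_cast at main' ⊢
  linarith
end

section
/- Each of the three greatest common divisors gcd(m·(r̃ + s̃)/2 + n·(r̃ − s̃)/2, m·α − n·(α + β)), gcd(m·r̃ − n·(r̃ + s̃)/2, m·β + n·α), and gcd(m·(s̃ − r̃)/2 + n·r̃, m·(α + β) − n·β) divides d. -/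
/-- If `m` and `n` are coprime, the gcd of the entries of the image of `(m, n)` under an integer
`2 × 2` matrix divides the determinant of that matrix. -/
theorem Int.gcd_linear_forms_dvd_det {m n : ℤ} (hmn : IsCoprime m n) (a b c e : ℤ) :
    (Int.gcd (m * a + n * b) (m * c + n * e) : ℤ) ∣ a * e - b * c := by
  obtain ⟨u, v, huv⟩ := hmn
  have h : a * e - b * c =
      (m * a + n * b) * (u * e - v * c) + (m * c + n * e) * (v * a - u * b) := by
    linear_combination (-(a * e - b * c)) * huv
  rw [h]
  exact dvd_add ((Int.gcd_dvd_left _ _).mul_right _) ((Int.gcd_dvd_right _ _).mul_right _)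

theorem stmt_15 (rt st α β d m n : ℤ)
    (hrs : Even (rt + st))
    (hmn : Int.gcd m n = 1)
    (hαβ : ((rt + st) / 2) * β + rt * α = d) :
    (Int.gcd (m * ((rt + st) / 2) + n * ((rt - st) / 2)) (m * α - n * (α + β)) : ℤ) ∣ d ∧
    (Int.gcd (m * rt - n * ((rt + st) / 2)) (m * β + n * α) : ℤ) ∣ d ∧
    (Int.gcd (m * ((st - rt) / 2) + n * rt) (m * (α + β) - n * β) : ℤ) ∣ d := by
  have hcop : IsCoprime m n := Int.isCoprime_iff_gcd_eq_one.mpr hmn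
  obtain ⟨k, hk⟩ := hrs
  have hsum : (rt + st) / 2 = k := by omega
  have hsub : (rt - st) / 2 = rt - k := by omega
  have hsub' : (st - rt) / 2 = k - rt := by omega
  rw [hsum] at hαβ
  rw [hsum, hsub, hsub']
  refine ⟨?_, ?_, ?_⟩
  · have h := Int.gcd_linear_forms_dvd_det hcop k (rt - k) α (-(α + β))
    rw [mul_neg, ← sub_eq_add_neg] at h
    rw [← Int.dvd_neg]
    convert h using 1
    linear_combination hαβ
  · have h := Int.gcd_linear_forms_dvd_det hcop rt (-k) β α
    rw [mul_neg, ← sub_eq_add_neg] at h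
    convert h using 1
    linear_combination -hαβ
  · have h := Int.gcd_linear_forms_dvd_det hcop (k - rt) rt (α + β) (-β)
    rw [mul_neg n, ← sub_eq_add_neg] at h
    rw [← Int.dvd_neg]
    convert h using 1
    linear_combination hαβ
end

section
/- Let m, n be integers with gcd(m, n) = 1, set P = m·ζ − n·η and Q = n·ζ + (m − n)·η, let Δ ⊆ ℝ³ be the convex hull of {(0,0,0), P, Q}, and set c₁ = gcd(m·(r̃ + s̃)/2 + n·(r̃ − s̃)/2, m·α − n·(α + β)) + gcd(m·r̃ − n·(r̃ + s̃)/2, m·β + n·α) + gcd(m·(s̃ − r̃)/2 + n·r̃, m·(α + β) − n·β). Then for every positive integer t, the number of points of ℤ³ lying in tΔ equals (d·(m² − mn + n²)·t² + c₁·t)/2 + 1. -/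
open Pointwise

theorem exists_primitive_and_complement (x y : ℤ) (h : ¬(x = 0 ∧ y = 0)) :
    ∃ x' y' u v : ℤ, x = Int.gcd x y * x' ∧ y = Int.gcd x y * y' ∧ x' * v - y' * u = 1 ∧
      0 < (Int.gcd x y : ℤ) := by
  obtain ⟨x', hx⟩ := Int.gcd_dvd_left x y
  obtain ⟨y', hy⟩ := Int.gcd_dvd_right x y
  have hg : 0 < (Int.gcd x y : ℤ) := by
    have := Int.gcd_pos_iff (a := x) (b := y)
    have : 0 < Int.gcd x y := by rw [this]; tauto
    exact_mod_cast this
  refine ⟨x', y', -Int.gcdB x y, Int.gcdA x y, hx, hy, ?_, hg⟩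
  have h1 := Int.gcd_eq_gcd_ab x y
  set g : ℤ := (Int.gcd x y : ℤ)
  apply mul_left_cancel₀ hg.ne'
  linear_combination -h1 - Int.gcdA x y * hx - Int.gcdB x y * hy

theorem ncard_halfOpen_parallelogram (p₁ p₂ q₁ q₂ D : ℤ) (hD : p₁ * q₂ - p₂ * q₁ = D)
    (hpos : 0 < D) :
    ({z : ℤ × ℤ | 0 ≤ z.1 * q₂ - z.2 * q₁ ∧ z.1 * q₂ - z.2 * q₁ < D ∧
      0 ≤ p₁ * z.2 - p₂ * z.1 ∧ p₁ * z.2 - p₂ * z.1 < D}.ncard : ℤ) = D := by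
  have hp : ¬(p₁ = 0 ∧ p₂ = 0) := by
    rintro ⟨rfl, rfl⟩
    simp at hD
    omega
  obtain ⟨x, y, u, v, hx, hy, huv, hg⟩ := exists_primitive_and_complement p₁ p₂ hp
  set g : ℤ := (Int.gcd p₁ p₂ : ℤ)
  obtain ⟨h, hh⟩ : ∃ h, h = x * q₂ - y * q₁ := ⟨_, rfl⟩
  obtain ⟨e, he⟩ : ∃ e, e = u * q₂ - v * q₁ := ⟨_, rfl⟩
  have hgh : D = g * h := by rw [← hD, hh, hx, hy]; ring
  have hh0 : 0 < h := pos_of_mul_pos_right (hgh ▸ hpos) hg.le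
  let f : ℤ × ℤ → ℤ × ℤ := fun k =>
    ((k.1 - k.2 * e / h) * x + k.2 * u, (k.1 - k.2 * e / h) * y + k.2 * v)
  have hinj : Function.Injective f := by
    rintro ⟨i, Y⟩ ⟨i', Y'⟩ hf
    simp only [f, Prod.mk.injEq] at hf
    obtain ⟨f1, f2⟩ := hf
    have hY : Y = Y' := by linear_combination (-y) * f1 + x * f2 + (Y' - Y) * huv
    subst hY
    have : i = i' := by linear_combination v * f1 - u * f2 + (i' - i) * huv
    rw [this]
  have hset : {z : ℤ × ℤ | 0 ≤ z.1 * q₂ - z.2 * q₁ ∧ z.1 * q₂ - z.2 * q₁ < D ∧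
      0 ≤ p₁ * z.2 - p₂ * z.1 ∧ p₁ * z.2 - p₂ * z.1 < D} =
      f '' ((Finset.Ico 0 g ×ˢ Finset.Ico 0 h : Finset (ℤ × ℤ)) : Set (ℤ × ℤ)) := by
    have key : ∀ k : ℤ × ℤ, (f k).1 * q₂ - (f k).2 * q₁ = k.1 * h + (k.2 * e) % h ∧
        p₁ * (f k).2 - p₂ * (f k).1 = g * k.2 := by
      rintro ⟨i, Y⟩
      have hm := Int.emod_add_mul_ediv (Y * e) h
      constructor
      · simp only [f]
        linear_combination (-(i - Y * e / h)) * hh - Y * he - hm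
      · simp only [f]
        rw [hx, hy]
        linear_combination (g * Y) * huv
    have surj : ∀ z : ℤ × ℤ, ∃ k, f k = z := by
      rintro ⟨z₁, z₂⟩
      refine ⟨(z₁ * v - z₂ * u + (x * z₂ - y * z₁) * e / h, x * z₂ - y * z₁), ?_⟩
      simp only [f, Prod.mk.injEq]
      constructor
      · linear_combination z₁ * huv
      · linear_combination z₂ * huv
    ext z
    obtain ⟨k, rfl⟩ := surj z
    rw [Set.mem_ofPred_eq, hinj.mem_set_image, (key k).1, (key k).2]
    simp only [Finset.coe_product, Finset.coe_Ico, Set.mem_prod, Set.mem_Ico]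
    have m0 := Int.emod_nonneg (k.2 * e) hh0.ne'
    have m1 := Int.emod_lt_of_pos (k.2 * e) hh0
    set μ := (k.2 * e) % h
    subst hgh
    constructor
    · rintro ⟨a1, a2, a3, a4⟩
      refine ⟨⟨?_, ?_⟩, ?_, ?_⟩ <;> by_contra! hc <;> nlinarith
    · rintro ⟨⟨a1, a2⟩, a3, a4⟩
      refine ⟨?_, ?_, ?_, ?_⟩ <;> nlinarith
  rw [hset, Set.ncard_image_of_injective _ hinj, Set.ncard_coe_finset, Finset.card_product,
    Int.card_Ico, Int.card_Ico]
  push_cast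
  rw [Int.toNat_of_nonneg (by linarith), Int.toNat_of_nonneg (by linarith), hgh]
  ring

theorem ncard_halfOpen_segment (b₁ b₂ v₁ v₂ l₁ l₂ D : ℤ) (hD : l₁ * v₁ + l₂ * v₂ = D)
    (hpos : 0 < D) :
    {z : ℤ × ℤ | v₁ * (z.2 - b₂) - v₂ * (z.1 - b₁) = 0 ∧
      0 ≤ l₁ * (z.1 - b₁) + l₂ * (z.2 - b₂) ∧
      l₁ * (z.1 - b₁) + l₂ * (z.2 - b₂) < D}.ncard = Int.gcd v₁ v₂ := by
  have hv : ¬(v₁ = 0 ∧ v₂ = 0) := by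
    rintro ⟨rfl, rfl⟩
    simp at hD
    omega
  obtain ⟨x, y, u, v, hx, hy, huv, hg⟩ := exists_primitive_and_complement v₁ v₂ hv
  obtain ⟨G, hG⟩ : ∃ G, G = Int.gcd v₁ v₂ := ⟨_, rfl⟩
  rw [← hG] at hx hy hg ⊢
  have hgl : D = G * (l₁ * x + l₂ * y) := by rw [← hD, hx, hy]; ring
  have hl : 0 < l₁ * x + l₂ * y := pos_of_mul_pos_right (hgl ▸ hpos) hg.le
  let f : ℤ → ℤ × ℤ := fun k => (b₁ + k * x, b₂ + k * y)
  have hinj : Function.Injective f := by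
    intro k k' hf
    simp only [f, Prod.mk.injEq] at hf
    obtain ⟨f1, f2⟩ := hf
    linear_combination v * f1 - u * f2 + (k' - k) * huv
  have hset : {z : ℤ × ℤ | v₁ * (z.2 - b₂) - v₂ * (z.1 - b₁) = 0 ∧
      0 ≤ l₁ * (z.1 - b₁) + l₂ * (z.2 - b₂) ∧
      l₁ * (z.1 - b₁) + l₂ * (z.2 - b₂) < D} =
      f '' ((Finset.Ico 0 (G : ℤ) : Finset ℤ) : Set ℤ) := by
    ext ⟨z₁, z₂⟩
    simp only [Set.mem_ofPred_eq, Set.mem_image, Finset.coe_Ico, Set.mem_Ico, f, Prod.mk.injEq]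
    constructor
    · rintro ⟨h0, h1, h2⟩
      have h0' : x * (z₂ - b₂) - y * (z₁ - b₁) = 0 := by
        apply mul_left_cancel₀ hg.ne'
        rw [hx, hy] at h0
        linear_combination h0
      obtain ⟨k, hk⟩ : ∃ k, k = (z₁ - b₁) * v - (z₂ - b₂) * u := ⟨_, rfl⟩
      have e1 : z₁ - b₁ = k * x := by
        linear_combination (-x) * hk + u * h0' - (z₁ - b₁) * huv
      have e2 : z₂ - b₂ = k * y := by
        linear_combination (-y) * hk + v * h0' - (z₂ - b₂) * huv
      rw [e1, e2] at h1 h2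
      refine ⟨k, ⟨?_, ?_⟩, by linarith, by linarith⟩
      · by_contra! hc
        nlinarith
      · by_contra! hc
        nlinarith
    · rintro ⟨k, ⟨k0, k1⟩, rfl, rfl⟩
      refine ⟨by rw [hx, hy]; ring, ?_, ?_⟩ <;> nlinarith
  rw [hset, Set.ncard_image_of_injective _ hinj, Set.ncard_coe_finset, Int.card_Ico]
  simp

/-- Pick's formula for a lattice triangle with one vertex at the origin. -/
theorem two_mul_ncard_triangle (p₁ p₂ q₁ q₂ D : ℤ) (hD : p₁ * q₂ - p₂ * q₁ = D)
    (hpos : 0 < D) :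
    2 * ({z : ℤ × ℤ | 0 ≤ z.1 * q₂ - z.2 * q₁ ∧ 0 ≤ p₁ * z.2 - p₂ * z.1 ∧
      (z.1 * q₂ - z.2 * q₁) + (p₁ * z.2 - p₂ * z.1) ≤ D}.ncard : ℤ) =
      D + Int.gcd p₁ p₂ + Int.gcd q₁ q₂ + Int.gcd (q₁ - p₁) (q₂ - p₂) + 2 := by
  let A : ℤ × ℤ → ℤ := fun z => z.1 * q₂ - z.2 * q₁
  let B : ℤ × ℤ → ℤ := fun z => p₁ * z.2 - p₂ * z.1
  have hAB : ∀ z w, A z = A w → B z = B w → z = w := by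
    rintro ⟨z₁, z₂⟩ ⟨w₁, w₂⟩ h1 h2
    simp only [A, B] at h1 h2
    have e1 : z₁ = w₁ := by
      apply mul_left_cancel₀ hpos.ne'
      rw [← hD]
      linear_combination p₁ * h1 + q₁ * h2
    have e2 : z₂ = w₂ := by
      apply mul_left_cancel₀ hpos.ne'
      rw [← hD]
      linear_combination p₂ * h1 + q₂ * h2
    rw [e1, e2]
  let T : Set (ℤ × ℤ) := {z | 0 ≤ A z ∧ 0 ≤ B z ∧ A z + B z ≤ D}
  let T' : Set (ℤ × ℤ) := {z | A z ≤ D ∧ B z ≤ D ∧ D ≤ A z + B z}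
  let H : Set (ℤ × ℤ) := {z | 0 ≤ A z ∧ A z < D ∧ 0 ≤ B z ∧ B z < D}
  let S₁ : Set (ℤ × ℤ) := {z | A z = D ∧ 0 ≤ B z ∧ B z < D}
  let S₂ : Set (ℤ × ℤ) := {z | B z = D ∧ 0 ≤ A z ∧ A z < D}
  let S₃ : Set (ℤ × ℤ) := {z | A z + B z = D ∧ 0 ≤ B z ∧ B z < D}
  have hH : (H.ncard : ℤ) = D := ncard_halfOpen_parallelogram p₁ p₂ q₁ q₂ D hD hpos
  have hS₁ : S₁.ncard = Int.gcd q₁ q₂ := by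
    rw [← ncard_halfOpen_segment p₁ p₂ q₁ q₂ (-p₂) p₁ D (by linarith) hpos]
    congr 1
    ext z
    simp only [S₁, A, B, Set.mem_ofPred_eq]
    constructor <;> rintro ⟨h1, h2, h3⟩ <;> refine ⟨?_, ?_, ?_⟩ <;> linarith
  have hS₂ : S₂.ncard = Int.gcd p₁ p₂ := by
    rw [← ncard_halfOpen_segment q₁ q₂ p₁ p₂ q₂ (-q₁) D (by linarith) hpos]
    congr 1
    ext z
    simp only [S₂, A, B, Set.mem_ofPred_eq]
    constructor <;> rintro ⟨h1, h2, h3⟩ <;> refine ⟨?_, ?_, ?_⟩ <;> linarith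
  have hS₃ : S₃.ncard = Int.gcd (q₁ - p₁) (q₂ - p₂) := by
    rw [← ncard_halfOpen_segment p₁ p₂ (q₁ - p₁) (q₂ - p₂) (-p₂) p₁ D (by linarith) hpos]
    congr 1
    ext z
    simp only [S₃, A, B, Set.mem_ofPred_eq]
    constructor <;> rintro ⟨h1, h2, h3⟩ <;> refine ⟨?_, ?_, ?_⟩ <;> linarith
  have fH : H.Finite := by
    apply Set.finite_of_ncard_pos
    omega
  have posgcd : ∀ x y l k : ℤ, l * x + k * y = D → 0 < Int.gcd x y := by
    intro x y l k h
    rw [Int.gcd_pos_iff]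
    by_contra! hc
    rw [hc.1, hc.2] at h
    simp at h
    omega
  have f₁ : S₁.Finite := Set.finite_of_ncard_pos (hS₁ ▸ posgcd q₁ q₂ (-p₂) p₁ (by linarith))
  have f₂ : S₂.Finite := Set.finite_of_ncard_pos (hS₂ ▸ posgcd p₁ p₂ q₂ (-q₁) (by linarith))
  have f₃ : S₃.Finite :=
    Set.finite_of_ncard_pos (hS₃ ▸ posgcd (q₁ - p₁) (q₂ - p₂) (-p₂) p₁ (by linarith))
  have Apq : A (p₁ + q₁, p₂ + q₂) = D := by simp only [A]; linarith
  have Bpq : B (p₁ + q₁, p₂ + q₂) = D := by simp only [B]; linarith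
  have Aq : A (q₁, q₂) = 0 := by simp only [A]; ring
  have Bq : B (q₁, q₂) = D := by simp only [B]; linarith
  have hunion : T ∪ T' = insert (p₁ + q₁, p₂ + q₂) (H ∪ S₁ ∪ S₂) := by
    ext z
    simp only [Set.mem_union, Set.mem_insert_iff, T, T', H, S₁, S₂, Set.mem_ofPred_eq]
    constructor
    · intro h
      by_cases hz : A z = D ∧ B z = D
      · exact Or.inl (hAB _ _ (hz.1.trans Apq.symm) (hz.2.trans Bpq.symm))
      · right
        omega
    · rintro (rfl | h)
      · omega
      · omega
  have hinter : T ∩ T' = insert (q₁, q₂) S₃ := by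
    ext z
    simp only [Set.mem_inter_iff, Set.mem_insert_iff, T, T', S₃, Set.mem_ofPred_eq]
    constructor
    · intro h
      by_cases hz : B z = D
      · exact Or.inl (hAB _ _ (by omega) (by omega))
      · right
        omega
    · rintro (rfl | h)
      · omega
      · omega
  have fU : (T ∪ T').Finite := by
    rw [hunion]
    exact ((fH.union f₁).union f₂).insert _
  have hTT' : T'.ncard = T.ncard := by
    have hinj : Function.Injective (fun z : ℤ × ℤ => ((p₁ + q₁, p₂ + q₂) : ℤ × ℤ) - z) :=
      sub_right_injective
    rw [← Set.ncard_image_of_injective T hinj]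
    congr 1
    have hA : ∀ z, A ((p₁ + q₁, p₂ + q₂) - z) = D - A z := by
      intro z
      simp only [A, Prod.fst_sub, Prod.snd_sub]
      linarith
    have hB : ∀ z, B ((p₁ + q₁, p₂ + q₂) - z) = D - B z := by
      intro z
      simp only [B, Prod.fst_sub, Prod.snd_sub]
      linarith
    ext z
    simp only [Set.mem_image]
    constructor
    · rintro ⟨h1, h2, h3⟩
      refine ⟨(p₁ + q₁, p₂ + q₂) - z, ?_, by simp⟩
      simp only [T, Set.mem_ofPred_eq, hA, hB]
      omega
    · rintro ⟨w, ⟨h1, h2, h3⟩, rfl⟩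
      simp only [T', Set.mem_ofPred_eq, hA, hB]
      omega
  have hcU : (T ∪ T').ncard = H.ncard + S₁.ncard + S₂.ncard + 1 := by
    rw [hunion, Set.ncard_insert_of_notMem _ ((fH.union f₁).union f₂),
      Set.ncard_union_eq _ (fH.union f₁) f₂, Set.ncard_union_eq _ fH f₁]
    · rw [Set.disjoint_left]
      simp only [H, S₁, Set.mem_ofPred_eq]
      intro z
      omega
    · rw [Set.disjoint_left]
      simp only [H, S₁, S₂, Set.mem_union, Set.mem_ofPred_eq]
      intro z
      omega
    · simp only [H, S₁, S₂, Set.mem_union, Set.mem_ofPred_eq]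
      omega
  have hcI : (T ∩ T').ncard = S₃.ncard + 1 := by
    rw [hinter, Set.ncard_insert_of_notMem _ f₃]
    simp only [S₃, Set.mem_ofPred_eq]
    omega
  have hsum := Set.ncard_union_add_ncard_inter T T'
    (fU.subset Set.subset_union_left) (fU.subset Set.subset_union_right)
  change 2 * (T.ncard : ℤ) = _
  omega

theorem mem_smul_convexHull_zero_pair {E : Type*} [AddCommGroup E] [Module ℝ E] (P Q x : E)
    {t : ℝ} (ht : 0 < t) :
    x ∈ t • convexHull ℝ {0, P, Q} ↔
      ∃ lam mu : ℝ, 0 ≤ lam ∧ 0 ≤ mu ∧ lam + mu ≤ t ∧ lam • P + mu • Q = x := by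
  rw [convexHull_insert (by simp), convexHull_pair, Set.mem_smul_set]
  simp only [mem_convexJoin, Set.mem_singleton_iff, exists_eq_left]
  constructor
  · rintro ⟨y, ⟨z, ⟨k, l, hk, hl, hkl, rfl⟩, ⟨k', l', hk', hl', hkl', rfl⟩⟩, rfl⟩
    refine ⟨t * l' * k, t * l' * l, by positivity, by positivity, ?_, by module⟩
    have : t * l' * k + t * l' * l = t * l' := by linear_combination t * l' * hkl
    rw [this]
    nlinarith
  · rintro ⟨lam, mu, hl, hm, hlm, rfl⟩
    rcases (add_nonneg hl hm).eq_or_lt with h0 | h0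
    · have e1 : lam = 0 := by linarith
      have e2 : mu = 0 := by linarith
      subst e1 e2
      exact ⟨0, ⟨P, left_mem_segment ℝ P Q, left_mem_segment ℝ 0 P⟩, by simp⟩
    · refine ⟨t⁻¹ • (lam • P + mu • Q), ⟨(lam + mu)⁻¹ • (lam • P + mu • Q),
        ⟨lam / (lam + mu), mu / (lam + mu), by positivity, by positivity, by field_simp, ?_⟩,
        ⟨1 - (lam + mu) / t, (lam + mu) / t, ?_, by positivity, by ring, ?_⟩⟩, ?_⟩
      · module
      · rw [sub_nonneg, div_le_one ht]
        exact hlm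
      · rw [smul_zero, zero_add, smul_smul]
        congr 1
        field_simp
      · rw [smul_smul, mul_inv_cancel₀ ht.ne', one_smul]

/-- Pick's formula for dilates of a triangle in a plane `N ⬝ z = 0` whose integer points are the
combinations of `v` and `w`. -/
theorem two_mul_ncard_smul_triangle_of_plane (N v w P Q : Fin 3 → ℤ) (p₁ p₂ q₁ q₂ D : ℤ)
    (hNv : N ⬝ᵥ v = 0) (hNw : N ⬝ᵥ w = 0)
    (hsat : ∀ z : Fin 3 → ℤ, N ⬝ᵥ z = 0 → ∃ x y : ℤ, x • v + y • w = z)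
    (hind : ∀ x y : ℝ, (∀ i, x * v i + y * w i = 0) → x = 0 ∧ y = 0)
    (hP : P = p₁ • v + p₂ • w) (hQ : Q = q₁ • v + q₂ • w)
    (hD : p₁ * q₂ - p₂ * q₁ = D) (hpos : 0 < D) (t : ℕ) (ht : 0 < t) :
    2 * ({z : Fin 3 → ℤ | (fun i => (z i : ℝ)) ∈
      (t : ℝ) • convexHull ℝ {0, (fun i => (P i : ℝ)), (fun i => (Q i : ℝ))}}.ncard : ℤ) =
      D * t ^ 2 + (Int.gcd p₁ p₂ + Int.gcd q₁ q₂ + Int.gcd (q₁ - p₁) (q₂ - p₂)) * t + 2 := by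
  have ht' : (0 : ℝ) < t := by exact_mod_cast ht
  have hpick := two_mul_ncard_triangle (t * p₁) (t * p₂) (t * q₁) (t * q₂) (D * t ^ 2)
    (by linear_combination (t : ℤ) ^ 2 * hD) (by positivity)
  rw [← mul_sub, ← mul_sub, Int.gcd_mul_left, Int.gcd_mul_left, Int.gcd_mul_left] at hpick
  let φ : ℤ × ℤ → Fin 3 → ℤ := fun z => z.1 • v + z.2 • w
  have hφ : Function.Injective φ := by
    rintro ⟨x, y⟩ ⟨x', y'⟩ h
    obtain ⟨h1, h2⟩ := hind (x - x') (y - y') fun i => by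
      have := congrFun h i
      simp only [φ, Pi.add_apply, Pi.smul_apply, smul_eq_mul] at this
      have : (x : ℝ) * v i + y * w i = x' * v i + y' * w i := by exact_mod_cast this
      linear_combination this
    rw [Prod.mk.injEq]
    constructor
    · exact_mod_cast sub_eq_zero.mp h1
    · exact_mod_cast sub_eq_zero.mp h2
  have hset : {z : Fin 3 → ℤ | (fun i => (z i : ℝ)) ∈
      (t : ℝ) • convexHull ℝ {0, (fun i => (P i : ℝ)), (fun i => (Q i : ℝ))}} =
      φ '' {z : ℤ × ℤ | 0 ≤ z.1 * (t * q₂) - z.2 * (t * q₁) ∧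
        0 ≤ t * p₁ * z.2 - t * p₂ * z.1 ∧
        (z.1 * (t * q₂) - z.2 * (t * q₁)) + (t * p₁ * z.2 - t * p₂ * z.1) ≤ D * t ^ 2} := by
    have hPi : ∀ i, (P i : ℝ) = p₁ * v i + p₂ * w i := fun i => by rw [hP]; simp
    have hQi : ∀ i, (Q i : ℝ) = q₁ * v i + q₂ * w i := fun i => by rw [hQ]; simp
    have hDr : (p₁ : ℝ) * q₂ - p₂ * q₁ = D := by exact_mod_cast hD
    have hposr : (0 : ℝ) < D := by exact_mod_cast hpos
    ext z
    rw [Set.mem_ofPred_eq, mem_smul_convexHull_zero_pair _ _ _ ht']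
    constructor
    · rintro ⟨lam, mu, hl, hm, hlm, hz⟩
      have hzi : ∀ i, lam * P i + mu * Q i = z i := fun i => congrFun hz i
      obtain ⟨x, y, rfl⟩ : ∃ x y : ℤ, x • v + y • w = z := by
        apply hsat
        have e1 : (N 0 : ℝ) * v 0 + N 1 * v 1 + N 2 * v 2 = 0 := by
          simp only [dotProduct, Fin.sum_univ_three] at hNv
          exact_mod_cast hNv
        have e2 : (N 0 : ℝ) * w 0 + N 1 * w 1 + N 2 * w 2 = 0 := by
          simp only [dotProduct, Fin.sum_univ_three] at hNw
          exact_mod_cast hNw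
        have : (N 0 : ℝ) * z 0 + N 1 * z 1 + N 2 * z 2 = 0 := by
          simp only [← hzi, hPi, hQi]
          linear_combination (lam * p₁ + mu * q₁) * e1 + (lam * p₂ + mu * q₂) * e2
        simp only [dotProduct, Fin.sum_univ_three]
        exact_mod_cast this
      refine ⟨(x, y), ?_, rfl⟩
      obtain ⟨h1, h2⟩ := hind (x - (lam * p₁ + mu * q₁)) (y - (lam * p₂ + mu * q₂)) fun i => by
        have := hzi i
        rw [hPi, hQi] at this
        simp only [Pi.add_apply, Pi.smul_apply, smul_eq_mul, Int.cast_add, Int.cast_mul] at this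
        linear_combination -this
      have hA : (x : ℝ) * (t * q₂) - y * (t * q₁) = t * (lam * D) := by
        rw [← hDr]
        linear_combination t * q₂ * h1 - t * q₁ * h2
      have hB : (t : ℝ) * p₁ * y - t * p₂ * x = t * (mu * D) := by
        rw [← hDr]
        linear_combination t * p₁ * h2 - t * p₂ * h1
      have i1 : (0 : ℝ) ≤ x * (t * q₂) - y * (t * q₁) := by rw [hA]; positivity
      have i2 : (0 : ℝ) ≤ t * p₁ * y - t * p₂ * x := by rw [hB]; positivity
      have i3 : (x : ℝ) * (t * q₂) - y * (t * q₁) + (t * p₁ * y - t * p₂ * x) ≤ D * t ^ 2 := by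
        rw [hA, hB]
        nlinarith [mul_pos ht' hposr]
      refine ⟨?_, ?_, ?_⟩
      · exact_mod_cast i1
      · exact_mod_cast i2
      · exact_mod_cast i3
    · rintro ⟨⟨x, y⟩, ⟨h1, h2, h3⟩, rfl⟩
      have i1 : (0 : ℝ) ≤ x * (t * q₂) - y * (t * q₁) := by exact_mod_cast h1
      have i2 : (0 : ℝ) ≤ t * p₁ * y - t * p₂ * x := by exact_mod_cast h2
      have i3 : (x : ℝ) * (t * q₂) - y * (t * q₁) + (t * p₁ * y - t * p₂ * x) ≤ D * t ^ 2 := by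
        exact_mod_cast h3
      refine ⟨(x * (t * q₂) - y * (t * q₁)) / (t * D), (t * p₁ * y - t * p₂ * x) / (t * D),
        by positivity, by positivity, ?_, ?_⟩
      · rw [← add_div, div_le_iff₀ (by positivity)]
        linarith
      · funext i
        simp only [φ, Pi.add_apply, Pi.smul_apply, smul_eq_mul, Int.cast_add, Int.cast_mul, hPi,
          hQi]
        field_simp
        rw [← hDr]
        ring
  rw [hset, Set.ncard_image_of_injective _ hφ]
  simp only [Int.natAbs_natCast] at hpick
  rw [hpick]
  push_cast
  ring

/-- The integer points of the plane through the origin with primitive normal `(a, b, c)`, where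
`a = g * a'` and `b = g * b'` with `a'`, `b'` coprime, are generated by `(-b', a', 0)` and any integer
point of the plane at height `g`. -/
theorem exists_eq_smul_add_smul_of_dotProduct_eq_zero (a b c g a' b' : ℤ) (ha : a = g * a')
    (hb : b = g * b') (hg : g ≠ 0) (hcop : IsCoprime a' b') (hgc : IsCoprime g c)
    (w : Fin 3 → ℤ) (hw : ![a, b, c] ⬝ᵥ w = 0) (hw2 : w 2 = g) (z : Fin 3 → ℤ)
    (hz : ![a, b, c] ⬝ᵥ z = 0) : ∃ x y : ℤ, x • ![-b', a', 0] + y • w = z := by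
  simp only [dotProduct, Fin.sum_univ_three, Matrix.cons_val] at hw hz
  have hdvd : g ∣ z 2 := by
    apply hgc.dvd_of_dvd_mul_left
    exact ⟨-(a' * z 0 + b' * z 1), by rw [ha, hb] at hz; linear_combination hz⟩
  obtain ⟨y, hy⟩ := hdvd
  have h0 : a' * (z 0 - y * w 0) + b' * (z 1 - y * w 1) = 0 := by
    apply mul_left_cancel₀ hg
    rw [ha, hb] at hz hw
    linear_combination hz - y * hw - c * hy + y * c * hw2
  obtain ⟨i, j, hij⟩ := hcop
  refine ⟨i * (z 1 - y * w 1) - j * (z 0 - y * w 0), y, ?_⟩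
  funext k
  fin_cases k
  · simp
    linear_combination (z 0 - y * w 0) * hij - i * h0
  · simp
    linear_combination (z 1 - y * w 1) * hij - j * h0
  · simp
    linear_combination y * hw2 - hy

theorem stmt_16 (a b c d r s rt st α β : ℤ)
    (hgcd : Int.gcd (Int.gcd a b : ℤ) c = 1)
    (hsum : a ^ 2 + b ^ 2 + c ^ 2 = 3 * d ^ 2)
    (hd : 1 ≤ d) (hab : ¬(a = 0 ∧ b = 0))
    (hq : 2 * (a ^ 2 + b ^ 2) = s ^ 2 + 3 * r ^ 2)
    (h1 : (a ^ 2 + b ^ 2) ∣ (r * a * c + d * b * s))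
    (h2 : (a ^ 2 + b ^ 2) ∣ (d * a * s - b * c * r))
    (h3 : (a ^ 2 + b ^ 2) ∣ (3 * d * b * r - a * c * s))
    (h4 : (a ^ 2 + b ^ 2) ∣ (3 * d * a * r + b * c * s))
    (hr : r = (Int.gcd a b : ℤ) * rt)
    (hs : s = (Int.gcd a b : ℤ) * st)
    (hrs : Even (rt + st))
    (ζ ς : Fin 3 → ℤ)
    (hζ : ζ = ![-(r * a * c + d * b * s) / (a ^ 2 + b ^ 2),
                 (d * a * s - b * c * r) / (a ^ 2 + b ^ 2), r])
    (hς : ς = ![(3 * d * b * r - a * c * s) / (a ^ 2 + b ^ 2),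
                 -(3 * d * a * r + b * c * s) / (a ^ 2 + b ^ 2), s])
    (heven : ∀ i, Even (ζ i + ς i))
    (η : Fin 3 → ℤ) (hη : η = fun i => (ζ i + ς i) / 2)
    (hαβ : ((rt + st) / 2) * β + rt * α = d)
    (hdiv : ∀ i, d ∣ (α * ζ i + β * η i))
    (m n : ℤ) (hmn : Int.gcd m n = 1)
    (P Q : Fin 3 → ℤ)
    (hP : P = m • ζ - n • η) (hQ : Q = n • ζ + (m - n) • η)
    (Δ : Set (Fin 3 → ℝ))
    (hΔ : Δ = convexHull ℝ {0, (fun i => (P i : ℝ)), (fun i => (Q i : ℝ))})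
    (c₁ : ℤ)
    (hc₁ : c₁ =
      Int.gcd (m * ((rt + st) / 2) + n * ((rt - st) / 2)) (m * α - n * (α + β)) +
      Int.gcd (m * rt - n * ((rt + st) / 2)) (m * β + n * α) +
      Int.gcd (m * ((st - rt) / 2) + n * rt) (m * (α + β) - n * β))
    (t : ℕ) (ht : 0 < t) :
    (({p : Fin 3 → ℤ | (fun i => (p i : ℝ)) ∈ (t : ℝ) • Δ}).ncard : ℚ) =
      ((d : ℚ) * ((m : ℚ) ^ 2 - (m : ℚ) * (n : ℚ) + (n : ℚ) ^ 2) * (t : ℚ) ^ 2 +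
        (c₁ : ℚ) * (t : ℚ)) / 2 + 1 := by
  have hgpos : 0 < (Int.gcd a b : ℤ) := by
    have h : 0 < Int.gcd a b := by rw [Int.gcd_pos_iff]; tauto
    exact_mod_cast h
  have hgc := Int.isCoprime_iff_gcd_eq_one.mpr hgcd
  obtain ⟨a', b', u, v, ha, hb, huv, -⟩ := exists_primitive_and_complement a b hab
  have hcop : IsCoprime a' b' := ⟨v, -u, by linear_combination huv⟩
  set g : ℤ := (Int.gcd a b : ℤ)
  have hqpos : 0 < a ^ 2 + b ^ 2 := by
    rcases not_and_or.mp hab with h | h <;> positivity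
  obtain ⟨k₁, hk₁⟩ := h1
  obtain ⟨k₂, hk₂⟩ := h2
  obtain ⟨k₃, hk₃⟩ := h3
  obtain ⟨k₄, hk₄⟩ := h4
  obtain ⟨R, hR⟩ := hrs
  rw [hk₁, hk₂, neg_mul_eq_mul_neg, Int.mul_ediv_cancel_left _ hqpos.ne',
    Int.mul_ediv_cancel_left _ hqpos.ne'] at hζ
  rw [hk₃, hk₄, neg_mul_eq_mul_neg, Int.mul_ediv_cancel_left _ hqpos.ne',
    Int.mul_ediv_cancel_left _ hqpos.ne'] at hς
  have hη2 : ∀ i, 2 * η i = ζ i + ς i := fun i => by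
    rw [hη]
    exact Int.mul_ediv_cancel' (heven i).two_dvd
  have hRa : (rt + st) / 2 = R := by omega
  have hRb : (rt - st) / 2 = rt - R := by omega
  have hRc : (st - rt) / 2 = R - rt := by omega
  rw [hRa, hRb, hRc] at hc₁
  rw [hRa] at hαβ
  have hst : st = 2 * R - rt := by linear_combination hR
  have hNζ : ![a, b, c] ⬝ᵥ ζ = 0 := by
    simp only [hζ, dotProduct, Fin.sum_univ_three, Matrix.cons_val]
    apply mul_left_cancel₀ hqpos.ne'
    linear_combination a * hk₁ - b * hk₂
  have hNς : ![a, b, c] ⬝ᵥ ς = 0 := by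
    simp only [hς, dotProduct, Fin.sum_univ_three, Matrix.cons_val]
    apply mul_left_cancel₀ hqpos.ne'
    linear_combination -a * hk₃ + b * hk₄
  have hdet : ∀ i, R * ζ i - rt * η i = d * (![-b', a', 0] : Fin 3 → ℤ) i := by
    suffices h : ∀ i, st * ζ i - rt * ς i = 2 * (d * (![-b', a', 0] : Fin 3 → ℤ) i) by
      intro i
      apply mul_left_cancel₀ (two_ne_zero (α := ℤ))
      linear_combination h i - rt * hη2 i - ζ i * hst
    intro i
    have hgq := (mul_pos hgpos hqpos).ne'
    rw [hζ, hς]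
    fin_cases i
    · change st * -k₁ - rt * k₃ = 2 * (d * -b')
      apply mul_left_cancel₀ hgq
      linear_combination (g * st) * hk₁ + (g * rt) * hk₃ + (r * a * c + d * b * s) * hs
        + (3 * d * b * r - a * c * s) * hr + d * b * hq - (2 * d * (a ^ 2 + b ^ 2)) * hb
    · change st * k₂ - rt * -k₄ = 2 * (d * a')
      apply mul_left_cancel₀ hgq
      linear_combination (-g * st) * hk₂ - (g * rt) * hk₄ - (d * a * s - b * c * r) * hs
        - (3 * d * a * r + b * c * s) * hr - d * a * hq + (2 * d * (a ^ 2 + b ^ 2)) * ha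
    · change st * r - rt * s = 2 * (d * 0)
      linear_combination st * hr - rt * hs
  choose w hw using hdiv
  have hd0 : d ≠ 0 := by omega
  have hζw : ∀ i, ζ i = β * (![-b', a', 0] : Fin 3 → ℤ) i + rt * w i := fun i => by
    apply mul_left_cancel₀ hd0
    linear_combination β * hdet i + rt * hw i - ζ i * hαβ
  have hηw : ∀ i, η i = -α * (![-b', a', 0] : Fin 3 → ℤ) i + R * w i := fun i => by
    apply mul_left_cancel₀ hd0
    linear_combination -α * hdet i + R * hw i - η i * hαβ
  have hw2 : w 2 = g := by
    have hζ2 : ζ 2 = r := by simp [hζ]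
    have hς2 : ς 2 = s := by simp [hς]
    apply mul_left_cancel₀ (mul_ne_zero two_ne_zero hd0)
    linear_combination -2 * hw 2 + β * hη2 2 + (2 * α + β) * hζ2 + β * hς2 + (2 * α + β) * hr
      + β * hs + 2 * g * hαβ + β * g * hR
  have hNw : ![a, b, c] ⬝ᵥ w = 0 := by
    simp only [dotProduct, Fin.sum_univ_three, Matrix.cons_val] at hNζ hNς ⊢
    apply mul_left_cancel₀ (mul_ne_zero two_ne_zero hd0)
    linear_combination -2 * (a * hw 0 + b * hw 1 + c * hw 2)
      + β * (a * hη2 0 + b * hη2 1 + c * hη2 2) + (2 * α + β) * hNζ + β * hNς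
  have hform : 0 < m ^ 2 - m * n + n ^ 2 := by
    have h : m ≠ 0 ∨ n ≠ 0 := by
      by_contra! h
      rw [h.1, h.2] at hmn
      simp at hmn
    have h4 : 4 * (m ^ 2 - m * n + n ^ 2) = (2 * m - n) ^ 2 + 3 * n ^ 2 := by ring
    have h4' : 4 * (m ^ 2 - m * n + n ^ 2) = (2 * n - m) ^ 2 + 3 * m ^ 2 := by ring
    rcases h with h | h
    · have : 0 < (2 * n - m) ^ 2 + 3 * m ^ 2 := by positivity
      omega
    · have : 0 < (2 * m - n) ^ 2 + 3 * n ^ 2 := by positivity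
      omega
  have hcount := two_mul_ncard_smul_triangle_of_plane ![a, b, c] ![-b', a', 0] w P Q
    (m * β + n * α) (m * rt - n * R) (-(m * α - n * (α + β))) (m * R + n * (rt - R))
    (d * (m ^ 2 - m * n + n ^ 2))
    (by
      simp only [dotProduct, Fin.sum_univ_three, Matrix.cons_val]
      linear_combination -b' * ha + a' * hb)
    hNw
    (exists_eq_smul_add_smul_of_dotProduct_eq_zero a b c g a' b' ha hb hgpos.ne' hcop hgc w hNw
      hw2)
    (by
      intro x y h
      have h0 := h 0
      have h1 := h 1
      have h2 := h 2
      rw [hw2] at h2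
      simp [hgpos.ne'] at h0 h1 h2
      subst h2
      have huv' : (a' : ℝ) * v - b' * u = 1 := by exact_mod_cast huv
      exact ⟨by linear_combination -x * huv' + u * h0 + v * h1, rfl⟩)
    (by
      funext i
      simp only [hP, Pi.sub_apply, Pi.add_apply, Pi.smul_apply, smul_eq_mul]
      rw [hζw i, hηw i]
      ring)
    (by
      funext i
      simp only [hQ, Pi.add_apply, Pi.smul_apply, smul_eq_mul]
      rw [hζw i, hηw i]
      ring)
    (by linear_combination (m ^ 2 - m * n + n ^ 2) * hαβ)
    (by positivity) t ht
  have e₃ : -(m * α - n * (α + β)) - (m * β + n * α) = -(m * (α + β) - n * β) := by ring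
  have e₄ : m * R + n * (rt - R) - (m * rt - n * R) = m * (R - rt) + n * rt := by ring
  rw [e₃, e₄, Int.gcd_comm (m * β + n * α), Int.gcd_comm (-(m * α - n * (α + β))),
    Int.gcd_comm (-(m * (α + β) - n * β)), Int.gcd_neg, Int.gcd_neg, ← hΔ] at hcount
  have hcount' : 2 * (({p : Fin 3 → ℤ | (fun i => (p i : ℝ)) ∈ (t : ℝ) • Δ}).ncard : ℤ) =
      d * (m ^ 2 - m * n + n ^ 2) * t ^ 2 + c₁ * t + 2 := by
    rw [hcount, hc₁]
    ring
  have hcountq : 2 * (({p : Fin 3 → ℤ | (fun i => (p i : ℝ)) ∈ (t : ℝ) • Δ}).ncard : ℚ) =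
      d * (m ^ 2 - m * n + n ^ 2) * t ^ 2 + c₁ * t + 2 := by
    exact_mod_cast hcount'
  linear_combination hcountq / 2
end

section
/- Let k and ℓ be positive integers with k odd and gcd(k, ℓ) = 1, and set d = 2ℓ² + k². If k ≢ ℓ (mod 3), then a = |2ℓ² + 2kℓ − k²| and c = |k² + 4kℓ − 2ℓ²| satisfy 2a² + c² = 3d² and gcd(a, c) = 1. If k ≢ −ℓ (mod 3), then a = |2ℓ² − 2kℓ − k²| and c = |k² − 4kℓ − 2ℓ²| satisfy 2a² + c² = 3d² and gcd(a, c) = 1. -/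
/-- On coprime arguments with `k` odd and `k ≢ l (mod 3)`, the two forms take coprime values. -/
lemma isCoprime_quadratic_forms {k l : ℤ} (hkodd : Odd k) (hkl : IsCoprime k l)
    (h3 : ¬ k ≡ l [ZMOD 3]) :
    IsCoprime (2 * l ^ 2 + 2 * k * l - k ^ 2) (k ^ 2 + 4 * k * l - 2 * l ^ 2) := by
  have hk2 : IsCoprime k 2 := by
    obtain ⟨m, rfl⟩ := hkodd
    exact ⟨1, -m, by ring⟩
  have coprime_two : IsCoprime (2 * l ^ 2 + 2 * k * l - k ^ 2) 2 := by
    have h : IsCoprime (-k ^ 2 + 2 * (l ^ 2 + k * l)) 2 :=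
      (hk2.pow_left (m := 2)).neg_left.add_mul_left_left _
    convert h using 1
    ring
  have coprime_k : IsCoprime (2 * l ^ 2 + 2 * k * l - k ^ 2) k := by
    have h : IsCoprime (2 * l ^ 2 + k * (2 * l - k)) k :=
      (hk2.symm.mul_left (hkl.symm.pow_left (m := 2))).add_mul_left_left _
    convert h using 1
    ring
  have coprime_l : IsCoprime (2 * l ^ 2 + 2 * k * l - k ^ 2) l := by
    have h : IsCoprime (-k ^ 2 + l * (2 * l + 2 * k)) l :=
      (hkl.pow_left (m := 2)).neg_left.add_mul_left_left _
    convert h using 1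
    ring
  have coprime_three : IsCoprime (2 * l ^ 2 + 2 * k * l - k ^ 2) 3 := by
    refine ((Int.prime_three.coprime_iff_not_dvd).mpr fun hdvd ↦ h3 ?_).symm
    have hsq : (3 : ℤ) ∣ (l - k) ^ 2 := by
      have h := dvd_sub (dvd_mul_right (3 : ℤ) (l ^ 2)) hdvd
      rwa [show 3 * l ^ 2 - (2 * l ^ 2 + 2 * k * l - k ^ 2) = (l - k) ^ 2 by ring] at h
    exact (Int.modEq_iff_dvd).mpr (Int.prime_three.dvd_of_dvd_pow hsq)
  have h : IsCoprime (2 * l ^ 2 + 2 * k * l - k ^ 2)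
      (2 * 3 * k * l + (2 * l ^ 2 + 2 * k * l - k ^ 2) * -1) :=
    (((coprime_two.mul_right coprime_three).mul_right coprime_k).mul_right
      coprime_l).add_mul_left_right _
  convert h using 1
  ring

theorem stmt_17 (k l d : ℤ) (hk : 0 < k) (hl : 0 < l) (hkodd : Odd k)
    (hgcd : Int.gcd k l = 1) (hd : d = 2 * l ^ 2 + k ^ 2) :
    (¬(k ≡ l [ZMOD 3]) →
      2 * |2 * l ^ 2 + 2 * k * l - k ^ 2| ^ 2 + |k ^ 2 + 4 * k * l - 2 * l ^ 2| ^ 2 =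
        3 * d ^ 2 ∧
      Int.gcd (|2 * l ^ 2 + 2 * k * l - k ^ 2|) (|k ^ 2 + 4 * k * l - 2 * l ^ 2|) = 1) ∧
    (¬(k ≡ -l [ZMOD 3]) →
      2 * |2 * l ^ 2 - 2 * k * l - k ^ 2| ^ 2 + |k ^ 2 - 4 * k * l - 2 * l ^ 2| ^ 2 =
        3 * d ^ 2 ∧
      Int.gcd (|2 * l ^ 2 - 2 * k * l - k ^ 2|) (|k ^ 2 - 4 * k * l - 2 * l ^ 2|) = 1) := by
  subst hd
  have hkl : IsCoprime k l := Int.isCoprime_iff_gcd_eq_one.mpr hgcd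
  simp only [sq_abs, ← Int.isCoprime_iff_gcd_eq_one, IsCoprime.abs_abs_iff]
  refine ⟨fun h ↦ ⟨by ring, isCoprime_quadratic_forms hkodd hkl h⟩, fun h ↦ ⟨by ring, ?_⟩⟩
  simpa [sub_eq_add_neg] using isCoprime_quadratic_forms hkodd hkl.neg_right h
end

section
/- Let (a, c, d) be a positive primitive solution of 2a² + c² = 3d² with (a, c, d) ≠ (1, 1, 1). Then there exist positive integers k and ℓ with k odd and gcd(k, ℓ) = 1 such that d = 2ℓ² + k² and either (k ≢ ℓ (mod 3), a = |2ℓ² + 2kℓ − k²| and c = |k² + 4kℓ − 2ℓ²|) or (k ≢ −ℓ (mod 3), a = |2ℓ² − 2kℓ − k²| and c = |k² − 4kℓ − 2ℓ²|). -/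
theorem Int.exists_sq_and_two_mul_sq_of_isCoprime {u v y : ℤ} (huv : IsCoprime u v)
    (hu : 0 ≤ u) (hv : 0 ≤ v) (h : u * v = 2 * y ^ 2) :
    ∃ k l : ℤ, 0 ≤ k ∧ 0 ≤ l ∧ (u = 2 * l ^ 2 ∧ v = k ^ 2 ∨ u = k ^ 2 ∧ v = 2 * l ^ 2) := by
  have eq_sq_abs {x r : ℤ} (hx : 0 ≤ x) (hr : x = r ^ 2 ∨ x = -r ^ 2) : x = |r| ^ 2 := by
    rw [sq_abs]
    rcases hr with hr | hr
    · exact hr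
    · nlinarith [sq_nonneg r]
  have even_left {u v : ℤ} (huv : IsCoprime u v) (hu : 0 ≤ u) (hv : 0 ≤ v)
      (h : u * v = 2 * y ^ 2) (h2 : 2 ∣ u) :
      ∃ k l : ℤ, 0 ≤ k ∧ 0 ≤ l ∧ u = 2 * l ^ 2 ∧ v = k ^ 2 := by
    obtain ⟨w, rfl⟩ := h2
    have hwv : w * v = y ^ 2 := by linarith
    have hcop : IsCoprime w v := huv.of_mul_left_right
    obtain ⟨l, hl⟩ := Int.sq_of_isCoprime hcop hwv
    obtain ⟨k, hk⟩ := Int.sq_of_isCoprime hcop.symm ((mul_comm v w).trans hwv)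
    exact ⟨|k|, |l|, abs_nonneg k, abs_nonneg l,
      by rw [← eq_sq_abs (by linarith) hl], eq_sq_abs hv hk⟩
  rcases Int.prime_two.dvd_or_dvd ⟨y ^ 2, h⟩ with h2 | h2
  · obtain ⟨k, l, hk, hl, h1, h2⟩ := even_left huv hu hv h h2
    exact ⟨k, l, hk, hl, .inl ⟨h1, h2⟩⟩
  · obtain ⟨k, l, hk, hl, h1, h2⟩ := even_left huv.symm hv hu ((mul_comm v u).trans h) h2
    exact ⟨k, l, hk, hl, .inr ⟨h2, h1⟩⟩

/-- Parametrization of the primitive solutions of `X² + 2Y² = d²`. -/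
theorem Int.exists_param_of_sq_add_two_mul_sq_eq_sq {X Y d : ℤ} (hXY : IsCoprime X Y)
    (hd : 0 < d) (h : X ^ 2 + 2 * Y ^ 2 = d ^ 2) :
    ∃ k l : ℤ, 0 ≤ k ∧ 0 ≤ l ∧ Odd k ∧ d = 2 * l ^ 2 + k ^ 2 ∧
      (X = k ^ 2 - 2 * l ^ 2 ∨ X = -(k ^ 2 - 2 * l ^ 2)) ∧
      (Y = 2 * k * l ∨ Y = -(2 * k * l)) := by
  have hparity : Even X ↔ Even d := by
    have := congrArg Even h
    simpa [Int.even_add, Int.even_pow] using this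
  have hX : Odd X := by
    by_contra hX
    rw [Int.not_odd_iff_even] at hX
    obtain ⟨x, rfl⟩ := hX.two_dvd
    obtain ⟨e, rfl⟩ := (hparity.1 hX).two_dvd
    have hY : (2 : ℤ) ∣ Y :=
      Int.prime_two.dvd_of_dvd_pow (n := 2) ⟨e ^ 2 - x ^ 2, by linarith⟩
    exact Int.prime_two.not_isUnit (hXY.isUnit_of_dvd' (dvd_mul_right 2 x) hY)
  have hdodd : Odd d := by
    rw [← Int.not_even_iff_odd] at hX ⊢
    rwa [← hparity]
  obtain ⟨u, hu⟩ := (hdodd.sub_odd hX).two_dvd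
  obtain ⟨v, rfl⟩ : ∃ v, X = v - u := ⟨X + u, by ring⟩
  obtain rfl : d = u + v := by linarith
  have huv : 2 * (u * v) = Y ^ 2 := by linarith
  obtain ⟨y, rfl⟩ : (2 : ℤ) ∣ Y := Int.prime_two.dvd_of_dvd_pow ⟨u * v, huv.symm⟩
  have huv' : u * v = 2 * y ^ 2 := by linarith
  have hcop : IsCoprime u v := by
    refine isCoprime_of_prime_dvd ?_ fun p hp hpu hpv ↦ ?_
    · rintro ⟨rfl, rfl⟩
      simp at hd
    · have hpY : p ∣ 2 * y := hp.dvd_of_dvd_pow (n := 2) (by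
        rw [← huv]
        exact (hpu.mul_right v).mul_left 2)
      exact hp.not_isUnit (hXY.isUnit_of_dvd' (dvd_sub hpv hpu) hpY)
  have hmul : 0 ≤ u * v := by rw [huv']; positivity
  have hu0 : 0 ≤ u := by nlinarith [sq_nonneg u]
  have hv0 : 0 ≤ v := by nlinarith [sq_nonneg v]
  obtain ⟨k, l, hk, hl, hkl⟩ := exists_sq_and_two_mul_sq_of_isCoprime hcop hu0 hv0 huv'
  have hd' : u + v = 2 * l ^ 2 + k ^ 2 := by
    rcases hkl with ⟨rfl, rfl⟩ | ⟨rfl, rfl⟩ <;> ring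
  refine ⟨k, l, hk, hl, ?_, hd', ?_, ?_⟩
  · rw [hd'] at hdodd
    have hk2 : Odd (k ^ 2) := (Int.odd_add'.1 hdodd).2 (even_two_mul _)
    exact (Int.odd_pow' two_ne_zero).1 hk2
  · rcases hkl with ⟨rfl, rfl⟩ | ⟨rfl, rfl⟩
    · exact .inl rfl
    · right; ring
  · apply sq_eq_sq_iff_eq_or_eq_neg.1
    rw [← huv]
    rcases hkl with ⟨rfl, rfl⟩ | ⟨rfl, rfl⟩ <;> ring

theorem stmt_18 (a c d : ℤ) (ha : 0 < a) (hc : 0 < c) (hd : 0 < d)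
    (hgcd : Int.gcd a c = 1) (heq : 2 * a ^ 2 + c ^ 2 = 3 * d ^ 2)
    (hne : ¬(a = 1 ∧ c = 1 ∧ d = 1)) :
    ∃ k l : ℤ, 0 < k ∧ 0 < l ∧ Odd k ∧ Int.gcd k l = 1 ∧
      d = 2 * l ^ 2 + k ^ 2 ∧
      ((¬(k ≡ l [ZMOD 3]) ∧
        a = |2 * l ^ 2 + 2 * k * l - k ^ 2| ∧
        c = |k ^ 2 + 4 * k * l - 2 * l ^ 2|) ∨
       (¬(k ≡ -l [ZMOD 3]) ∧
        a = |2 * l ^ 2 - 2 * k * l - k ^ 2| ∧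
        c = |k ^ 2 - 4 * k * l - 2 * l ^ 2|)) := by
  have hac : IsCoprime a c := Int.isCoprime_iff_gcd_eq_one.2 hgcd
  obtain ⟨b, hb, Y, hY⟩ : ∃ b : ℤ, (b = a ∨ b = -a) ∧ 3 ∣ b + c := by
    have h3 : (3 : ℤ) ∣ (a + c) * (-a + c) := ⟨d ^ 2 - a ^ 2, by linarith⟩
    rcases Int.prime_three.dvd_or_dvd h3 with h | h
    · exact ⟨a, .inl rfl, h⟩
    · exact ⟨-a, .inr rfl, h⟩
  have hba : |b| = a := by
    rcases hb with rfl | rfl <;> simp [abs_of_pos ha]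
  have hbc : IsCoprime b c := by
    rcases hb with rfl | rfl
    · exact hac
    · exact hac.neg_left
  have hb2 : b ^ 2 = a ^ 2 := by rw [← hba, sq_abs]
  obtain ⟨X, rfl⟩ : ∃ X, b = Y - X := ⟨Y - b, by ring⟩
  obtain rfl : c = X + 2 * Y := by linarith
  have hXY : IsCoprime X Y := by
    obtain ⟨r, s, hrs⟩ := hbc
    exact ⟨s - r, r + 2 * s, by linarith⟩
  obtain ⟨k, l, hk, hl, hkodd, hdkl, hX, hYkl⟩ :=
    Int.exists_param_of_sq_add_two_mul_sq_eq_sq hXY hd (by linarith)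
  have hk0 : k ≠ 0 := by
    rintro rfl
    simp at hkodd
  have hkl : IsCoprime k l := by
    refine isCoprime_of_prime_dvd (fun h ↦ hk0 h.1) fun p hp hpk hpl ↦ ?_
    have h1 : p ∣ k ^ 2 - 2 * l ^ 2 :=
      dvd_sub (dvd_pow hpk two_ne_zero) ((dvd_pow hpl two_ne_zero).mul_left 2)
    have h2 : p ∣ 2 * k * l := hpl.mul_left _
    refine hp.not_isUnit (hXY.isUnit_of_dvd' ?_ ?_)
    · rcases hX with rfl | rfl
      · exact h1
      · exact h1.neg_right
    · rcases hYkl with rfl | rfl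
      · exact h2
      · exact h2.neg_right
  have hl0 : l ≠ 0 := by
    rintro rfl
    have hk1 : k = 1 := by
      have := Int.isUnit_iff.1 (isCoprime_zero_right.1 hkl)
      omega
    subst hk1
    have hd1 : d = 1 := by simpa using hdkl
    have hY0 : Y = 0 := by simpa using hYkl
    subst hY0 hd1
    have hX1 : X = 1 := by
      rcases hX with hX | hX <;> linarith
    subst hX1
    exact hne ⟨by simpa using hba.symm, by norm_num, rfl⟩
  have not_both : ¬((3 : ℤ) ∣ a ∧ (3 : ℤ) ∣ X + 2 * Y) := fun h ↦
    Int.prime_three.not_isUnit (hac.isUnit_of_dvd' h.1 h.2)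
  have not_modEq {m : ℤ} (ha' : a = |2 * m ^ 2 + 2 * k * m - k ^ 2|)
      (hc' : X + 2 * Y = |k ^ 2 + 4 * k * m - 2 * m ^ 2|) : ¬(k ≡ m [ZMOD 3]) := by
    intro hmod
    obtain ⟨t, ht⟩ := hmod.dvd
    obtain rfl : m = k + 3 * t := by linarith
    apply not_both
    rw [ha', hc', dvd_abs, dvd_abs]
    exact ⟨⟨k ^ 2 + 6 * k * t + 6 * t ^ 2, by ring⟩, ⟨k ^ 2 - 6 * t ^ 2, by ring⟩⟩
  refine ⟨k, l, by omega, by omega, hkodd, Int.isCoprime_iff_gcd_eq_one.1 hkl, hdkl, ?_⟩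
  have hc' : X + 2 * Y = |X + 2 * Y| := (abs_of_pos hc).symm
  have param : (∃ m, (m = l ∨ m = -l) ∧ a = |2 * m ^ 2 + 2 * k * m - k ^ 2| ∧
      X + 2 * Y = |k ^ 2 + 4 * k * m - 2 * m ^ 2|) := by
    rw [hc', ← hba]
    rcases hX with rfl | rfl <;> rcases hYkl with rfl | rfl
    · exact ⟨l, .inl rfl, by ring_nf, by ring_nf⟩
    · exact ⟨-l, .inr rfl, by ring_nf, by ring_nf⟩
    · refine ⟨-l, .inr rfl, ?_, ?_⟩ <;> rw [← abs_neg] <;> ring_nf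
    · refine ⟨l, .inl rfl, ?_, ?_⟩ <;> rw [← abs_neg] <;> ring_nf
  obtain ⟨m, rfl | rfl, ham, hcm⟩ := param
  · exact .inl ⟨not_modEq ham hcm, ham, hcm⟩
  · refine .inr ⟨not_modEq ham hcm, ?_, ?_⟩
    · rw [ham]; ring_nf
    · rw [hcm]; ring_nf
end
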